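/- The weighted projective space P(1^l, 2^m), embedded into projective space of dimension binom(l+1,2) + m via its minimal very ample embedding, has syzygy spaces R_{p,q} = ⊕ Σ_λ(k^l), where the sum runs over symmetric Young diagrams λ = λ' with 2q boxes, diagonal length 2q − 2p, and at most l rows; i.e., its graded Betti numbers coincide with those of the quadratic Veronese embedding of P^{l−1}. -/

import Mathlib

/-!
STATEMENT 18: The weighted projective space `P(1^l, 2^m)`, embedded into
projective space of dimension `binom (l+1) 2 + m` by its minimal very ample
embedding (by the generators of the degree-2 part), has syzygy spaces
`R_{p,q} = ⊕ Σ_λ(k^l)`, the sum over symmetric Young diagrams `λ = λ'` with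
`2q` boxes, diagonal length `2q − 2p` and at most `l` rows; i.e. its graded
Betti numbers coincide with those of the quadratic Veronese embedding of
`P^{l−1}`.

The homogeneous coordinate ring is `⊕_q A_q` with `A_q` the weighted-degree
`2q` part of `k[x_1,…,x_l,y_1,…,y_m]` (`deg x = 1`, `deg y = 2`); the
embedding space of linear forms is `W = A_1` (the weighted-degree-2 part,
which has dimension `binom (l+1) 2 + m`), and the syzygies are computed by
the Koszul complex `Λ^p W ⊗ A_q` with the standard Koszul differential.  The
conclusion asserts that the dimension of its cohomology at each position
`(p, q)` equals the sum of the dimensions `dim Σ_λ(k^l)` (hook content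
formula) over symmetric diagrams λ with `|λ| = 2q`, `l(λ) = 2q − 2p`
(encoded by the arm set `A ⊆ {0,…,l−1}` of the main hooks:
`A.card + 2p = 2q` and `A.sum = p`).
-/

set_option synthInstance.maxHeartbeats 1000000
set_option maxHeartbeats 1000000

open MvPolynomial ExteriorAlgebra

/-- The weights of the variables of `P(1^l, 2^m)`. -/
def wps (l m : ℕ) : Fin l ⊕ Fin m → ℕ := Sum.elim (fun _ => 1) (fun _ => 2)

/-- Weighted-degree-`q` part of the coordinate ring of `P(1^l, 2^m)`. -/
abbrev wPart (k : Type) [Field k] (l m q : ℕ) :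
    Submodule k (MvPolynomial (Fin l ⊕ Fin m) k) :=
  MvPolynomial.weightedHomogeneousSubmodule k (wps l m) q

/-- Koszul term `Λ^p W ⊗ A_q`, where `W = A_1` is the weighted-degree-2
part. -/
abbrev wKoszulTerm (k : Type) [Field k] (l m p q : ℕ) :=
  TensorProduct k (⋀[k]^p (wPart k l m 2)) (wPart k l m q)

noncomputable instance wKoszulTermAddCommGroup (k : Type) [Field k] (l m p q : ℕ) :
    AddCommGroup (wKoszulTerm k l m p q) := inferInstance

noncomputable instance wKoszulTermModule (k : Type) [Field k] (l m p q : ℕ) :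
    Module k (wKoszulTerm k l m p q) := inferInstance

noncomputable def wWedge (k : Type) [Field k] (l m p : ℕ) (v : Fin p → wPart k l m 2) :
    ⋀[k]^p (wPart k l m 2) :=
  ⟨ExteriorAlgebra.ιMulti k p v, ExteriorAlgebra.ιMulti_range k p (Set.mem_range_self v)⟩

noncomputable def wMul (k : Type) [Field k] (l m : ℕ) {q : ℕ}
    (w : wPart k l m 2) (f : wPart k l m q) : wPart k l m (q + 2) :=
  ⟨w.1 * f.1, by
    have := ((MvPolynomial.mem_weightedHomogeneousSubmodule _ _ _ _).1 w.2).mul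
      ((MvPolynomial.mem_weightedHomogeneousSubmodule _ _ _ _).1 f.2)
    exact (MvPolynomial.mem_weightedHomogeneousSubmodule _ _ _ _).2
      (by simpa [add_comm] using this)⟩

def symDiagram (A : Finset ℕ) : Finset (ℕ × ℕ) :=
  A.biUnion (fun a =>
    (({(A.filter (fun x => a < x)).card} : Finset ℕ) ×ˢ
        Finset.Icc (A.filter (fun x => a < x)).card ((A.filter (fun x => a < x)).card + a)) ∪
      ((Finset.Icc ((A.filter (fun x => a < x)).card + 1)
          ((A.filter (fun x => a < x)).card + a)) ×ˢ
        ({(A.filter (fun x => a < x)).card} : Finset ℕ)))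

def dimSchur (n : ℕ) (D : Finset (ℕ × ℕ)) : ℕ :=
  (∏ b ∈ D, (n + b.2 - b.1)) /
    (∏ b ∈ D, ((D.filter (fun x => x.1 = b.1 ∧ b.2 ≤ x.2)).card +
      (D.filter (fun x => x.2 = b.2 ∧ b.1 < x.1)).card))

/-- The Betti number `dim R_{p,p+q}` of the quadratic Veronese embedding of
`P^{l-1}`: symmetric diagrams with `2(p+q)` boxes and diagonal length `2q`
(i.e. `2(p+q) - 2p`). -/
def veroneseBetti (l p q : ℕ) : ℕ :=
  ∑ A ∈ (Finset.range l).powerset.filter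
      (fun A => A.card = 2 * q ∧ A.sum id = p),
    dimSchur l (symDiagram A)

section GlPart
variable {k : Type} [Field k] {T : Type} [AddCommGroup T] [Module k T] {l : ℕ}

/-- The weight space of weight `α`. -/
def wtSp (E : Fin l → Fin l → Module.End k T) (α : Fin l →₀ ℕ) : Submodule k T :=
  ⨅ i, LinearMap.ker (E i i - (α i : k) • 1)

theorem mem_wtSp {E : Fin l → Fin l → Module.End k T} {α : Fin l →₀ ℕ} {v : T} :
    v ∈ wtSp E α ↔ ∀ i, E i i v = (α i : k) • v := by
  simp [wtSp, Submodule.mem_iInf, sub_eq_zero]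

/-- `gl_l` commutation relations. -/
def GlRel (E : Fin l → Fin l → Module.End k T) : Prop :=
  ∀ i j a b, E i j * E a b = E a b * E i j + (if j = a then E i b else 0)
    - (if i = b then E a j else 0)

theorem GlRel.app {E : Fin l → Fin l → Module.End k T} (h : GlRel E) (i j a b : Fin l) (v : T) :
    E i j (E a b v) = E a b (E i j v) + (if j = a then E i b v else 0)
    - (if i = b then E a j v else 0) := by
  have := congrArg (fun f => f v) (h i j a b)
  simp only [Module.End.mul_apply, LinearMap.sub_apply, LinearMap.add_apply] at this
  rw [this]; split_ifs <;> simp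

/-- The Casimir operator. -/
def casimir (E : Fin l → Fin l → Module.End k T) : Module.End k T :=
  ∑ i, ∑ j, E i j * E j i

/-- A finite dimensional polynomial `gl_l`-module of degree `n` inside `T`. -/
structure GlMod (E : Fin l → Fin l → Module.End k T) (n : ℕ) (N : Submodule k T) : Prop where
  rel : GlRel E
  fin : FiniteDimensional k N
  stable : ∀ i j, ∀ v ∈ N, E i j v ∈ N
  wts : ∀ v ∈ N, v ≠ 0 → ∀ χ : Fin l → k, (∀ i, E i i v = χ i • v) →
    ∃ α : Fin l →₀ ℕ, ∑ i, α i = n ∧ ∀ i, χ i = α i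
  ss : ∀ v ∈ N, ∀ i, ∀ c : k, (E i i - c • 1) ((E i i - c • 1) v) = 0 → (E i i - c • 1) v = 0

theorem GlMod.mono {E : Fin l → Fin l → Module.End k T} {n : ℕ} {N N' : Submodule k T}
    (h : GlMod E n N) (hle : N' ≤ N) (hst : ∀ i j, ∀ v ∈ N', E i j v ∈ N') : GlMod E n N' where
  rel := h.rel
  fin := by
    have := h.fin
    exact Submodule.finiteDimensional_of_le hle
  stable := hst
  wts := fun v hv => h.wts v (hle hv)
  ss := fun v hv => h.ss v (hle hv)

variable {E : Fin l → Fin l → Module.End k T} {n : ℕ} {N : Submodule k T}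

theorem GlMod.finwt (h : GlMod E n N) (α : Fin l →₀ ℕ) :
    FiniteDimensional k (N ⊓ wtSp E α : Submodule k T) := by
  have := h.fin
  exact Submodule.finiteDimensional_of_le inf_le_left

theorem GlMod.eq_zero [CharZero k] (h : GlMod E n N) {α : Fin l →₀ ℕ} (hα : ∑ i, α i ≠ n) :
    N ⊓ wtSp E α = ⊥ := by
  rw [Submodule.eq_bot_iff]
  rintro v ⟨hv, hw⟩
  by_contra hne
  rw [SetLike.mem_coe, mem_wtSp] at hw
  obtain ⟨β, hβ, hχ⟩ := h.wts v hv hne _ hw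
  apply hα
  rw [← hβ]
  exact Finset.sum_congr rfl fun i _ => by exact_mod_cast hχ i

theorem GlMod.shift [CharZero k] (h : GlMod E n N) {i j : Fin l} {α β : Fin l →₀ ℕ}
    (hβ : β + Finsupp.single j 1 = α + Finsupp.single i 1) {v : T} (hv : v ∈ N ⊓ wtSp E α) :
    E i j v ∈ N ⊓ wtSp E β := by
  obtain ⟨hv, hw⟩ := hv
  rw [SetLike.mem_coe, mem_wtSp] at hw
  refine ⟨h.stable i j v hv, ?_⟩
  rw [SetLike.mem_coe, mem_wtSp]
  intro a
  rw [h.rel.app, hw a, map_smul]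
  have hb := DFunLike.congr_fun hβ a
  simp only [Finsupp.add_apply, Finsupp.single_apply] at hb
  have hb' : (β a : k) + (if j = a then 1 else 0) = α a + (if i = a then 1 else 0) := by
    exact_mod_cast hb
  rw [eq_sub_of_add_eq hb', sub_smul, add_smul]
  congr 1
  · congr 1
    by_cases hia : i = a
    · subst hia; simp
    · simp [hia, Ne.symm hia]
  · by_cases hia : j = a
    · subst hia; simp
    · simp [hia, Ne.symm hia]

theorem GlMod.lower_zero [CharZero k] (h : GlMod E n N) {i j : Fin l} (hij : i ≠ j) {α : Fin l →₀ ℕ}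
    (hα : α i = 0) {v : T} (hv : v ∈ N ⊓ wtSp E α) :
    E j i v = 0 := by
  obtain ⟨hv, hw⟩ := hv
  rw [SetLike.mem_coe, mem_wtSp] at hw
  by_contra hne
  obtain ⟨β, hβ, hχ⟩ := h.wts (E j i v) (h.stable j i v hv) hne
    (fun a => α a + (if a = j then 1 else 0) - (if a = i then 1 else 0)) (by
      intro a
      rw [h.rel.app, hw a, map_smul, sub_smul, add_smul]
      congr 1
      · congr 1
        by_cases hia : a = j
        · subst hia; simp
        · simp [hia]
      · by_cases hia : a = i
        · subst hia; simp
        · simp [hia])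
  have := hχ i
  simp only [hα, hij, if_true, if_false] at this
  have h2 : ((β i + 1 : ℕ) : k) = 0 := by push_cast; rw [← this]; simp
  exact absurd h2 (Nat.cast_ne_zero.mpr (Nat.succ_ne_zero _))

theorem GlMod.mapsTo [CharZero k] (h : GlMod E n N) (i j : Fin l) (α : Fin l →₀ ℕ) :
    ∀ v ∈ N ⊓ wtSp E α, (E i j * E j i) v ∈ N ⊓ wtSp E α := by
  intro v hv
  rw [Module.End.mul_apply]
  by_cases hij : i = j
  · subst hij
    exact h.shift rfl (h.shift rfl hv)
  by_cases hi : α i = 0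
  · rw [h.lower_zero hij hi hv, map_zero]; exact Submodule.zero_mem _
  · have hle : Finsupp.single i 1 ≤ α := by
      rw [Finsupp.single_le_iff]; omega
    obtain ⟨γ, rfl⟩ := exists_add_of_le hle
    refine h.shift (α := γ + Finsupp.single j 1) ?_ (h.shift ?_ hv)
    · abel
    · abel

/-- trace of `E_ij E_ji` on a weight space -/
noncomputable def GlMod.tr [CharZero k] (h : GlMod E n N) (i j : Fin l) (α : Fin l →₀ ℕ) : k :=
  LinearMap.trace k _ ((E i j * E j i).restrict (h.mapsTo i j α))

/-- dimension of weight space -/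
noncomputable def wdim (E : Fin l → Fin l → Module.End k T) (N : Submodule k T)
    (α : Fin l →₀ ℕ) : ℕ := Module.finrank k (N ⊓ wtSp E α : Submodule k T)

theorem GlMod.tr_self [CharZero k] (h : GlMod E n N) (i : Fin l) (α : Fin l →₀ ℕ) :
    h.tr i i α = (α i : k) ^ 2 * wdim E N α := by
  have hfin := h.finwt α
  have : (E i i * E i i).restrict (h.mapsTo i i α) = ((α i : k) ^ 2) • LinearMap.id := by
    ext ⟨v, hv⟩
    have hw := mem_wtSp.1 hv.2 i
    simp [hw, smul_smul, pow_two]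
  rw [GlMod.tr, this, map_smul, LinearMap.trace_id, wdim, smul_eq_mul]

theorem GlMod.tr_swap [CharZero k] (h : GlMod E n N) (i j : Fin l) (α : Fin l →₀ ℕ) :
    h.tr i j α = h.tr j i α + ((α i : k) - α j) * wdim E N α := by
  have hfin := h.finwt α
  have : (E i j * E j i).restrict (h.mapsTo i j α) = (E j i * E i j).restrict (h.mapsTo j i α) +
      ((α i : k) - α j) • LinearMap.id := by
    ext ⟨v, hv⟩
    have hw := mem_wtSp.1 hv.2 i
    have hw' := mem_wtSp.1 hv.2 j
    simp [h.rel.app i j j i, hw, hw', sub_smul, add_sub_assoc]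
  rw [GlMod.tr, this, map_add, map_smul, LinearMap.trace_id, wdim, smul_eq_mul]
  rfl

theorem GlMod.tr_zero [CharZero k] (h : GlMod E n N) {i j : Fin l} (hij : i ≠ j) {α : Fin l →₀ ℕ}
    (hα : α i = 0) : h.tr i j α = 0 := by
  have hfin := h.finwt α
  have : (E i j * E j i).restrict (h.mapsTo i j α) = 0 := by
    ext ⟨v, hv⟩
    simp [h.lower_zero hij hα hv]
  rw [GlMod.tr, this, map_zero]

theorem GlMod.tr_step [CharZero k] (h : GlMod E n N) (i j : Fin l) (γ : Fin l →₀ ℕ) :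
    h.tr i j (γ + Finsupp.single i 1) = h.tr j i (γ + Finsupp.single j 1) := by
  have hfin := h.finwt (γ + Finsupp.single i 1)
  have hfin := h.finwt (γ + Finsupp.single j 1)
  have e1 : ∀ v ∈ N ⊓ wtSp E (γ + Finsupp.single i 1),
      E j i v ∈ N ⊓ wtSp E (γ + Finsupp.single j 1) := fun v hv => h.shift (by abel) hv
  have e2 : ∀ v ∈ N ⊓ wtSp E (γ + Finsupp.single j 1),
      E i j v ∈ N ⊓ wtSp E (γ + Finsupp.single i 1) := fun v hv => h.shift (by abel) hv
  have := LinearMap.trace_comp_comm' ((E j i).restrict e1) ((E i j).restrict e2)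
  exact this

theorem GlMod.tr_bot [CharZero k] (h : GlMod E n N) (i j : Fin l) {α : Fin l →₀ ℕ}
    (hα : wdim E N α = 0) : h.tr i j α = 0 := by
  have hfin := h.finwt α
  have := Module.finrank_zero_iff.1 hα
  rw [GlMod.tr, Subsingleton.elim ((E i j * E j i).restrict (h.mapsTo i j α)) 0, map_zero]

/-- `N` is killed by a power of `casimir - c`. -/
def CasNil (E : Fin l → Fin l → Module.End k T) (c : k) (N : Submodule k T) : Prop :=
  ∀ v ∈ N, ∃ m : ℕ, ((casimir E - c • 1) ^ m) v = 0

theorem GlMod.casMapsTo [CharZero k] (h : GlMod E n N) (α : Fin l →₀ ℕ) :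
    ∀ v ∈ N ⊓ wtSp E α, casimir E v ∈ N ⊓ wtSp E α := by
  intro v hv
  simp only [casimir, LinearMap.sum_apply]
  exact Submodule.sum_mem _ fun i _ => Submodule.sum_mem _ fun j _ => h.mapsTo i j α v hv

theorem GlMod.tr_cas [CharZero k] (h : GlMod E n N) {c : k} (hc : CasNil E c N)
    (α : Fin l →₀ ℕ) : ∑ i, ∑ j, h.tr i j α = c * wdim E N α := by
  have hfin := h.finwt α
  set f : Module.End k (N ⊓ wtSp E α : Submodule k T) :=
    (casimir E).restrict (h.casMapsTo α) with hf
  have h1 : f = ∑ i, ∑ j, (E i j * E j i).restrict (h.mapsTo i j α) := by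
    ext ⟨v, hv⟩
    simp [hf, casimir]
  have h2 : LinearMap.trace k _ f = ∑ i, ∑ j, h.tr i j α := by
    rw [h1, map_sum]
    refine Finset.sum_congr rfl fun i _ => ?_
    rw [map_sum]
    rfl
  rw [← h2]
  have hpow : ∀ m : ℕ, ∀ v : (N ⊓ wtSp E α : Submodule k T), (((f - c • 1) ^ m) v : T) =
      ((casimir E - c • 1) ^ m) v := by
    intro m
    induction m with
    | zero => intro v; simp
    | succ m ih =>
      intro v
      rw [pow_succ, pow_succ, Module.End.mul_apply, Module.End.mul_apply, ih]
      simp [hf]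
  have hnil : IsNilpotent (f - c • 1) := by
    rw [Module.End.isNilpotent_iff_of_finite]
    intro v
    obtain ⟨m, hm⟩ := hc v v.2.1
    refine ⟨m, ?_⟩
    apply Subtype.ext
    rw [hpow, hm]; rfl
  have h3 := LinearMap.isNilpotent_trace_of_isNilpotent hnil
  have h4 := h3.eq_zero
  rw [map_sub, map_smul, sub_eq_zero] at h4
  rw [h4, LinearMap.trace_one, wdim, smul_eq_mul]

end GlPart

section PolyPart
variable {k : Type} [Field k] {l : ℕ}

/-- Euler derivation `x_i ∂_i`. -/
noncomputable def De (i : Fin l) : Derivation k (MvPolynomial (Fin l) k) (MvPolynomial (Fin l) k) :=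
  (X i : MvPolynomial (Fin l) k) • pderiv i

theorem De_apply (i : Fin l) (f : MvPolynomial (Fin l) k) : De i f = X i * pderiv i f := rfl

theorem coeff_De (i : Fin l) (f : MvPolynomial (Fin l) k) (α : Fin l →₀ ℕ) :
    coeff α (De i f) = (α i : k) * coeff α f := by
  induction f using MvPolynomial.induction_on' with
  | add p q hp hq => rw [map_add, coeff_add, hp, hq, coeff_add, mul_add]
  | monomial m r =>
    rw [De_apply, X_mul_pderiv_monomial, coeff_smul, coeff_monomial]
    split_ifs with h
    · subst h; simp
    · simp

theorem deriv_prod {A : Type} [CommRing A] [Algebra k A] (D : Derivation k A A) {ι : Type}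
    [DecidableEq ι] (s : Finset ι) (f : ι → A) :
    D (∏ a ∈ s, f a) = ∑ a ∈ s, (∏ b ∈ s.erase a, f b) * D (f a) := by
  induction s using Finset.induction_on with
  | empty => simp
  | insert a s ha ih =>
    rw [Finset.prod_insert ha, Derivation.leibniz, ih, Finset.sum_insert ha,
      Finset.erase_insert ha, smul_eq_mul, smul_eq_mul, Finset.mul_sum, add_comm]
    congr 1
    refine Finset.sum_congr rfl fun b hb => ?_
    have hne : a ≠ b := fun h => ha (h ▸ hb)
    rw [Finset.erase_insert_of_ne hne, Finset.prod_insert (by simp [ha])]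
    ring

/-- pairs `i < j` -/
def prs (l : ℕ) : Finset (Fin l × Fin l) := Finset.univ.filter fun p => p.1 < p.2

/-- The Vandermonde product. -/
noncomputable def Vand (k : Type) [Field k] (l : ℕ) : MvPolynomial (Fin l) k :=
  ∏ p ∈ prs l, (X p.2 - X p.1)

/-- Vandermonde with a factor removed -/
noncomputable def Vq (k : Type) [Field k] {l : ℕ} (i j : Fin l) : MvPolynomial (Fin l) k :=
  if j < i then ∏ p ∈ (prs l).erase (j, i), (X p.2 - X p.1)
  else - ∏ p ∈ (prs l).erase (i, j), (X p.2 - X p.1)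

theorem Vq_mul {i j : Fin l} (hij : i ≠ j) : (X i - X j) * Vq k i j = Vand k l := by
  unfold Vq Vand
  split_ifs with h
  · exact Finset.mul_prod_erase (prs l) (fun p : Fin l × Fin l => (X p.2 - X p.1 : MvPolynomial (Fin l) k))
      (a := (j, i)) (by simp [prs, h])
  · have h' : i < j := lt_of_le_of_ne (not_lt.1 h) hij
    rw [← Finset.mul_prod_erase (prs l) (fun p : Fin l × Fin l => (X p.2 - X p.1 : MvPolynomial (Fin l) k))
      (a := (i, j)) (by simp [prs, h'])]
    ring

theorem Vq_swap {i j : Fin l} (hij : i ≠ j) : Vq k j i = - Vq k i j := by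
  unfold Vq
  rcases lt_or_gt_of_ne hij with h | h
  · simp [h, h.not_gt]
  · simp [h, h.not_gt]

theorem De_X (i j : Fin l) : De i (X j : MvPolynomial (Fin l) k) = if j = i then X i else 0 := by
  rw [De_apply, pderiv_X, Pi.single_apply]
  split_ifs <;> simp

theorem De_Vand (i : Fin l) : De i (Vand k l) = ∑ j, if j = i then 0 else X i * Vq k i j := by
  rw [Vand, deriv_prod]
  have : ∀ p ∈ prs l, (∏ b ∈ (prs l).erase p, (X b.2 - X b.1 : MvPolynomial (Fin l) k)) *
      De i (X p.2 - X p.1) =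
      (∑ j, if p = (j, i) then X i * ∏ b ∈ (prs l).erase p, (X b.2 - X b.1) else 0) -
      (∑ j, if p = (i, j) then X i * ∏ b ∈ (prs l).erase p, (X b.2 - X b.1) else 0) := by
    rintro ⟨a, b⟩ -
    rw [map_sub, De_X, De_X, mul_sub]
    congr 1
    · by_cases h : b = i
      · subst h; simp [mul_comm]
      · simp [h]
    · by_cases h : a = i
      · subst h; simp [mul_comm]
      · simp [h]
  rw [Finset.sum_congr rfl this, Finset.sum_sub_distrib, Finset.sum_comm,
    Finset.sum_comm (s := prs l), ← Finset.sum_sub_distrib]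
  refine Finset.sum_congr rfl fun j _ => ?_
  rw [Finset.sum_ite_eq', Finset.sum_ite_eq']
  unfold Vq prs
  rcases lt_trichotomy i j with h | h | h
  · simp [h, h.ne', h.not_gt]
  · subst h; simp
  · simp [h, h.ne, h.not_gt]

/-- The second order operator -/
noncomputable def Lap (f : MvPolynomial (Fin l) k) : MvPolynomial (Fin l) k :=
  ∑ i, De i (De i f)

theorem coeff_Lap (f : MvPolynomial (Fin l) k) (α : Fin l →₀ ℕ) :
    coeff α (Lap f) = (∑ i, (α i : k) ^ 2) * coeff α f := by
  simp only [Lap, coeff_sum, coeff_De, Finset.sum_mul]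
  exact Finset.sum_congr rfl fun i _ => by ring

theorem Vand_eq_det : Vand k l = (Matrix.vandermonde (fun i : Fin l => (X i : MvPolynomial (Fin l) k))).det := by
  rw [Matrix.det_vandermonde, Vand, prs, Finset.prod_filter, ← Finset.univ_product_univ,
    Finset.prod_product]
  refine Finset.prod_congr rfl fun i _ => ?_
  rw [← Finset.prod_filter]
  congr 1
  ext; simp

theorem prodXpow (γ : Fin l → ℕ) : ∏ i, (X i : MvPolynomial (Fin l) k) ^ γ i =
    monomial (Finsupp.equivFunOnFinite.symm γ) 1 := by
  rw [monomial_eq]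
  simp [Finsupp.prod_fintype]

theorem coeff_Vand_ne {α : Fin l →₀ ℕ} (h : coeff α (Vand k l) ≠ 0) :
    ∃ σ : Equiv.Perm (Fin l), ∀ i, α i = (σ i : ℕ) := by
  rw [Vand_eq_det, ← Matrix.det_transpose, Matrix.det_apply, coeff_sum] at h
  obtain ⟨σ, -, hσ⟩ := Finset.exists_ne_zero_of_sum_ne_zero h
  refine ⟨σ, fun i => ?_⟩
  simp only [Matrix.transpose_apply, Matrix.vandermonde_apply] at hσ
  rw [prodXpow, coeff_smul, coeff_monomial] at hσ
  split_ifs at hσ with h'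
  · rw [← h']; simp
  · simp at hσ

theorem Lap_Vand : Lap (Vand k l) = C (∑ i : Fin l, ((i : ℕ) : k) ^ 2) * Vand k l := by
  ext α
  rw [coeff_Lap, coeff_C_mul]
  by_cases h : coeff α (Vand k l) = 0
  · simp [h]
  · obtain ⟨σ, hσ⟩ := coeff_Vand_ne h
    congr 1
    simp only [hσ]
    exact Equiv.sum_comp σ (fun i : Fin l => ((i : ℕ) : k) ^ 2)

theorem Vand_ne_zero : Vand k l ≠ 0 := by
  unfold Vand
  rw [Finset.prod_ne_zero_iff]
  intro p hp
  rw [sub_ne_zero]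
  intro h
  have := X_injective h
  simp [prs, this] at hp

theorem Lap_mul (f g : MvPolynomial (Fin l) k) :
    Lap (f * g) = Lap f * g + 2 * ∑ i, De i f * De i g + f * Lap g := by
  unfold Lap
  rw [Finset.sum_mul, Finset.mul_sum, Finset.mul_sum, ← Finset.sum_add_distrib, ← Finset.sum_add_distrib]
  refine Finset.sum_congr rfl fun i _ => ?_
  simp only [Derivation.leibniz, map_add, smul_eq_mul]
  ring

theorem Lap_key (f : MvPolynomial (Fin l) k) (Tg : Fin l → Fin l → MvPolynomial (Fin l) k)
    (n c : k) (hn : ∑ i, De i f = C n * f)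
    (hT : ∀ i j, i ≠ j → (X i - X j) * Tg i j = X i * (De i f - De j f))
    (hd : ∀ i, Tg i i = De i (De i f))
    (hc : ∑ i, ∑ j, Tg i j = C c * f) :
    Lap (Vand k l * f) = C (c + (∑ i : Fin l, ((i : ℕ) : k) ^ 2) + (l - 1) * n) * (Vand k l * f) := by
  have h1 : ∀ i j, i ≠ j → Vand k l * Tg i j = Vq k i j * (X i * (De i f - De j f)) := by
    intro i j hij
    rw [← hT i j hij, ← Vq_mul hij]; ring
  have hcc : C c * f = Lap f + ∑ i, ∑ j, if j = i then 0 else Tg i j := by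
    rw [← hc, Lap, ← Finset.sum_add_distrib]
    refine Finset.sum_congr rfl fun i _ => ?_
    rw [← hd, ← Finset.add_sum_erase _ _ (Finset.mem_univ i)]
    congr 1
    rw [← Finset.add_sum_erase (Finset.univ) (fun j => if j = i then 0 else Tg i j) (Finset.mem_univ i)]
    simp only [if_true, zero_add]
    exact Finset.sum_congr rfl fun j hj => by rw [if_neg (Finset.ne_of_mem_erase hj)]
  have h2 : Vand k l * ∑ i, ∑ j, (if j = i then 0 else Tg i j) =
      ∑ i, ∑ j, (if j = i then 0 else Vq k i j * (X i + X j) * De i f) := by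
    have e1 : Vand k l * ∑ i, ∑ j, (if j = i then 0 else Tg i j) =
        ∑ i, ∑ j, (if j = i then 0 else Vq k i j * X i * De i f) -
        ∑ i, ∑ j, (if j = i then 0 else Vq k i j * X i * De j f) := by
      rw [Finset.mul_sum, ← Finset.sum_sub_distrib]
      refine Finset.sum_congr rfl fun i _ => ?_
      rw [Finset.mul_sum, ← Finset.sum_sub_distrib]
      refine Finset.sum_congr rfl fun j _ => ?_
      split_ifs with h
      · simp
      · rw [h1 i j (Ne.symm h)]; ring
    have e2 : ∑ i, ∑ j, (if j = i then 0 else Vq k i j * X i * De j f) =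
        ∑ i, ∑ j, (if j = i then 0 else - (Vq k i j * X j * De i f)) := by
      rw [Finset.sum_comm]
      refine Finset.sum_congr rfl fun i _ => Finset.sum_congr rfl fun j _ => ?_
      by_cases h : i = j
      · simp [h]
      · rw [if_neg h, if_neg (Ne.symm h), Vq_swap h]; ring
    rw [e1, e2, ← Finset.sum_sub_distrib]
    refine Finset.sum_congr rfl fun i _ => ?_
    rw [← Finset.sum_sub_distrib]
    refine Finset.sum_congr rfl fun j _ => ?_
    split_ifs <;> ring
  have h3 : 2 * ∑ i, De i (Vand k l) * De i f =
      ∑ i, ∑ j, (if j = i then 0 else Vq k i j * (X i + X j) * De i f) +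
      C ((l : k) - 1) * (Vand k l * ∑ i, De i f) := by
    rw [Finset.mul_sum, Finset.mul_sum, Finset.mul_sum, ← Finset.sum_add_distrib]
    refine Finset.sum_congr rfl fun i _ => ?_
    have e : C ((l : k) - 1) * (Vand k l * De i f) =
        ∑ j, if j = i then 0 else Vand k l * De i f := by
      rw [← Finset.add_sum_erase _ _ (Finset.mem_univ i), if_pos rfl, zero_add,
        Finset.sum_congr rfl (g := fun _ => Vand k l * De i f)
          (fun j hj => if_neg (Finset.ne_of_mem_erase hj)), Finset.sum_const,
        Finset.card_erase_of_mem (Finset.mem_univ i), Finset.card_univ, Fintype.card_fin,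
        nsmul_eq_mul, Nat.cast_sub (by have := i.2; omega)]
      simp
    rw [e, De_Vand, Finset.sum_mul, Finset.mul_sum, ← Finset.sum_add_distrib]
    refine Finset.sum_congr rfl fun j _ => ?_
    by_cases h : j = i
    · simp [h]
    · rw [if_neg h, if_neg h, if_neg h, ← Vq_mul (Ne.symm h)]; ring
  rw [Lap_mul, Lap_Vand, h3, ← h2, hn]
  have : Lap f = C c * f - ∑ i, ∑ j, if j = i then 0 else Tg i j := by rw [hcc]; ring
  rw [this]
  simp only [map_add, map_mul, map_sub]
  ring

end PolyPart

section ChiPart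
variable {k : Type} [Field k] {T : Type} [AddCommGroup T] [Module k T] {l : ℕ}
variable {E : Fin l → Fin l → Module.End k T} {n : ℕ} {N : Submodule k T}

/-- The character of `N`. -/
noncomputable def chi (E : Fin l → Fin l → Module.End k T) (n : ℕ) (N : Submodule k T) :
    MvPolynomial (Fin l) k :=
  ∑ α ∈ (Finset.univ : Finset (Fin l)).finsuppAntidiag n, monomial α (wdim E N α : k)

theorem coeff_gen (g : (Fin l →₀ ℕ) → k) (hg : ∀ α, ∑ i, α i ≠ n → g α = 0) (α : Fin l →₀ ℕ) :
    coeff α (∑ α ∈ (Finset.univ : Finset (Fin l)).finsuppAntidiag n, monomial α (g α)) = g α := by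
  rw [coeff_sum]
  simp only [coeff_monomial]
  rw [Finset.sum_ite_eq']
  split_ifs with h
  · rfl
  · rw [Finset.mem_finsuppAntidiag] at h
    refine (hg α fun h' => h ⟨h', by simp⟩).symm

theorem GlMod.wdim_zero [CharZero k] (h : GlMod E n N) {α : Fin l →₀ ℕ} (hα : ∑ i, α i ≠ n) :
    wdim E N α = 0 := by
  rw [wdim, h.eq_zero hα, finrank_bot]

theorem GlMod.coeff_chi [CharZero k] (h : GlMod E n N) (α : Fin l →₀ ℕ) :
    coeff α (chi E n N) = wdim E N α :=
  coeff_gen _ (fun α hα => by rw [h.wdim_zero hα, Nat.cast_zero]) α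

theorem GlMod.lap_chi [CharZero k] (h : GlMod E n N) {c : k} (hc : CasNil E c N) :
    Lap (Vand k l * chi E n N) =
      C (c + (∑ i : Fin l, ((i : ℕ) : k) ^ 2) + (l - 1) * n) * (Vand k l * chi E n N) := by
  set Tg : Fin l → Fin l → MvPolynomial (Fin l) k := fun i j =>
    ∑ α ∈ (Finset.univ : Finset (Fin l)).finsuppAntidiag n, monomial α (h.tr i j α) with hTg
  have cT : ∀ i j α, coeff α (Tg i j) = h.tr i j α := fun i j α =>
    coeff_gen _ (fun α hα => h.tr_bot i j (h.wdim_zero hα)) α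
  have t1 : ∀ i j, i ≠ j → X j * Tg i j = X i * Tg j i := by
    intro i j hij
    ext δ
    rw [mul_comm, mul_comm (X i), coeff_mul_X', coeff_mul_X', cT, cT]
    by_cases hi : δ i = 0
    · rw [if_neg (c := i ∈ δ.support) (by simpa using hi)]
      split_ifs with hj
      · apply h.tr_zero hij
        simp [hi]
      · rfl
    by_cases hj : δ j = 0
    · rw [if_neg (c := j ∈ δ.support) (by simpa using hj)]
      split_ifs with hi
      · symm; apply h.tr_zero (Ne.symm hij)
        simp [hj]
      · rfl
    rw [if_pos (by simpa using hj), if_pos (by simpa using hi)]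
    have hle : Finsupp.single i 1 ≤ δ := by
      rw [Finsupp.single_le_iff]; omega
    obtain ⟨γ, rfl⟩ := exists_add_of_le hle
    have hle : Finsupp.single j 1 ≤ γ := by
      rw [Finsupp.single_le_iff]
      simp [Finsupp.single_apply, hij] at hj; omega
    obtain ⟨γ, rfl⟩ := exists_add_of_le hle
    rw [add_tsub_cancel_left, add_left_comm, add_tsub_cancel_left, add_comm, h.tr_step, add_comm]
  have t2 : ∀ i j, Tg i j = Tg j i + (De i (chi E n N) - De j (chi E n N)) := by
    intro i j
    ext δ
    rw [coeff_add, coeff_sub, coeff_De, coeff_De, cT, cT, h.coeff_chi, h.tr_swap i j]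
    ring
  refine Lap_key _ Tg n c ?_ ?_ ?_ ?_
  · ext δ
    rw [coeff_sum, coeff_C_mul, h.coeff_chi]
    simp only [coeff_De, h.coeff_chi]
    rw [← Finset.sum_mul]
    by_cases hδ : ∑ i, δ i = n
    · rw [← hδ]; push_cast; rfl
    · rw [h.wdim_zero hδ]; simp
  · intro i j hij
    rw [sub_mul, t1 i j hij, t2 i j]; ring
  · intro i
    ext δ
    rw [cT, coeff_De, coeff_De, h.coeff_chi, h.tr_self]; ring
  · ext δ
    rw [coeff_sum, coeff_C_mul, h.coeff_chi, ← h.tr_cas hc]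
    refine Finset.sum_congr rfl fun i _ => ?_
    rw [coeff_sum]
    exact Finset.sum_congr rfl fun j _ => cT i j δ

theorem GlMod.norm_of_coeff [CharZero k] (h : GlMod E n N) {c : k} (hc : CasNil E c N)
    {γ : Fin l →₀ ℕ} (hγ : coeff γ (Vand k l * chi E n N) ≠ 0) :
    (∑ i, (γ i : k) ^ 2) = c + (∑ i : Fin l, ((i : ℕ) : k) ^ 2) + (l - 1) * n := by
  have := congrArg (coeff γ) (h.lap_chi hc)
  rw [coeff_Lap, coeff_C_mul] at this
  exact mul_right_cancel₀ hγ this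

/-- Critical exponents. -/
def critN (n : ℕ) (γ : Fin l → ℕ) : Prop :=
  ∑ i, (γ i) ^ 2 + n = ∑ i : Fin l, (i : ℕ) ^ 2 + 2 * l * n

theorem critN_iff [CharZero k] (γ : Fin l → ℕ) : critN n γ ↔
    (∑ i, (γ i : k) ^ 2) = (l * n : k) + (∑ i : Fin l, ((i : ℕ) : k) ^ 2) + (l - 1) * n := by
  unfold critN
  rw [← Nat.cast_inj (R := k)]
  push_cast
  constructor
  · intro h; linear_combination h
  · intro h; linear_combination h

/-- The dominance order. -/
def domLE (α β : Fin l → ℕ) : Prop :=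
  ∀ ν : Fin l → ℤ, Monotone ν → ∑ i, ν i * α i ≤ ∑ i, ν i * β i

/-- the exponent chosen from the expansion of the Vandermonde product -/
noncomputable def mS (S : Finset (Fin l × Fin l)) : Fin l →₀ ℕ :=
  ∑ p ∈ prs l \ S, Finsupp.single p.2 1 + ∑ p ∈ S, Finsupp.single p.1 1

theorem pair_mS (S : Finset (Fin l × Fin l)) (ν : Fin l → ℤ) :
    ∑ i, ν i * (mS S i : ℤ) = ∑ p ∈ prs l \ S, ν p.2 + ∑ p ∈ S, ν p.1 := by
  have key : ∀ (s : Finset (Fin l × Fin l)) (g : Fin l × Fin l → Fin l),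
      ∑ i, ν i * ((∑ p ∈ s, Finsupp.single (g p) 1 : Fin l →₀ ℕ) i : ℤ) = ∑ p ∈ s, ν (g p) := by
    intro s g
    simp only [Finsupp.finsetSum_apply, Nat.cast_sum, Finset.mul_sum]
    rw [Finset.sum_comm]
    refine Finset.sum_congr rfl fun p _ => ?_
    simp [Finsupp.single_apply]
  rw [← key, ← key, ← Finset.sum_add_distrib]
  refine Finset.sum_congr rfl fun i _ => ?_
  simp only [mS, Finsupp.add_apply]
  push_cast
  ring

/-- the staircase -/
noncomputable def stair (l : ℕ) : Fin l →₀ ℕ := Finsupp.equivFunOnFinite.symm fun i => (i : ℕ)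

@[simp] theorem stair_apply (i : Fin l) : stair l i = i := rfl

theorem mS_empty : mS (∅ : Finset (Fin l × Fin l)) = stair l := by
  ext i
  simp only [mS, Finset.sdiff_empty, Finset.sum_empty, add_zero, Finsupp.finsetSum_apply,
    Finsupp.single_apply, stair_apply, Finset.sum_boole, prs, Finset.filter_filter, Nat.cast_id]
  have : (Finset.univ.filter fun p : Fin l × Fin l => p.1 < p.2 ∧ p.2 = i) =
      (Finset.Iio i).map ⟨fun a => (a, i), fun a b h => by simpa using h⟩ := by
    ext ⟨a, b⟩
    simp only [Finset.mem_filter, Finset.mem_univ, true_and, Finset.mem_map, Finset.mem_Iio,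
      Function.Embedding.coeFn_mk]
    constructor
    · rintro ⟨h1, rfl⟩; exact ⟨a, h1, rfl⟩
    · rintro ⟨c, h1, h2⟩; cases h2; exact ⟨h1, rfl⟩
  rw [this, Finset.card_map, Fin.card_Iio]

theorem Vand_expand : Vand k l = ∑ S ∈ (prs l).powerset, C ((-1) ^ S.card) * monomial (mS S) 1 := by
  rw [Vand, Finset.prod_sub]
  refine Finset.sum_congr rfl fun S _ => ?_
  have key : ∀ (s : Finset (Fin l × Fin l)) (g : Fin l × Fin l → Fin l),
      ∏ p ∈ s, (X (g p) : MvPolynomial (Fin l) k) = monomial (∑ p ∈ s, Finsupp.single (g p) 1) 1 := by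
    intro s g
    classical
    induction s using Finset.induction_on with
    | empty => simp
    | insert a s ha ih => rw [Finset.prod_insert ha, Finset.sum_insert ha, ih, X, monomial_mul, mul_one]
  rw [key, key, mul_assoc, monomial_mul, mul_one, mS]
  simp

theorem GlMod.coeff_top [CharZero k] (h : GlMod E n N) {lam : Fin l →₀ ℕ}
    (htop : ∀ μ : Fin l →₀ ℕ, domLE lam μ → ∑ i : Fin l, (i : ℕ) * lam i < ∑ i : Fin l, (i : ℕ) * μ i →
      wdim E N μ = 0) :
    coeff (stair l + lam) (Vand k l * chi E n N) = wdim E N lam := by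
  rw [Vand_expand, Finset.sum_mul, coeff_sum, Finset.sum_eq_single ∅]
  · rw [mul_assoc, coeff_C_mul, mS_empty, coeff_monomial_mul, h.coeff_chi]; simp
  · intro S hS hne
    rw [Finset.mem_powerset] at hS
    rw [mul_assoc, coeff_C_mul, coeff_monomial_mul']
    split_ifs with hle
    · obtain ⟨μ, hμ⟩ := exists_add_of_le hle
      have hpair : ∀ ν : Fin l → ℤ, ∑ i, ν i * (μ i : ℤ) = ∑ i, ν i * (lam i : ℤ) +
          ∑ p ∈ S, (ν p.2 - ν p.1) := by
        intro ν
        have e1 : ∑ i, ν i * (stair l i : ℤ) + ∑ i, ν i * (lam i : ℤ) =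
            ∑ i, ν i * (mS S i : ℤ) + ∑ i, ν i * (μ i : ℤ) := by
          rw [← Finset.sum_add_distrib, ← Finset.sum_add_distrib]
          refine Finset.sum_congr rfl fun i _ => ?_
          have := DFunLike.congr_fun hμ i
          simp only [Finsupp.add_apply] at this
          rw [← mul_add, ← mul_add]
          congr 1
          exact_mod_cast this
        rw [← mS_empty, pair_mS, pair_mS] at e1
        simp only [Finset.sdiff_empty, Finset.sum_empty, add_zero] at e1
        have e2 := Finset.sum_sdiff (f := fun p => ν p.2) hS
        rw [Finset.sum_sub_distrib]
        linarith
      rw [hμ, add_tsub_cancel_left, h.coeff_chi, htop μ]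
      · simp
      · intro ν hν
        rw [hpair]
        have : 0 ≤ ∑ p ∈ S, (ν p.2 - ν p.1) := Finset.sum_nonneg fun p hp => by
          have := hS hp
          simp only [prs, Finset.mem_filter, Finset.mem_univ, true_and] at this
          have := hν this.le
          linarith
        linarith
      · have h2 := hpair (fun i => (i : ℕ))
        have : 0 < ∑ p ∈ S, (((p.2 : ℕ) : ℤ) - ((p.1 : ℕ) : ℤ)) := by
          refine Finset.sum_pos (fun p hp => ?_) (Finset.nonempty_of_ne_empty hne)
          have := hS hp
          simp only [prs, Finset.mem_filter, Finset.mem_univ, true_and] at this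
          have : (p.1 : ℕ) < p.2 := this
          omega
        zify
        linarith
    · simp
  · intro h; simp at h

end ChiPart

section MaxPart
variable {k : Type} [Field k] [CharZero k] {T : Type} [AddCommGroup T] [Module k T] {l : ℕ}
variable {E : Fin l → Fin l → Module.End k T} {n : ℕ} {N : Submodule k T}

theorem domLE.refl (α : Fin l → ℕ) : domLE α α := fun _ _ => le_rfl
theorem domLE.trans {α β γ : Fin l → ℕ} (h : domLE α β) (h' : domLE β γ) : domLE α γ :=
  fun ν hν => (h ν hν).trans (h' ν hν)

theorem GlMod.string (h : GlMod E n N) {i j : Fin l} (hij : i ≠ j) : ∀ (m : ℕ) (α : Fin l →₀ ℕ)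
    (s : ℕ), α j = m → α j ≤ α i → h.tr i j α = -(s : k) → s + (α i - α j) * wdim E N α = 0 := by
  intro m
  induction m with
  | zero =>
    intro α s hj hle ht
    have := h.tr_swap i j α
    rw [h.tr_zero (Ne.symm hij) hj, ht] at this
    have h2 : ((s + (α i - α j) * wdim E N α : ℕ) : k) = 0 := by
      push_cast [Nat.cast_sub hle]; linear_combination -this
    exact_mod_cast h2
  | succ m ih =>
    intro α s hj hle ht
    have hs : Finsupp.single j 1 ≤ α := by rw [Finsupp.single_le_iff]; omega
    obtain ⟨γ, rfl⟩ := exists_add_of_le hs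
    have := h.tr_swap i j (Finsupp.single j 1 + γ)
    rw [add_comm, ← h.tr_step i j, add_comm, ht] at this
    set s' := s + ((Finsupp.single j 1 + γ : Fin l →₀ ℕ) i - (Finsupp.single j 1 + γ : Fin l →₀ ℕ) j) *
      wdim E N (Finsupp.single j 1 + γ) with hs'
    have h3 := ih (γ + Finsupp.single i 1) s' (by
      simp [Finsupp.single_apply, hij] at hj ⊢; omega) (by
      simp [Finsupp.single_apply, hij, Ne.symm hij] at hj hle ⊢; omega) (by
      rw [hs', Nat.cast_add, Nat.cast_mul, Nat.cast_sub hle]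
      rw [add_comm γ] at this ⊢
      linear_combination -this)
    omega

theorem GlMod.max_mono (h : GlMod E n N) {lam : Fin l →₀ ℕ} (hw : wdim E N lam ≠ 0)
    (htop : ∀ μ : Fin l →₀ ℕ, domLE lam μ → ∑ i : Fin l, (i : ℕ) * lam i < ∑ i : Fin l, (i : ℕ) * μ i →
      wdim E N μ = 0) : Monotone lam := by
  intro i j hij
  by_contra hlt
  push Not at hlt
  have hij' : i < j := lt_of_le_of_ne hij (by rintro rfl; exact lt_irrefl _ hlt)
  have hs : Finsupp.single i 1 ≤ lam := by rw [Finsupp.single_le_iff]; omega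
  have htr : h.tr i j lam = 0 := by
    obtain ⟨γ, rfl⟩ := exists_add_of_le hs
    rw [add_comm, h.tr_step]
    apply h.tr_bot
    have hp : ∀ ν : Fin l → ℤ, ∑ a, ν a * ((γ + Finsupp.single j 1 : Fin l →₀ ℕ) a : ℤ) =
        ∑ a, ν a * ((Finsupp.single i 1 + γ : Fin l →₀ ℕ) a : ℤ) + (ν j - ν i) := by
      intro ν
      simp only [Finsupp.add_apply, Nat.cast_add, mul_add, Finset.sum_add_distrib,
        Finsupp.single_apply]
      simp
      ring
    apply htop
    · intro ν hν
      rw [hp]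
      have := hν hij
      linarith
    · have := hp (fun a => (a : ℕ))
      have : (i : ℕ) < j := hij'
      rw [← Nat.cast_lt (α := ℤ)]
      simp only [Nat.cast_sum, Nat.cast_mul]
      linarith
  have := h.string hij'.ne _ lam 0 rfl hlt.le (by simpa using htr)
  rw [zero_add] at this
  rcases Nat.mul_eq_zero.1 this with h1 | h1
  · omega
  · exact hw h1

theorem GlMod.exists_max (h : GlMod E n N) (hc : CasNil E (l * n : k) N) {lam0 : Fin l →₀ ℕ}
    (hw : wdim E N lam0 ≠ 0) : ∃ lam : Fin l →₀ ℕ, wdim E N lam ≠ 0 ∧ domLE lam0 lam ∧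
      Monotone lam ∧ critN n (stair l + lam : Fin l →₀ ℕ) := by
  classical
  have hmem : ∀ α, wdim E N α ≠ 0 → α ∈ (Finset.univ : Finset (Fin l)).finsuppAntidiag n := by
    intro α hα
    rw [Finset.mem_finsuppAntidiag]
    refine ⟨?_, by simp⟩
    by_contra hne
    exact hα (h.wdim_zero hne)
  set S := ((Finset.univ : Finset (Fin l)).finsuppAntidiag n).filter
    fun α => wdim E N α ≠ 0 ∧ domLE lam0 α with hS
  obtain ⟨lam, hl, hmax⟩ := Finset.exists_max_image S (fun α => ∑ i : Fin l, (i : ℕ) * α i)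
    ⟨lam0, Finset.mem_filter.2 ⟨hmem _ hw, hw, domLE.refl _⟩⟩
  rw [hS, Finset.mem_filter] at hl
  have htop : ∀ μ : Fin l →₀ ℕ, domLE lam μ →
      ∑ i : Fin l, (i : ℕ) * lam i < ∑ i : Fin l, (i : ℕ) * μ i → wdim E N μ = 0 := by
    intro μ hμ hlt
    by_contra hne
    have := hmax μ (Finset.mem_filter.2 ⟨hmem _ hne, hne, hl.2.2.trans hμ⟩)
    omega
  refine ⟨lam, hl.2.1, hl.2.2, h.max_mono hl.2.1 htop, ?_⟩
  rw [critN_iff (k := k)]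
  have := h.norm_of_coeff hc (γ := stair l + lam) (by
    rw [h.coeff_top htop]; exact_mod_cast hl.2.1)
  exact this

theorem GlMod.coeff_crit (h : GlMod E n N) (hc : CasNil E (l * n : k) N) {lam : Fin l →₀ ℕ}
    (hm : Monotone (stair l + lam : Fin l →₀ ℕ)) (hcr : critN n (stair l + lam : Fin l →₀ ℕ)) :
    coeff (stair l + lam) (Vand k l * chi E n N) = wdim E N lam := by
  apply h.coeff_top
  intro μ hμ hlt
  by_contra hne
  obtain ⟨ρ, -, hρ, -, hcr'⟩ := h.exists_max hc hne
  have hd := hμ.trans hρ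
  have h1 := hd (fun i => ((stair l + lam : Fin l →₀ ℕ) i : ℤ)) (fun i j hij => by
    exact Nat.cast_le.2 (hm hij))
  unfold critN at hcr hcr'
  have h2 : ∑ i, ((stair l + lam : Fin l →₀ ℕ) i) ^ 2 = ∑ i, ((stair l + ρ : Fin l →₀ ℕ) i) ^ 2 := by
    omega
  rw [← Nat.cast_inj (R := ℤ)] at h2
  simp only [Nat.cast_sum, Nat.cast_pow] at h2
  have h3 : ∑ i, ((ρ i : ℤ) - lam i) ^ 2 ≤ 0 := by
    have : ∑ i, ((ρ i : ℤ) - lam i) ^ 2 = (∑ i, (((stair l + ρ : Fin l →₀ ℕ) i : ℕ) : ℤ) ^ 2 -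
      ∑ i, (((stair l + lam : Fin l →₀ ℕ) i : ℕ) : ℤ) ^ 2) -
      2 * (∑ i, ((stair l + lam : Fin l →₀ ℕ) i : ℤ) * ρ i -
        ∑ i, ((stair l + lam : Fin l →₀ ℕ) i : ℤ) * lam i) := by
      rw [← Finset.sum_sub_distrib, ← Finset.sum_sub_distrib, Finset.mul_sum,
        ← Finset.sum_sub_distrib]
      refine Finset.sum_congr rfl fun i _ => ?_
      simp only [Finsupp.add_apply]
      push_cast
      ring
    rw [this]
    linarith
  have h4 : ∀ i, ρ i = lam i := by
    have := (Finset.sum_eq_zero_iff_of_nonneg (fun i _ => sq_nonneg ((ρ i : ℤ) - lam i))).1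
      (le_antisymm h3 (Finset.sum_nonneg fun i _ => sq_nonneg _))
    intro i
    have := this i (Finset.mem_univ i)
    have : (ρ i : ℤ) - lam i = 0 := by simpa using this
    omega
  have h5 := hρ (fun i => (i : ℕ)) (fun i j hij => by simpa using hij)
  simp only [h4] at h5
  zify at hlt
  linarith

end MaxPart

section EigPart
variable {k : Type} [Field k] {T : Type} [AddCommGroup T] [Module k T]

theorem finrank_iSup_indep {ι : Type*} (N : ι → Submodule k T) (hN : iSupIndep N)
    (hf : ∀ i, FiniteDimensional k (N i)) (s : Finset ι) :
    Module.finrank k (⨆ i ∈ s, N i : Submodule k T) = ∑ i ∈ s, Module.finrank k (N i) := by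
  classical
  induction s using Finset.induction_on with
  | empty =>
    have : (⨆ i ∈ (∅ : Finset ι), N i) = ⊥ := by simp
    rw [this, finrank_bot, Finset.sum_empty]
  | insert a s ha ih =>
    have hfd : FiniteDimensional k (⨆ i ∈ s, N i : Submodule k T) :=
      Submodule.finiteDimensional_finset_sup s N |> fun h => by
        rw [Finset.sup_eq_iSup] at h; exact h
    have hd : Disjoint (N a) (⨆ i ∈ s, N i) := (hN a).mono_right (by
      refine iSup₂_le fun i hi => le_iSup₂_of_le i ?_ le_rfl
      rintro rfl; exact ha hi)
    have := Submodule.finrank_sup_add_finrank_inf_eq (N a) (⨆ i ∈ s, N i)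
    rw [Finset.iSup_insert, Finset.sum_insert ha, ← ih]
    rw [hd.eq_bot, finrank_bot, add_zero] at this
    exact this

theorem sup_eig [IsAlgClosed k] (f : Module.End k T) (P : Submodule k T) [FiniteDimensional k P]
    (hP : ∀ v ∈ P, f v ∈ P) : ⨆ μ, (P ⊓ f.maxGenEigenspace μ) = P := by
  have h := Module.End.iSup_maxGenEigenspace_eq_top (f.restrict hP)
  have h2 := congrArg (Submodule.map P.subtype) h
  rw [Submodule.map_iSup, Submodule.map_top, Submodule.range_subtype] at h2
  conv_rhs => rw [← h2]
  refine iSup_congr fun μ => ?_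
  rw [Module.End.maxGenEigenspace, Module.End.maxGenEigenspace, Module.End.genEigenspace_restrict,
    Submodule.map_comap_subtype]

theorem fin_eig (f : Module.End k T) (P : Submodule k T) [FiniteDimensional k P]
    (hP : ∀ v ∈ P, f v ∈ P) : {μ | P ⊓ f.maxGenEigenspace μ ≠ ⊥}.Finite := by
  have h := (Module.End.independent_maxGenEigenspace (f.restrict hP))
  have h2 := WellFoundedGT.finite_ne_bot_of_iSupIndep h
  refine h2.subset fun μ hμ hbot => hμ ?_
  rw [Module.End.maxGenEigenspace, Module.End.genEigenspace_restrict] at hbot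
  have := congrArg (Submodule.map P.subtype) hbot
  rw [Submodule.map_comap_subtype, Submodule.map_bot] at this
  exact this

theorem finrank_eig [IsAlgClosed k] (f : Module.End k T) (P : Submodule k T) [FiniteDimensional k P]
    (hP : ∀ v ∈ P, f v ∈ P) (s : Finset k) (hs : ∀ μ, P ⊓ f.maxGenEigenspace μ ≠ ⊥ → μ ∈ s) :
    Module.finrank k P = ∑ μ ∈ s, Module.finrank k (P ⊓ f.maxGenEigenspace μ : Submodule k T) := by
  rw [← finrank_iSup_indep]
  · have h1 : (⨆ μ ∈ s, (P ⊓ f.maxGenEigenspace μ)) = P := by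
      conv_rhs => rw [← sup_eig f P hP]
      refine le_antisymm (iSup_mono fun μ => iSup_le fun _ => le_rfl) (iSup_le fun μ => ?_)
      by_cases h : P ⊓ f.maxGenEigenspace μ = ⊥
      · rw [h]; exact bot_le
      · exact le_iSup₂_of_le μ (hs μ h) le_rfl
    rw [h1]
  · exact (Module.End.independent_maxGenEigenspace f).mono fun μ => inf_le_right
  · intro μ; exact Submodule.finiteDimensional_of_le inf_le_left

variable {l : ℕ} {E : Fin l → Fin l → Module.End k T} {n : ℕ} {N : Submodule k T}

theorem GlRel.cas_comm (h : GlRel E) (a b : Fin l) : casimir E * E a b = E a b * casimir E := by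
  have key : ∀ i j, E i j * E j i * E a b = E a b * (E i j * E j i)
      + ((if i = a then E i j * E j b else 0) - (if j = b then E i j * E a i else 0)
      + (if j = a then E i b * E j i else 0) - (if i = b then E a j * E j i else 0)) := by
    intro i j
    rw [mul_assoc, h j i a b, mul_sub, mul_add, ← mul_assoc, h i j a b, sub_mul, add_mul]
    simp only [mul_ite, ite_mul, mul_zero, zero_mul, mul_assoc]
    abel
  simp only [casimir, Finset.sum_mul, Finset.mul_sum]
  simp only [key, Finset.sum_add_distrib, Finset.sum_sub_distrib]
  have e1 : ∑ i, ∑ j, (if i = a then E i j * E j b else 0) = ∑ j, E a j * E j b := by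
    rw [Finset.sum_comm]; simp
  have e2 : ∑ i, ∑ j, (if j = b then E i j * E a i else 0) = ∑ i, E i b * E a i := by simp
  have e3 : ∑ i, ∑ j, (if j = a then E i b * E j i else 0) = ∑ i, E i b * E a i := by simp
  have e4 : ∑ i, ∑ j, (if i = b then E a j * E j i else 0) = ∑ j, E a j * E j b := by
    rw [Finset.sum_comm]; simp
  rw [e1, e2, e3, e4]
  abel

theorem GlMod.cas_stable (h : GlMod E n N) : ∀ v ∈ N, casimir E v ∈ N := by
  intro v hv
  simp only [casimir, LinearMap.sum_apply]
  exact Submodule.sum_mem _ fun i _ => Submodule.sum_mem _ fun j _ =>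
    h.stable i j _ (h.stable j i v hv)

/-- The generalized eigenspace of the Casimir. -/
theorem GlMod.eig (h : GlMod E n N) (c : k) : GlMod E n (N ⊓ (casimir E).maxGenEigenspace c) := by
  refine h.mono inf_le_left fun i j v hv => ⟨h.stable i j v hv.1, ?_⟩
  exact Module.End.mapsTo_maxGenEigenspace_of_comm (h.rel.cas_comm i j) c hv.2

theorem casNil_eig (c : k) : CasNil E c (N ⊓ (casimir E).maxGenEigenspace c) := by
  rintro v ⟨-, hv⟩
  exact (Module.End.mem_maxGenEigenspace _ _ _).1 hv

theorem GlMod.coeff_eig [CharZero k] [IsAlgClosed k] (h : GlMod E n N) (γ : Fin l →₀ ℕ) :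
    (critN n γ → coeff γ (Vand k l * chi E n (N ⊓ (casimir E).maxGenEigenspace (l * n : k))) =
      coeff γ (Vand k l * chi E n N)) ∧
    (¬ critN n γ → coeff γ (Vand k l * chi E n (N ⊓ (casimir E).maxGenEigenspace (l * n : k))) = 0)
    := by
  classical
  have hfin := h.fin
  constructor
  · intro hcr
    set s := insert (l * n : k) (fin_eig (casimir E) N h.cas_stable).toFinset with hs
    have hchi : chi E n N = ∑ μ ∈ s, chi E n (N ⊓ (casimir E).maxGenEigenspace μ) := by
      ext α
      rw [coeff_sum, h.coeff_chi]
      rw [Finset.sum_congr rfl fun μ _ => (h.eig μ).coeff_chi α, ← Nat.cast_sum]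
      congr 1
      have := h.finwt α
      rw [wdim, finrank_eig (casimir E) (N ⊓ wtSp E α) (h.casMapsTo α) s]
      · refine Finset.sum_congr rfl fun μ _ => ?_
        rw [wdim, inf_right_comm]
      · intro μ hμ
        rw [hs, Finset.mem_insert, Set.Finite.mem_toFinset]
        right
        intro hb
        apply hμ
        rw [inf_right_comm, hb, bot_inf_eq]
    rw [hchi, Finset.mul_sum, coeff_sum, Finset.sum_eq_single (l * n : k)]
    · intro μ _ hμ
      by_contra hne
      have := (h.eig μ).norm_of_coeff (casNil_eig μ) hne
      rw [critN_iff (k := k)] at hcr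
      apply hμ
      linear_combination hcr - this
    · intro hn; exact absurd (Finset.mem_insert_self _ _) hn
  · intro hcr
    by_contra hne
    exact hcr ((critN_iff (k := k) γ).2 ((h.eig _).norm_of_coeff (casNil_eig _) hne))

theorem GlMod.ss_pow (h : GlMod E n N) {v : T} (hv : v ∈ N) (i : Fin l) (c : k) :
    ∀ m : ℕ, ((E i i - c • 1) ^ m) v = 0 → (E i i - c • 1) v = 0 := by
  have hst : ∀ v ∈ N, (E i i - c • 1) v ∈ N := fun v hv => by
    simp only [LinearMap.sub_apply, LinearMap.smul_apply, Module.End.one_apply]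
    exact N.sub_mem (h.stable i i v hv) (N.smul_mem _ hv)
  have hst' : ∀ m : ℕ, ((E i i - c • 1) ^ m) v ∈ N := by
    intro m
    induction m with
    | zero => simpa using hv
    | succ m ih => rw [pow_succ', Module.End.mul_apply]; exact hst _ ih
  intro m
  induction m with
  | zero => intro h0; rw [pow_zero, Module.End.one_apply] at h0; rw [h0, map_zero]
  | succ m ih =>
    intro h0
    cases m with
    | zero => simpa using h0
    | succ m =>
      apply ih
      rw [pow_succ', pow_succ', Module.End.mul_apply, Module.End.mul_apply] at h0
      have := h.ss _ (hst' m) i c h0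
      rwa [pow_succ', Module.End.mul_apply]

/-- total dimension is the sum of the weight space dimensions -/
theorem GlMod.finrank_eq [CharZero k] [IsAlgClosed k] (h : GlMod E n N) :
    Module.finrank k N = ∑ α ∈ (Finset.univ : Finset (Fin l)).finsuppAntidiag n, wdim E N α := by
  classical
  have hfin := h.fin
  set f : Fin l → Module.End k N := fun i => (E i i).restrict (h.stable i i) with hf
  have hcomm : ∀ i j, Commute (f i) (f j) := by
    intro i j
    ext ⟨v, hv⟩
    have := h.rel.app i i j j v
    by_cases hij : i = j
    · subst hij; rfl
    · rw [if_neg hij, if_neg hij, add_zero, sub_zero] at this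
      exact this
  have hmg : ∀ i c (v : N), v ∈ (f i).maxGenEigenspace c ↔ E i i v = c • (v : T) := by
    intro i c v
    rw [hf, Module.End.maxGenEigenspace, Module.End.genEigenspace_restrict, Submodule.mem_comap,
      ← Module.End.maxGenEigenspace, Module.End.mem_maxGenEigenspace]
    constructor
    · rintro ⟨m, hm⟩
      have := h.ss_pow v.2 i c m hm
      simpa [sub_eq_zero] using this
    · intro hv
      refine ⟨1, ?_⟩
      simp [hv]
  have htop := Module.End.iSup_iInf_maxGenEigenspace_eq_top_of_iSup_maxGenEigenspace_eq_top_of_commute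
    f (fun i j _ => hcomm i j) (fun i => Module.End.iSup_maxGenEigenspace_eq_top (f i))
  have hind := Module.End.independent_iInf_maxGenEigenspace_of_forall_mapsTo f
    (fun i j c => Module.End.mapsTo_maxGenEigenspace_of_comm (hcomm j i) c)
  set Q : (Fin l →₀ ℕ) → Submodule k N := fun α => ⨅ i, (f i).maxGenEigenspace (α i : k) with hQ
  have hQind : iSupIndep Q := hind.comp (f := fun α : Fin l →₀ ℕ => fun i => (α i : k)) (by
    intro α β hαβ
    ext i
    have := congrFun hαβ i
    exact Nat.cast_injective (R := k) this)
  have hQtop : (⨆ α ∈ (Finset.univ : Finset (Fin l)).finsuppAntidiag n, Q α) = ⊤ := by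
    rw [eq_top_iff, ← htop]
    refine iSup_le fun χ => ?_
    by_cases hb : (⨅ i, (f i).maxGenEigenspace (χ i)) = ⊥
    · rw [hb]; exact bot_le
    · obtain ⟨v, hv, hne⟩ := Submodule.exists_mem_ne_zero_of_ne_bot hb
      rw [Submodule.mem_iInf] at hv
      obtain ⟨α, hα, hχ⟩ := h.wts v v.2 (by simpa using hne) χ (fun i => (hmg _ _ _).1 (hv i))
      refine le_iSup₂_of_le α (by rw [Finset.mem_finsuppAntidiag]; exact ⟨hα, by simp⟩) ?_
      rw [hQ]
      simp only [hχ]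
      exact le_rfl
  have := finrank_iSup_indep Q hQind (fun _ => inferInstance)
    ((Finset.univ : Finset (Fin l)).finsuppAntidiag n)
  rw [hQtop, finrank_top] at this
  rw [this]
  refine Finset.sum_congr rfl fun α _ => ?_
  rw [wdim, ← Submodule.map_comap_subtype, Submodule.finrank_map_subtype_eq]
  have : Q α = Submodule.comap N.subtype (wtSp E α) := by
    ext v
    simp only [hQ, Submodule.mem_iInf, hmg, Submodule.mem_comap, mem_wtSp, Submodule.subtype_apply]
  rw [this]

end EigPart

section DetPart

/-- Chebyshev-like monic polynomials. -/
noncomputable def chS (K : Type) [Field K] : ℕ → Polynomial K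
  | 0 => 1
  | 1 => Polynomial.X
  | (i + 2) => Polynomial.X * chS K (i + 1) - chS K i

theorem chS_deg (K : Type) [Field K] : ∀ i, (chS K i).natDegree = i ∧ (chS K i).Monic := by
  intro i
  induction i using Nat.strong_induction_on with
  | _ i ih =>
    match i, ih with
    | 0, _ => simp [chS]
    | 1, _ => simp [chS, Polynomial.monic_X]
    | (i + 2), ih =>
      obtain ⟨d1, m1⟩ := ih (i + 1) (by omega)
      obtain ⟨d0, m0⟩ := ih i (by omega)
      have hm : (Polynomial.X * chS K (i + 1)).Monic := Polynomial.monic_X.mul m1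
      have hd : (Polynomial.X * chS K (i + 1)).natDegree = i + 2 := by
        rw [Polynomial.natDegree_X_mul m1.ne_zero, d1]
      have hlt : (chS K i).degree < (Polynomial.X * chS K (i + 1)).degree := by
        rw [Polynomial.degree_eq_natDegree m0.ne_zero, Polynomial.degree_eq_natDegree hm.ne_zero,
          d0, hd]
        exact_mod_cast (by omega : i < i + 2)
      constructor
      · rw [chS, Polynomial.natDegree_sub_eq_left_of_natDegree_lt, hd]
        rw [hd, d0]; omega
      · rw [chS]; exact hm.sub_of_left hlt

theorem chS_eval {K : Type} [Field K] {x : K} (hx : x ≠ 0) : ∀ i,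
    (1 - x ^ 2) * x ^ i * (chS K i).eval (x + x⁻¹) = 1 - x ^ (2 * i + 2) := by
  intro i
  induction i using Nat.strong_induction_on with
  | _ i ih =>
    match i, ih with
    | 0, _ => simp [chS]
    | 1, _ => simp [chS]; field_simp; ring
    | (i + 2), ih =>
      have h1 := ih (i + 1) (by omega)
      have h0 := ih i (by omega)
      rw [chS, Polynomial.eval_sub, Polynomial.eval_mul, Polynomial.eval_X]
      have : (1 - x ^ 2) * x ^ (i + 2) * ((x + x⁻¹) * Polynomial.eval (x + x⁻¹) (chS K (i + 1)) -
          Polynomial.eval (x + x⁻¹) (chS K i)) =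
          (x * (x + x⁻¹)) * ((1 - x ^ 2) * x ^ (i + 1) * Polynomial.eval (x + x⁻¹) (chS K (i + 1))) -
          x ^ 2 * ((1 - x ^ 2) * x ^ i * Polynomial.eval (x + x⁻¹) (chS K i)) := by ring
      rw [this, h1, h0, mul_add, mul_inv_cancel₀ hx]
      ring

variable {l : ℕ}

theorem prod_prs {R : Type*} [CommMonoid R] (f : Fin l → Fin l → R) :
    ∏ i : Fin l, ∏ j ∈ Finset.Ioi i, f i j = ∏ p ∈ prs l, f p.1 p.2 := by
  rw [prs, Finset.prod_filter, ← Finset.univ_product_univ, Finset.prod_product]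
  refine Finset.prod_congr rfl fun i _ => ?_
  rw [← Finset.prod_filter]
  refine Finset.prod_congr ?_ fun _ _ => rfl
  ext j; simp

theorem prod_prs_x {R : Type*} [CommMonoid R] (x : Fin l → R) :
    ∏ p ∈ prs l, (x p.1 * x p.2) = ∏ i, x i ^ (l - 1) := by
  rw [Finset.prod_mul_distrib, ← prod_prs (fun i _ => x i)]
  have h2 : ∏ p ∈ prs l, x p.2 = ∏ j : Fin l, x j ^ (j : ℕ) := by
    rw [prs, Finset.prod_filter, ← Finset.univ_product_univ, Finset.prod_product_right]
    refine Finset.prod_congr rfl fun i _ => ?_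
    rw [← Finset.prod_filter]
    dsimp only
    rw [Finset.prod_const]
    congr 1
    rw [← Fin.card_Iio]
    congr 1
    ext j; simp
  rw [h2, ← Finset.prod_mul_distrib]
  refine Finset.prod_congr rfl fun i _ => ?_
  rw [Finset.prod_const, Fin.card_Ioi, ← pow_add]
  congr 1
  have := i.2
  omega

theorem det_field {K : Type} [Field K] (x : Fin l → K) (hx : ∀ i, x i ≠ 0) :
    (Matrix.of fun j i : Fin l => x j ^ (l - 1 - (i : ℕ)) - x j ^ (l + 1 + (i : ℕ))).det =
      (∏ j, (1 - x j ^ 2)) * ∏ p ∈ prs l, ((x p.2 - x p.1) * (x p.1 * x p.2 - 1)) := by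
  have h1 : (Matrix.of fun j i : Fin l => x j ^ (l - 1 - (i : ℕ)) - x j ^ (l + 1 + (i : ℕ))) =
      Matrix.of fun j i : Fin l => ((1 - x j ^ 2) * x j ^ (l - 1)) *
        (Matrix.of (fun a b : Fin l => (chS K b).eval (x a + (x a)⁻¹))) j i := by
    ext j i
    simp only [Matrix.of_apply]
    have := chS_eval (hx j) i
    have hi : l - 1 = (l - 1 - i) + i := by have := i.2; omega
    have hi2 : l + 1 + i = (l - 1 - i) + (2 * i + 2) := by have := i.2; omega
    rw [hi2, pow_add (x j) (l - 1 - i) (2 * i + 2)]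
    conv_rhs => rw [hi, pow_add]
    linear_combination -(x j) ^ (l - 1 - (i : ℕ)) * this
  rw [h1, Matrix.det_mul_column, ← Matrix.det_eval_matrixOfPolynomials_eq_det_vandermonde _
    (fun i : Fin l => chS K i) (fun i => (chS_deg K i).1) (fun i => (chS_deg K i).2),
    Matrix.det_vandermonde, prod_prs (fun i j => x j + (x j)⁻¹ - (x i + (x i)⁻¹)),
    Finset.prod_mul_distrib, mul_assoc, ← prod_prs_x, ← Finset.prod_mul_distrib]
  congr 1
  refine Finset.prod_congr rfl fun p _ => ?_
  have := hx p.1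
  have := hx p.2
  field_simp
  ring

/-- weakly increasing pairs -/
def lePrs (l : ℕ) : Finset (Fin l × Fin l) := Finset.univ.filter fun p => p.1 ≤ p.2

theorem prod_lePrs {R : Type*} [CommMonoid R] (f : Fin l × Fin l → R) :
    ∏ p ∈ lePrs l, f p = (∏ i, f (i, i)) * ∏ p ∈ prs l, f p := by
  have : lePrs l = (Finset.univ : Finset (Fin l)).map ⟨fun i => (i, i), fun i j h => by
      simpa using h⟩ ∪ prs l := by
    ext ⟨a, b⟩
    simp only [lePrs, prs, Finset.mem_filter, Finset.mem_univ, true_and, Finset.mem_union,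
      Finset.mem_map]
    constructor
    · intro h
      rcases h.lt_or_eq with h | h
      · exact Or.inr h
      · exact Or.inl ⟨a, by rw [h]; rfl⟩
    · rintro (⟨c, h⟩ | h)
      · cases h; exact le_rfl
      · exact h.le
  rw [this, Finset.prod_union, Finset.prod_map]
  · rfl
  · rw [Finset.disjoint_left]
    rintro ⟨a, b⟩ h1 h2
    simp only [prs, Finset.mem_filter, Finset.mem_univ, true_and, Finset.mem_map] at h1 h2
    obtain ⟨c, h⟩ := h1
    cases h
    exact lt_irrefl _ h2

variable {k : Type} [Field k]

/-- matrix of the denominator determinant, over polynomials; rows are variables -/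
noncomputable def denM (k : Type) [Field k] (l : ℕ) : Matrix (Fin l) (Fin l) (MvPolynomial (Fin l) k) :=
  Matrix.of fun j i => X j ^ (l - 1 - (i : ℕ)) - X j ^ (l + 1 + (i : ℕ))

theorem den_identity : Vand k l * ∏ p ∈ lePrs l, (1 - X p.1 * X p.2 : MvPolynomial (Fin l) k) =
    (-1) ^ (prs l).card * (denM k l).det := by
  apply FaithfulSMul.algebraMap_injective (MvPolynomial (Fin l) k)
    (FractionRing (MvPolynomial (Fin l) k))
  set φ := algebraMap (MvPolynomial (Fin l) k) (FractionRing (MvPolynomial (Fin l) k)) with hφ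
  have hx : ∀ i : Fin l, φ (X i) ≠ 0 := fun i => by
    rw [hφ, Ne, FaithfulSMul.algebraMap_eq_zero_iff]
    exact X_ne_zero i
  have := det_field (fun i => φ (X i)) hx
  rw [map_mul, map_mul, RingHom.map_det]
  have h2 : φ.mapMatrix (denM k l) = Matrix.of fun j i : Fin l =>
      φ (X j) ^ (l - 1 - (i : ℕ)) - φ (X j) ^ (l + 1 + (i : ℕ)) := by
    ext j i
    simp [denM]
  rw [h2, this, prod_lePrs, map_mul, Vand, map_prod, map_prod, map_prod]
  have h3 : ∏ p ∈ prs l, ((φ (X p.2) - φ (X p.1)) * (φ (X p.1) * φ (X p.2) - 1)) =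
      (∏ p ∈ prs l, φ (X p.2 - X p.1)) * ((-1) ^ (prs l).card *
        ∏ p ∈ prs l, φ (1 - X p.1 * X p.2)) := by
    rw [← Finset.prod_const, ← Finset.prod_mul_distrib, ← Finset.prod_mul_distrib]
    refine Finset.prod_congr rfl fun p _ => ?_
    simp only [map_sub, map_mul, map_one]
    ring
  rw [h3]
  have h4 : ∏ j : Fin l, (1 - φ (X j) ^ 2) = ∏ j : Fin l, φ (1 - X j * X j) := by
    refine Finset.prod_congr rfl fun p _ => ?_
    simp only [map_sub, map_mul, map_one]
    ring
  rw [h4, map_pow, map_neg, map_one]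
  have h5 : ((-1) ^ (prs l).card * (-1) ^ (prs l).card :
    FractionRing (MvPolynomial (Fin l) k)) = 1 := by
    rw [← mul_pow]; simp
  linear_combination -(∏ j : Fin l, φ (1 - X j * X j)) * (∏ p ∈ prs l, φ (X p.2 - X p.1)) *
    (∏ p ∈ prs l, φ (1 - X p.1 * X p.2)) * h5

end DetPart

section LPart
variable {k : Type} [Field k] {l : ℕ}

/-- truncated power -/
noncomputable def ell (k : Type) [Field k] (g a : ℕ) : Polynomial k :=
  if a ≤ g then Polynomial.X ^ (g - a) else 0

/-- the functional recording multiplication by complete symmetric functions -/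
noncomputable def Lf (γ : Fin l →₀ ℕ) : MvPolynomial (Fin l) k →ₗ[k] Polynomial k :=
  (basisMonomials (Fin l) k).constr k fun e => ∏ j, ell k (γ j) (e j)

theorem Lf_monomial (γ e : Fin l →₀ ℕ) : Lf γ (monomial e (1 : k)) = ∏ j, ell k (γ j) (e j) := by
  have := (basisMonomials (Fin l) k).constr_basis k (fun e => ∏ j, ell k (γ j) (e j)) e
  rw [coe_basisMonomials] at this
  exact this

theorem Lf_prodpow (γ : Fin l →₀ ℕ) (e : Fin l → ℕ) :
    Lf γ (∏ j, (X j : MvPolynomial (Fin l) k) ^ e j) = ∏ j, ell k (γ j) (e j) := by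
  rw [prodXpow, Lf_monomial]; rfl

theorem Lf_prodsub (γ : Fin l →₀ ℕ) (a b : Fin l → ℕ) :
    Lf γ (∏ j, ((X j : MvPolynomial (Fin l) k) ^ a j - X j ^ b j)) =
      ∏ j, (ell k (γ j) (a j) - ell k (γ j) (b j)) := by
  classical
  rw [Finset.prod_sub, Finset.prod_sub, map_sum]
  refine Finset.sum_congr rfl fun t _ => ?_
  have key : ∀ (R : Type) [CommRing R] (F G : Fin l → R),
      (∏ j ∈ Finset.univ \ t, F j) * ∏ j ∈ t, G j = ∏ j, if j ∈ t then G j else F j := by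
    intro R _ F G
    rw [Finset.prod_ite, mul_comm]
    congr 1
    · exact Finset.prod_congr (by ext; simp) fun _ _ => rfl
    · exact Finset.prod_congr (by ext; simp) fun _ _ => rfl
  rw [mul_assoc, mul_assoc, key, key]
  have h1 : ((-1) ^ t.card * ∏ j, (if j ∈ t then X j ^ b j else X j ^ a j) :
      MvPolynomial (Fin l) k) = ((-1 : k) ^ t.card) • ∏ j, X j ^ (if j ∈ t then b j else a j) := by
    rw [smul_eq_C_mul]
    simp only [map_pow, map_neg, map_one]
    congr 1
    refine Finset.prod_congr rfl fun j _ => ?_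
    split_ifs <;> rfl
  rw [h1, map_smul, Lf_prodpow, Polynomial.smul_eq_C_mul]
  simp only [map_pow, map_neg, map_one]
  congr 1
  refine Finset.prod_congr rfl fun j _ => ?_
  split_ifs <;> rfl

/-- complete symmetric polynomial -/
noncomputable def hsym (k : Type) [Field k] (l r : ℕ) : MvPolynomial (Fin l) k :=
  ∑ β ∈ (Finset.univ : Finset (Fin l)).finsuppAntidiag r, monomial β 1

theorem coeff_hsym (r : ℕ) (α : Fin l →₀ ℕ) : coeff α (hsym k l r) = if ∑ i, α i = r then 1 else 0 := by
  rw [hsym, coeff_sum]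
  simp only [coeff_monomial]
  rw [Finset.sum_ite_eq']
  simp [Finset.mem_finsuppAntidiag]

theorem coeff_Lf (γ : Fin l →₀ ℕ) (r : ℕ) (f : MvPolynomial (Fin l) k) :
    (Lf γ f).coeff r = coeff γ (f * hsym k l r) := by
  induction f using MvPolynomial.induction_on' with
  | monomial e c =>
    have : monomial e c = c • monomial e (1 : k) := by rw [smul_monomial, smul_eq_mul, mul_one]
    rw [this, map_smul, Polynomial.coeff_smul, smul_mul_assoc, coeff_smul, Lf_monomial]
    congr 1
    rw [coeff_monomial_mul', coeff_hsym]
    split_ifs with h1 h2 h2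
    · have : ∀ j, ell k (γ j) (e j) = Polynomial.X ^ ((γ - e) j) := fun j => by
        rw [ell, if_pos (h1 j)]; rfl
      simp only [this]
      rw [Finset.prod_pow_eq_pow_sum, h2, Polynomial.coeff_X_pow]; simp
    · have : ∀ j, ell k (γ j) (e j) = Polynomial.X ^ ((γ - e) j) := fun j => by
        rw [ell, if_pos (h1 j)]; rfl
      simp only [this]
      rw [Finset.prod_pow_eq_pow_sum, Polynomial.coeff_X_pow, if_neg (Ne.symm h2), mul_zero]
    · rw [Finsupp.le_def] at h1
      push Not at h1
      obtain ⟨j, hj⟩ := h1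
      rw [Finset.prod_eq_zero (Finset.mem_univ j), Polynomial.coeff_zero]
      rw [ell, if_neg (by omega)]
  | add p q hp hq => rw [map_add, Polynomial.coeff_add, hp, hq, add_mul, coeff_add]

/-- entries of the reduced matrix -/
noncomputable def denB (k : Type) [Field k] {l : ℕ} (γ : Fin l →₀ ℕ) : Matrix (Fin l) (Fin l) (Polynomial k) :=
  Matrix.of fun i j => (ell k (γ j) (l - 1 - (i : ℕ)) - ell k (γ j) (l + 1 + (i : ℕ))) -
    (if (i : ℕ) = 0 then 0 else Polynomial.X *
      (ell k (γ j) (l - (i : ℕ)) - ell k (γ j) (l + (i : ℕ))))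

theorem Lf_det (γ : Fin l →₀ ℕ) : Lf γ (denM k l).det = (denB k γ).det := by
  have h1 : Lf γ (denM k l).det = (Matrix.of fun i j : Fin l =>
      ell k (γ j) (l - 1 - (i : ℕ)) - ell k (γ j) (l + 1 + (i : ℕ))).det := by
    rw [← Matrix.det_transpose, Matrix.det_apply, Matrix.det_apply, map_sum]
    refine Finset.sum_congr rfl fun σ _ => ?_
    have := Lf_prodsub (k := k) γ (fun j => l - 1 - (σ j : ℕ)) (fun j => l + 1 + (σ j : ℕ))
    simp only [denM, Matrix.transpose_apply, Matrix.of_apply]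
    rw [← this]
    rcases Int.units_eq_one_or (Equiv.Perm.sign σ) with h | h <;> rw [h] <;> simp
  rw [h1]
  cases l with
  | zero => simp
  | succ l =>
    apply Matrix.det_eq_of_forall_row_eq_smul_add_pred (fun _ => Polynomial.X)
    · intro j; simp [denB]
    · intro i j
      simp only [denB, Matrix.of_apply, Fin.val_succ, Fin.val_castSucc]
      rw [if_neg (by omega)]
      have e1 : l + 1 - 1 - (i : ℕ) = l + 1 - (i + 1) := by omega
      have e2 : l + 1 + 1 + (i : ℕ) = l + 1 + (i + 1) := by omega
      rw [e1, e2]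
      ring

/-- folded exponent -/
def fold (l g : ℕ) : ℕ := if l ≤ g then g - l else l - 1 - g

theorem denB_zero (γ : Fin l →₀ ℕ) (i j : Fin l) (h : fold l (γ j) < i) : denB k γ i j = 0 := by
  simp only [denB, Matrix.of_apply]
  have hi := i.2
  rw [if_neg (by omega)]
  unfold fold at h
  split_ifs at h with hl
  · rw [ell, if_pos (by omega), ell, if_neg (by omega), ell, if_pos (by omega), ell,
      if_neg (by omega), sub_zero, sub_zero, ← pow_succ',
      show γ j - (l - (i : ℕ)) + 1 = γ j - (l - 1 - i) by omega, sub_self]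
  · by_cases h2 : l - (i : ℕ) ≤ γ j
    · rw [ell, if_pos (by omega), ell, if_neg (by omega), ell, if_pos (by omega), ell,
      if_neg (by omega), sub_zero, sub_zero, ← pow_succ',
      show γ j - (l - (i : ℕ)) + 1 = γ j - (l - 1 - i) by omega, sub_self]
    · omega

theorem denB_diag (γ : Fin l →₀ ℕ) (i j : Fin l) (h : (i : ℕ) = fold l (γ j)) :
    denB k γ i j = if l ≤ γ j then Polynomial.X else 1 := by
  simp only [denB, Matrix.of_apply]
  have hi := i.2
  unfold fold at h
  by_cases h0 : (i : ℕ) = 0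
  · rw [if_pos h0]
    split_ifs at h ⊢ with hl
    · rw [ell, if_pos (by omega), ell, if_neg (by omega), show γ j - (l - 1 - i) = 1 by omega]; simp
    · rw [ell, if_pos (by omega), ell, if_neg (by omega), show γ j - (l - 1 - i) = 0 by omega]; simp
  · rw [if_neg h0]
    split_ifs at h ⊢ with hl
    · rw [ell, if_pos (by omega), ell, if_neg (by omega), ell, if_pos (by omega), ell,
        if_pos (by omega), show γ j - (l - 1 - i) = (γ j - (l - i)) + 1 by omega,
        show γ j - (l + i) = 0 by omega]
      ring
    · rw [ell, if_pos (by omega), ell, if_neg (by omega), ell, if_neg (by omega), ell,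
        if_neg (by omega), show γ j - (l - 1 - i) = 0 by omega]
      ring

theorem fold_sq (γ : Fin l →₀ ℕ) {n : ℕ} (hn : ∑ j, γ j = n + ∑ i : Fin l, (i : ℕ)) (hc : critN n γ) :
    ∑ j, ((fold l (γ j) : ℤ) ^ 2 + fold l (γ j)) = ∑ i : Fin l, (((i : ℕ) : ℤ) ^ 2 + (i : ℕ)) := by
  have h1 : ∀ j, (fold l (γ j) : ℤ) ^ 2 + fold l (γ j) =
      (γ j : ℤ) ^ 2 - (2 * l - 1) * γ j + l * (l - 1) := by
    intro j
    unfold fold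
    split_ifs with h
    · rw [Nat.cast_sub h]; ring
    · rw [Nat.cast_sub (by omega), Nat.cast_sub (by omega)]; push_cast; ring
  have h2 : ∑ i : Fin l, (((i : ℕ) : ℤ) ^ 2 + (i : ℕ)) =
      ∑ i : Fin l, (((i : ℕ) : ℤ) ^ 2 - (2 * l - 1) * (i : ℕ) + l * (l - 1)) := by
    rw [← Equiv.sum_comp Fin.revPerm]
    refine Finset.sum_congr rfl fun i _ => ?_
    rw [Fin.revPerm_apply, Fin.val_rev, Nat.cast_sub (by omega)]; push_cast; ring
  rw [h2]
  simp only [h1, Finset.sum_add_distrib, Finset.sum_sub_distrib, ← Finset.mul_sum]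
  unfold critN at hc
  zify at hc hn
  rw [hn]
  linear_combination hc

theorem det_ne (γ : Fin l →₀ ℕ) {n : ℕ} (hn : ∑ j, γ j = n + ∑ i : Fin l, (i : ℕ)) (hc : critN n γ)
    (hd : (denB k γ).det ≠ 0) : ∃ σ : Equiv.Perm (Fin l), ∀ j, (σ j : ℕ) = fold l (γ j) := by
  rw [Matrix.det_apply] at hd
  obtain ⟨σ, -, hσ⟩ := Finset.exists_ne_zero_of_sum_ne_zero hd
  refine ⟨σ, ?_⟩
  have hle : ∀ j, (σ j : ℕ) ≤ fold l (γ j) := by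
    intro j
    by_contra hlt
    apply hσ
    have h0 : ∏ i, denB k γ (σ i) i = 0 :=
      Finset.prod_eq_zero (f := fun i => denB k γ (σ i) i) (Finset.mem_univ j)
        (denB_zero γ (σ j) j (by omega))
    rw [h0, smul_zero]
  have hs := fold_sq γ hn hc
  rw [← Equiv.sum_comp σ (fun i : Fin l => ((i : ℕ) : ℤ) ^ 2 + (i : ℕ))] at hs
  have hle2 : ∀ j ∈ Finset.univ, (((σ j : ℕ) : ℤ) ^ 2 + (σ j : ℕ)) ≤
      ((fold l (γ j) : ℤ) ^ 2 + fold l (γ j)) := by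
    intro j _
    have : ((σ j : ℕ) : ℤ) ≤ fold l (γ j) := by exact_mod_cast hle j
    have h0 : (0 : ℤ) ≤ ((σ j : ℕ) : ℤ) := by positivity
    nlinarith
  have := (Finset.sum_eq_sum_iff_of_le hle2).1 hs.symm
  intro j
  have h1 := this j (Finset.mem_univ j)
  have h2 : ((σ j : ℕ) : ℤ) ≤ fold l (γ j) := by exact_mod_cast hle j
  have h0 : (0 : ℤ) ≤ ((σ j : ℕ) : ℤ) := by positivity
  have : ((σ j : ℕ) : ℤ) = fold l (γ j) := by nlinarith
  exact_mod_cast this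

theorem det_val (γ : Fin l →₀ ℕ) (σ : Equiv.Perm (Fin l)) (hσ : ∀ j, (σ j : ℕ) = fold l (γ j)) :
    (denB k γ).det = Equiv.Perm.sign σ •
      Polynomial.X ^ (Finset.univ.filter fun j => l ≤ γ j).card := by
  rw [Matrix.det_apply, Finset.sum_eq_single σ]
  · congr 1
    rw [Finset.prod_congr rfl fun j _ => denB_diag γ _ j (hσ j), Finset.prod_ite, Finset.prod_const,
      Finset.prod_const_one, mul_one]
  · intro τ _ hτ
    by_cases hle : ∀ j, (τ j : ℕ) ≤ σ j
    · exfalso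
      apply hτ
      have h2 : ∑ j, ((τ j : Fin l) : ℕ) = ∑ j, ((σ j : Fin l) : ℕ) := by
        rw [Equiv.sum_comp τ (fun j => (j : ℕ)), Equiv.sum_comp σ (fun j => (j : ℕ))]
      have := (Finset.sum_eq_sum_iff_of_le fun j _ => hle j).1 h2
      ext j
      exact this j (Finset.mem_univ j)
    · push Not at hle
      obtain ⟨j, hj⟩ := hle
      have h0 : ∏ i, denB k γ (τ i) i = 0 :=
        Finset.prod_eq_zero (f := fun i => denB k γ (τ i) i) (Finset.mem_univ j)
          (denB_zero γ (τ j) j (by rw [← hσ]; exact hj))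
      rw [h0, smul_zero]
  · intro h; exact absurd (Finset.mem_univ _) h

/-- elementary part: the character of the exterior power of the space of quadrics -/
noncomputable def esym (k : Type) [Field k] (l p : ℕ) : MvPolynomial (Fin l) k :=
  ∑ S ∈ (lePrs l).powersetCard p, ∏ a ∈ S, (X a.1 * X a.2)

theorem Vand_homog : (Vand k l).IsHomogeneous (∑ i : Fin l, (i : ℕ)) := by
  rw [Vand]
  have h := MvPolynomial.IsHomogeneous.prod (prs l) (fun p => (X p.2 - X p.1 : MvPolynomial (Fin l) k))
    (fun _ => 1) (fun p _ => (isHomogeneous_X k p.2).sub (isHomogeneous_X k p.1))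
  convert h using 1
  have := pair_mS (l := l) ∅ (fun _ => 1)
  rw [mS_empty] at this
  simp at this ⊢
  exact_mod_cast this

theorem hsym_homog (r : ℕ) : (hsym k l r).IsHomogeneous r := by
  intro α hα
  rw [coeff_hsym] at hα
  by_contra h
  apply hα
  rw [if_neg]
  intro h2
  apply h
  rw [← h2, ← Finsupp.degree_eq_sum, Finsupp.degree_eq_weight_one]
  rfl

theorem coeff_VEh (γ : Fin l →₀ ℕ) (p r : ℕ) (hγ : ∑ j, γ j = (2 * p + r) + ∑ i : Fin l, (i : ℕ)) :
    coeff γ (Vand k l * (esym k l p * hsym k l r)) =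
      (-1) ^ p * (-1) ^ (prs l).card * ((denB k γ).det).coeff r := by
  rw [← Lf_det, coeff_Lf]
  have h1 : (denM k l).det = (-1) ^ (prs l).card *
      (Vand k l * ∏ p ∈ lePrs l, (1 - X p.1 * X p.2 : MvPolynomial (Fin l) k)) := by
    rw [den_identity, ← mul_assoc, ← mul_pow]; simp
  have h2 : ∏ p ∈ lePrs l, (1 - X p.1 * X p.2 : MvPolynomial (Fin l) k) =
      ∑ S ∈ (lePrs l).powerset, (-1) ^ S.card * ∏ a ∈ S, (X a.1 * X a.2) := by
    rw [Finset.prod_sub]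
    refine Finset.sum_congr rfl fun S _ => ?_
    simp
  have h3 : coeff γ ((Vand k l * ∏ p ∈ lePrs l, (1 - X p.1 * X p.2 : MvPolynomial (Fin l) k)) *
      hsym k l r) = (-1) ^ p * coeff γ (Vand k l * (esym k l p * hsym k l r)) := by
    rw [h2, esym, Finset.powersetCard_eq_filter, Finset.mul_sum, Finset.sum_mul, Finset.sum_mul,
      Finset.mul_sum, coeff_sum, coeff_sum, Finset.sum_filter, Finset.mul_sum]
    refine Finset.sum_congr rfl fun S _ => ?_
    have e1 : Vand k l * ((-1) ^ S.card * ∏ a ∈ S, (X a.1 * X a.2)) * hsym k l r =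
        C ((-1) ^ S.card) * (Vand k l * ((∏ a ∈ S, (X a.1 * X a.2)) * hsym k l r)) := by
      simp only [map_pow, map_neg, map_one]; ring
    rw [e1, coeff_C_mul]
    split_ifs with hS
    · rw [hS]
    · rw [mul_zero]
      have hh : (Vand k l * ((∏ a ∈ S, (X a.1 * X a.2)) * hsym k l r)).IsHomogeneous
          ((∑ i : Fin l, (i : ℕ)) + ((∑ a ∈ S, 2) + r)) := by
        refine Vand_homog.mul (IsHomogeneous.mul ?_ (hsym_homog r))
        exact IsHomogeneous.prod S _ (fun _ => 2) (fun a _ =>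
          (isHomogeneous_X k a.1).mul (isHomogeneous_X k a.2))
      rw [hh.coeff_eq_zero, mul_zero]
      rw [Finsupp.degree_eq_sum, hγ, Finset.sum_const, smul_eq_mul]
      omega
  have e2 : (-1) ^ (prs l).card * (Vand k l * ∏ p ∈ lePrs l, (1 - X p.1 * X p.2 :
      MvPolynomial (Fin l) k)) * hsym k l r = C ((-1) ^ (prs l).card) * ((Vand k l * ∏ p ∈ lePrs l,
      (1 - X p.1 * X p.2 : MvPolynomial (Fin l) k)) * hsym k l r) := by
      simp only [map_pow, map_neg, map_one]; ring
  rw [h1, e2, coeff_C_mul, h3]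
  have h5 : ((-1) ^ (prs l).card * (-1) ^ (prs l).card : k) = 1 := by rw [← mul_pow]; simp
  have h6 : ((-1) ^ p * (-1) ^ p : k) = 1 := by rw [← mul_pow]; simp
  linear_combination (-(coeff γ (Vand k l * (esym k l p * hsym k l r)))) * (h5 + h6 * ((-1) ^ (prs l).card * (-1) ^ (prs l).card : k))

theorem coeff_VEh_zero (γ : Fin l →₀ ℕ) (p r : ℕ)
    (hγ : ∑ j, γ j ≠ (2 * p + r) + ∑ i : Fin l, (i : ℕ)) :
    coeff γ (Vand k l * (esym k l p * hsym k l r)) = 0 := by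
  have hh : (Vand k l * (esym k l p * hsym k l r)).IsHomogeneous
      ((∑ i : Fin l, (i : ℕ)) + (2 * p + r)) := by
    refine Vand_homog.mul (IsHomogeneous.mul ?_ (hsym_homog r))
    rw [esym]
    refine IsHomogeneous.sum _ _ _ fun S hS => ?_
    have := IsHomogeneous.prod S _ (fun _ => 2) (fun a _ =>
          (isHomogeneous_X k a.1).mul (isHomogeneous_X k a.2))
    rw [Finset.sum_const, (Finset.mem_powersetCard.1 hS).2, smul_eq_mul, mul_comm] at this
    exact this
  rw [hh.coeff_eq_zero]
  rw [Finsupp.degree_eq_sum]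
  omega

theorem VEh_ne (γ : Fin l →₀ ℕ) (p r : ℕ) (hc : critN (2 * p + r) γ)
    (h : coeff γ (Vand k l * (esym k l p * hsym k l r)) ≠ 0) :
    (∃ σ : Equiv.Perm (Fin l), ∀ j, (σ j : ℕ) = fold l (γ j)) ∧
      (Finset.univ.filter fun j => l ≤ γ j).card = r ∧
      ∑ j, γ j = (2 * p + r) + ∑ i : Fin l, (i : ℕ) := by
  have hγ : ∑ j, γ j = (2 * p + r) + ∑ i : Fin l, (i : ℕ) := by
    by_contra hne
    exact h (coeff_VEh_zero γ p r hne)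
  rw [coeff_VEh γ p r hγ] at h
  have h1 : (denB k γ).det ≠ 0 := by
    intro h0; rw [h0] at h; simp at h
  obtain ⟨σ, hσ⟩ := det_ne γ hγ hc h1
  refine ⟨⟨σ, hσ⟩, ?_, hγ⟩
  rw [det_val γ σ hσ] at h
  by_contra hne
  apply h
  rcases Int.units_eq_one_or (Equiv.Perm.sign σ) with h | h <;> rw [h] <;>
    simp [Polynomial.coeff_X_pow, Ne.symm hne]

theorem VEh_val (γ : Fin l →₀ ℕ) (p r : ℕ) (σ : Equiv.Perm (Fin l))
    (hσ : ∀ j, (σ j : ℕ) = fold l (γ j))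
    (hr : (Finset.univ.filter fun j => l ≤ γ j).card = r)
    (hγ : ∑ j, γ j = (2 * p + r) + ∑ i : Fin l, (i : ℕ)) :
    coeff γ (Vand k l * (esym k l p * hsym k l r)) = 1 ∨
    coeff γ (Vand k l * (esym k l p * hsym k l r)) = -1 := by
  rw [coeff_VEh γ p r hγ, det_val γ σ hσ, hr]
  rcases Int.units_eq_one_or (Equiv.Perm.sign σ) with h | h <;>
  rcases neg_one_pow_eq_or k p with h1 | h1 <;>
  rcases neg_one_pow_eq_or k (prs l).card with h2 | h2 <;> rw [h, h1, h2] <;> simp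

end LPart

section EvalPart
variable {k : Type} [Field k] {l : ℕ}

/-- alternating polynomials, in terms of coefficients -/
def Alt (Q : MvPolynomial (Fin l) k) : Prop :=
  ∀ (σ : Equiv.Perm (Fin l)) (γ : Fin l →₀ ℕ),
    coeff (γ.mapDomain σ) Q = ((Equiv.Perm.sign σ : ℤ) : k) * coeff γ Q

theorem critN_perm {n : ℕ} (σ : Equiv.Perm (Fin l)) (γ : Fin l →₀ ℕ) :
    critN n (γ.mapDomain σ : Fin l →₀ ℕ) ↔ critN n γ := by
  unfold critN
  simp only [Finsupp.mapDomain_equiv_apply]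
  rw [Equiv.sum_comp σ.symm (fun i => γ i ^ 2)]

theorem alt_VEh (p r : ℕ) : Alt (Vand k l * (esym k l p * hsym k l r)) := by
  intro σ γ
  have hs : ∑ j, (γ.mapDomain σ) j = ∑ j, γ j := by
    simp only [Finsupp.mapDomain_equiv_apply]
    exact Equiv.sum_comp σ.symm (fun i => γ i)
  by_cases hγ : ∑ j, γ j = (2 * p + r) + ∑ i : Fin l, (i : ℕ)
  · rw [coeff_VEh γ p r hγ, coeff_VEh _ p r (hs.trans hγ)]
    have : denB k (γ.mapDomain σ) = (denB k γ).submatrix id σ.symm := by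
      ext i j
      simp only [denB, Matrix.submatrix_apply, Matrix.of_apply, Finsupp.mapDomain_equiv_apply, id]
    rw [this, Matrix.det_permute', Equiv.Perm.sign_symm]
    rcases Int.units_eq_one_or (Equiv.Perm.sign σ) with h | h <;> rw [h] <;> simp
  · rw [coeff_VEh_zero γ p r hγ, coeff_VEh_zero _ p r (by rw [hs]; exact hγ), mul_zero]

theorem alt_zero [CharZero k] {Q : MvPolynomial (Fin l) k} (hQ : Alt Q)
    (h0 : ∀ γ : Fin l →₀ ℕ, StrictMono γ → coeff γ Q = 0) : Q = 0 := by
  ext γ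
  rw [coeff_zero]
  by_cases hinj : Function.Injective γ
  · have h1 := hQ (Tuple.sort γ)⁻¹ γ
    have h2 : StrictMono (γ.mapDomain ((Tuple.sort γ)⁻¹ : Equiv.Perm (Fin l)) : Fin l →₀ ℕ) := by
      have he : (γ.mapDomain ((Tuple.sort γ)⁻¹ : Equiv.Perm (Fin l)) : Fin l →₀ ℕ) = ⇑γ ∘ Tuple.sort γ := by
        ext j
        rw [Finsupp.mapDomain_equiv_apply]; rfl
      rw [he]
      exact (Tuple.monotone_sort γ).strictMono_of_injective (hinj.comp (Tuple.sort γ).injective)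
    rw [h0 _ h2] at h1
    have h3 : ((Equiv.Perm.sign (Tuple.sort γ)⁻¹ : ℤ) : k) ≠ 0 := by
      rcases Int.units_eq_one_or (Equiv.Perm.sign (Tuple.sort γ)⁻¹) with h | h <;> rw [h] <;> simp
    exact (mul_eq_zero.1 h1.symm).resolve_left h3
  · unfold Function.Injective at hinj
    push Not at hinj
    obtain ⟨a, b, hab, hne⟩ := hinj
    have h1 := hQ (Equiv.swap a b) γ
    have he : γ.mapDomain (Equiv.swap a b) = γ := by
      ext j
      rw [Finsupp.mapDomain_equiv_apply, Equiv.symm_swap, Equiv.swap_apply_def]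
      split_ifs with h h' <;> simp_all
    rw [he, Equiv.Perm.sign_swap hne] at h1
    push_cast at h1
    have : (2 : k) * coeff γ Q = 0 := by linear_combination h1
    exact (mul_eq_zero.1 this).resolve_left two_ne_zero

/-- alternant -/
noncomputable def alternant (k : Type) [Field k] {l : ℕ} (c : Fin l → ℕ) : MvPolynomial (Fin l) k :=
  (Matrix.of fun i j : Fin l => (X j : MvPolynomial (Fin l) k) ^ c i).det

theorem coeff_alternant (c : Fin l → ℕ) (γ : Fin l →₀ ℕ) : coeff γ (alternant k c) =
    ∑ σ : Equiv.Perm (Fin l), if (∀ j, γ j = c (σ j)) then ((Equiv.Perm.sign σ : ℤ) : k) else 0 := by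
  rw [alternant, Matrix.det_apply', coeff_sum]
  refine Finset.sum_congr rfl fun σ _ => ?_
  simp only [Matrix.of_apply]
  rw [prodXpow (fun j => c (σ j))]
  have : ((Equiv.Perm.sign σ : ℤ) : MvPolynomial (Fin l) k) = C ((Equiv.Perm.sign σ : ℤ) : k) := by
    simp
  rw [this, coeff_C_mul, coeff_monomial]
  have e : (Finsupp.equivFunOnFinite.symm (fun j => c (σ j)) = γ) ↔ (∀ j, γ j = c (σ j)) := by
    rw [Finsupp.ext_iff]
    exact forall_congr' fun j => eq_comm
  simp only [e]
  split_ifs <;> simp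

theorem alt_alternant (c : Fin l → ℕ) : Alt (alternant k c) := by
  intro τ γ
  rw [coeff_alternant, coeff_alternant, Finset.mul_sum,
    ← Equiv.sum_comp (Equiv.mulRight τ⁻¹)]
  refine Finset.sum_congr rfl fun σ _ => ?_
  have e : (∀ j, (γ.mapDomain τ) j = c ((Equiv.mulRight τ⁻¹ σ) j)) ↔ ∀ j, γ j = c (σ j) := by
    simp only [Finsupp.mapDomain_equiv_apply]
    constructor
    · intro h j
      have := h (τ j)
      simpa using this
    · intro h j
      exact h _
  simp only [e]
  split_ifs
  · simp [mul_comm]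
  · simp

theorem coeff_alternant_mono {c : Fin l → ℕ} (hc : StrictMono c) {γ : Fin l →₀ ℕ} (hγ : StrictMono γ) :
    coeff γ (alternant k c) = if (γ : Fin l → ℕ) = c then 1 else 0 := by
  rw [coeff_alternant]
  have key : ∀ σ : Equiv.Perm (Fin l), (∀ j, γ j = c (σ j)) → σ = 1 := by
    intro σ h
    have hm : StrictMono σ := by
      intro a b hab
      have := hγ hab
      rw [h, h] at this
      exact hc.lt_iff_lt.1 this
    have := Subsingleton.elim (hm.orderIsoOfSurjective σ σ.surjective) (OrderIso.refl _)
    ext j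
    have := congrArg (fun f => ((f j : Fin l) : ℕ)) (congrArg DFunLike.coe this)
    simpa using this
  rw [Finset.sum_eq_single 1]
  · simp only [Equiv.Perm.coe_one, id, Equiv.Perm.sign_one, funext_iff]
    simp
  · intro σ _ hσ
    rw [if_neg fun h => hσ (key σ h)]
  · simp

theorem alt_expand [CharZero k] {Q : MvPolynomial (Fin l) k} (hQ : Alt Q) {ι : Type} (S : Finset ι)
    (c : ι → Fin l → ℕ) (hS : ∀ a ∈ S, StrictMono (c a)) (hinj : ∀ a ∈ S, ∀ b ∈ S, c a = c b → a = b)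
    (h1 : ∀ a ∈ S, ∀ γ : Fin l →₀ ℕ, ⇑γ = c a → coeff γ Q = 1)
    (h0 : ∀ γ : Fin l →₀ ℕ, StrictMono γ → coeff γ Q ≠ 0 → ∃ a ∈ S, ⇑γ = c a) :
    Q = ∑ a ∈ S, alternant k (c a) := by
  rw [← sub_eq_zero]
  apply alt_zero
  · intro σ γ
    rw [coeff_sub, coeff_sub, hQ σ γ, coeff_sum, coeff_sum, mul_sub, Finset.mul_sum]
    congr 1
    exact Finset.sum_congr rfl fun a _ => alt_alternant (c a) σ γ
  · intro γ hγ
    rw [coeff_sub, coeff_sum, Finset.sum_congr rfl fun a ha => coeff_alternant_mono (hS a ha) hγ]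
    by_cases hex : ∃ a ∈ S, ⇑γ = c a
    · obtain ⟨a, ha, hca⟩ := hex
      rw [h1 a ha γ hca, Finset.sum_eq_single a, if_pos hca, sub_self]
      · intro b hb hba
        rw [if_neg fun h => hba (hinj b hb a ha (h.symm.trans hca))]
      · exact fun h => absurd ha h
    · have : coeff γ Q = 0 := by
        by_contra hne
        exact hex (h0 γ hγ hne)
      rw [this, Finset.sum_eq_zero, sub_zero]
      intro a ha
      rw [if_neg fun h => hex ⟨a, ha, h⟩]

/-- geometric sum -/
noncomputable def gsum (k : Type) [Field k] (a b : ℕ) : Polynomial k :=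
  ∑ i ∈ Finset.Ico a b, Polynomial.X ^ i

theorem gsum_mul {a b : ℕ} (h : a ≤ b) :
    gsum k a b * (Polynomial.X - 1) = Polynomial.X ^ b - Polynomial.X ^ a :=
  geom_sum_Ico_mul _ h

theorem gsum_eval {a b : ℕ} (h : a ≤ b) : (gsum k a b).eval 1 = (b : k) - a := by
  simp [gsum, Polynomial.eval_finsetSum, Nat.cast_sub h]

theorem spec_alternant {c : Fin l → ℕ} (hc : StrictMono c) :
    aeval (fun j : Fin l => (Polynomial.X : Polynomial k) ^ (j : ℕ)) (alternant k c) =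
      (∏ p ∈ prs l, gsum k (c p.1) (c p.2)) * (Polynomial.X - 1) ^ (prs l).card := by
  rw [alternant, AlgHom.map_det]
  have : (aeval (fun j : Fin l => (Polynomial.X : Polynomial k) ^ (j : ℕ))).mapMatrix
      (Matrix.of fun i j : Fin l => (X j : MvPolynomial (Fin l) k) ^ c i) =
      Matrix.vandermonde (fun i => Polynomial.X ^ c i) := by
    ext1 i j
    simp [Matrix.vandermonde_apply, ← pow_mul, mul_comm]
  rw [this, Matrix.det_vandermonde, ← Finset.prod_const, ← Finset.prod_mul_distrib, Finset.prod_sigma']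
  refine Finset.prod_bij' (fun x _ => (x.1, x.2)) (fun x _ => ⟨x.1, x.2⟩) ?_ ?_ ?_ ?_ ?_
  · rintro ⟨a, b⟩ h; simpa [prs] using h
  · rintro ⟨a, b⟩ h; simpa [prs] using h
  · simp
  · simp
  · rintro ⟨a, b⟩ h
    simp only [Finset.mem_sigma, Finset.mem_univ, Finset.mem_Ioi, true_and] at h
    exact (gsum_mul (hc h).le).symm

theorem spec_Vand : Vand k l = alternant k (fun i : Fin l => (i : ℕ)) := by
  rw [Vand_eq_det, alternant, ← Matrix.det_transpose]
  rfl

theorem dim_formula {ι : Type} (S : Finset ι) (c : ι → Fin l → ℕ) (hS : ∀ a ∈ S, StrictMono (c a))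
    (ch : MvPolynomial (Fin l) k) (h : Vand k l * ch = ∑ a ∈ S, alternant k (c a)) :
    aeval (fun _ => (1 : k)) ch * ∏ p ∈ prs l, (((p.2 : ℕ) : k) - (p.1 : ℕ)) =
      ∑ a ∈ S, ∏ p ∈ prs l, ((c a p.2 : k) - c a p.1) := by
  have h1 := congrArg (aeval (fun j : Fin l => (Polynomial.X : Polynomial k) ^ (j : ℕ))) h
  rw [map_mul, spec_Vand, spec_alternant (fun a b h => h), map_sum,
    Finset.sum_congr rfl fun a ha => spec_alternant (hS a ha), ← Finset.sum_mul] at h1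
  have hX : ((Polynomial.X : Polynomial k) - 1) ^ (prs l).card ≠ 0 :=
    pow_ne_zero _ (Polynomial.X_sub_C_ne_zero 1)
  have h2 : (∏ p ∈ prs l, gsum k (p.1 : ℕ) (p.2 : ℕ)) *
      aeval (fun j : Fin l => (Polynomial.X : Polynomial k) ^ (j : ℕ)) ch =
      ∑ a ∈ S, ∏ p ∈ prs l, gsum k (c a p.1) (c a p.2) := by
    apply mul_right_cancel₀ hX
    rw [← h1]; ring
  have h3 := congrArg (Polynomial.eval 1) h2
  rw [Polynomial.eval_mul, Polynomial.eval_prod, Polynomial.eval_finsetSum] at h3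
  have e1 : Polynomial.eval 1 (aeval (fun j : Fin l => (Polynomial.X : Polynomial k) ^ (j : ℕ)) ch) =
      aeval (fun _ => (1 : k)) ch := by
    rw [← Polynomial.coe_aeval_eq_eval, ← AlgHom.comp_apply, comp_aeval]
    congr 2
    ext j
    simp
  rw [e1] at h3
  rw [mul_comm, Finset.prod_congr rfl fun p hp => (gsum_eval (k := k) (a := (p.1 : ℕ)) (b := (p.2 : ℕ))
    (by simp [prs] at hp; exact hp.le)).symm, h3]
  refine Finset.sum_congr rfl fun a ha => ?_
  rw [Polynomial.eval_prod]
  refine Finset.prod_congr rfl fun p hp => gsum_eval ?_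
  simp [prs] at hp
  exact (hS a ha hp).le

end EvalPart

section SymPart

/-- the beta-set of the symmetric diagram with arm set `A` -/
def EA (l : ℕ) (A : Finset ℕ) : Finset ℕ :=
  A.image (fun a => l + a) ∪ (Finset.range l \ A).image (fun a => l - 1 - a)

theorem EA_disj (l : ℕ) (A : Finset ℕ) :
    Disjoint (A.image (fun a => l + a)) ((Finset.range l \ A).image (fun a => l - 1 - a)) := by
  rw [Finset.disjoint_left]
  intro x hx hy
  simp only [Finset.mem_image, Finset.mem_sdiff, Finset.mem_range] at hx hy
  obtain ⟨a, _, rfl⟩ := hx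
  obtain ⟨b, hb, h⟩ := hy
  omega

theorem EA_inj2 (l : ℕ) (A : Finset ℕ) :
    Set.InjOn (fun a => l - 1 - a) (Finset.range l \ A : Finset ℕ) := by
  intro a ha b hb h
  simp only [Finset.coe_sdiff, Finset.coe_range, Set.mem_sdiff, Set.mem_Iio] at ha hb
  simp only at h
  omega

theorem EA_card {l : ℕ} {A : Finset ℕ} (hA : A ⊆ Finset.range l) : (EA l A).card = l := by
  rw [EA, Finset.card_union_of_disjoint (EA_disj l A), Finset.card_image_of_injective _
    (fun a b h => by simpa using h), Finset.card_image_of_injOn (EA_inj2 l A),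
    Finset.card_sdiff_of_subset hA, Finset.card_range]
  have := Finset.card_le_card hA
  rw [Finset.card_range] at this
  omega

theorem EA_sum {l : ℕ} {A : Finset ℕ} (hA : A ⊆ Finset.range l) :
    ∑ x ∈ EA l A, x = ∑ i : Fin l, (i : ℕ) + 2 * A.sum id + A.card := by
  rw [EA, Finset.sum_union (EA_disj l A), Finset.sum_image (fun a _ b _ h => by simpa using h),
    Finset.sum_image (EA_inj2 l A)]
  have h1 : ∑ i : Fin l, (i : ℕ) = ∑ a ∈ Finset.range l, (l - 1 - a) := by
    rw [Finset.sum_range_reflect (fun i => i) l, Fin.sum_univ_eq_sum_range (fun i => i) l]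
  have h2 := Finset.sum_sdiff (f := fun a => l - 1 - a) hA
  have h3 : ∑ a ∈ A, (l + a) = ∑ a ∈ A, (l - 1 - a) + 2 * A.sum id + A.card := by
    rw [Finset.mul_sum, Finset.card_eq_sum_ones, ← Finset.sum_add_distrib, ← Finset.sum_add_distrib]
    refine Finset.sum_congr rfl fun a ha => ?_
    have := Finset.mem_range.1 (hA ha)
    simp only [id]
    omega
  omega

/-- increasing enumeration of the beta-set -/
noncomputable def cA (l : ℕ) (A : Finset ℕ) : Fin l → ℕ :=
  if h : (EA l A).card = l then (EA l A).orderEmbOfFin h else fun _ => 0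

theorem cA_eq {l : ℕ} {A : Finset ℕ} (hA : A ⊆ Finset.range l) :
    cA l A = (EA l A).orderEmbOfFin (EA_card hA) := by
  rw [cA, dif_pos (EA_card hA)]

theorem cA_mono {l : ℕ} {A : Finset ℕ} (hA : A ⊆ Finset.range l) : StrictMono (cA l A) := by
  rw [cA_eq hA]; exact OrderEmbedding.strictMono _

theorem cA_mem {l : ℕ} {A : Finset ℕ} (hA : A ⊆ Finset.range l) (j : Fin l) : cA l A j ∈ EA l A := by
  rw [cA_eq hA]; exact Finset.orderEmbOfFin_mem _ _ _

theorem cA_image {l : ℕ} {A : Finset ℕ} (hA : A ⊆ Finset.range l) :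
    Finset.univ.image (cA l A) = EA l A := by
  rw [cA_eq hA]
  exact Finset.image_orderEmbOfFin_univ _ _

theorem cA_unique {l : ℕ} {A : Finset ℕ} (hA : A ⊆ Finset.range l) {f : Fin l → ℕ} (hf : StrictMono f)
    (hm : ∀ j, f j ∈ EA l A) : f = cA l A := by
  rw [cA_eq hA]
  exact Finset.orderEmbOfFin_unique _ hm hf

theorem cA_sum {l : ℕ} {A : Finset ℕ} (hA : A ⊆ Finset.range l) {M : Type*} [AddCommMonoid M] (g : ℕ → M) :
    ∑ j, g (cA l A j) = ∑ x ∈ EA l A, g x := by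
  rw [← cA_image hA, Finset.sum_image fun a _ b _ h => (cA_mono hA).injective h]

theorem mem_EA {l : ℕ} {A : Finset ℕ} (a : ℕ) : l + a ∈ EA l A ↔ a ∈ A := by
  simp only [EA, Finset.mem_union, Finset.mem_image, Finset.mem_sdiff, Finset.mem_range]
  constructor
  · rintro (⟨b, hb, h⟩ | ⟨b, hb, h⟩)
    · obtain rfl : b = a := by omega
      exact hb
    · omega
  · exact fun h => Or.inl ⟨a, h, rfl⟩

theorem mem_EA_lt {l : ℕ} {A : Finset ℕ} {g : ℕ} (hg : g < l) : g ∈ EA l A ↔ l - 1 - g ∉ A := by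
  simp only [EA, Finset.mem_union, Finset.mem_image, Finset.mem_sdiff, Finset.mem_range]
  constructor
  · rintro (⟨b, hb, h⟩ | ⟨b, hb, h⟩)
    · omega
    · obtain rfl : b = l - 1 - g := by omega
      exact hb.2
  · exact fun h => Or.inr ⟨l - 1 - g, ⟨by omega, h⟩, by omega⟩

theorem cA_inj {l : ℕ} {A B : Finset ℕ} (hA : A ⊆ Finset.range l) (hB : B ⊆ Finset.range l)
    (h : cA l A = cA l B) : A = B := by
  have : EA l A = EA l B := by rw [← cA_image hA, ← cA_image hB, h]
  ext a
  rw [← mem_EA (l := l), this, mem_EA]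

theorem cA_fold {l : ℕ} {A : Finset ℕ} (hA : A ⊆ Finset.range l) :
    ∃ σ : Equiv.Perm (Fin l), ∀ j, (σ j : ℕ) = fold l (cA l A j) := by
  have hlt : ∀ j, fold l (cA l A j) < l := by
    intro j
    have h := cA_mem hA j
    have := j.2
    unfold fold
    split_ifs with hl
    · obtain ⟨a, ha⟩ := Nat.exists_eq_add_of_le hl
      rw [ha, mem_EA] at h
      have := Finset.mem_range.1 (hA h)
      omega
    · omega
  have hinj : Function.Injective fun j : Fin l => (⟨fold l (cA l A j), hlt j⟩ : Fin l) := by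
    intro i j hij
    simp only [Fin.mk.injEq] at hij
    apply (cA_mono hA).injective
    have hi := cA_mem hA i
    have hj := cA_mem hA j
    have h2 := i.2
    generalize cA l A i = x at *
    generalize cA l A j = y at *
    unfold fold at hij
    split_ifs at hij with h1 h2 h2
    · omega
    · exfalso
      obtain ⟨a, rfl⟩ := Nat.exists_eq_add_of_le h1
      rw [mem_EA] at hi
      rw [mem_EA_lt (by omega)] at hj
      apply hj
      rw [← hij]
      convert hi using 1
      omega
    · exfalso
      obtain ⟨a, rfl⟩ := Nat.exists_eq_add_of_le h2
      rw [mem_EA] at hj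
      rw [mem_EA_lt (by omega)] at hi
      apply hi
      rw [hij]
      convert hj using 1
      omega
    · omega
  exact ⟨Equiv.ofBijective _ (Finite.injective_iff_bijective.1 hinj), fun j => rfl⟩

theorem cA_card {l : ℕ} {A : Finset ℕ} (hA : A ⊆ Finset.range l) :
    (Finset.univ.filter fun j => l ≤ cA l A j).card = A.card := by
  rw [Finset.card_filter, cA_sum hA (fun x => if l ≤ x then 1 else 0), ← Finset.card_filter]
  have : (EA l A).filter (fun x => l ≤ x) = A.image (fun a => l + a) := by
    ext x
    simp only [Finset.mem_filter, Finset.mem_image]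
    constructor
    · rintro ⟨h, hl⟩
      obtain ⟨a, rfl⟩ := Nat.exists_eq_add_of_le hl
      exact ⟨a, (mem_EA a).1 h, rfl⟩
    · rintro ⟨a, h, rfl⟩
      exact ⟨(mem_EA a).2 h, by omega⟩
  rw [this, Finset.card_image_of_injective _ (fun a b h => by simpa using h)]

theorem crit_of_fold {l n : ℕ} (γ : Fin l → ℕ) (σ : Equiv.Perm (Fin l))
    (hσ : ∀ j, (σ j : ℕ) = fold l (γ j)) (hn : ∑ j, γ j = n + ∑ i : Fin l, (i : ℕ)) : critN n γ := by
  have h1 : ∀ j, (fold l (γ j) : ℤ) ^ 2 + fold l (γ j) =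
      (γ j : ℤ) ^ 2 - (2 * l - 1) * γ j + l * (l - 1) := by
    intro j
    unfold fold
    split_ifs with h
    · rw [Nat.cast_sub h]; ring
    · have := j.2
      rw [Nat.cast_sub (by omega), Nat.cast_sub (by omega)]; push_cast; ring
  have h2 : ∑ i : Fin l, (((i : ℕ) : ℤ) ^ 2 + (i : ℕ)) =
      ∑ i : Fin l, (((i : ℕ) : ℤ) ^ 2 - (2 * l - 1) * (i : ℕ) + l * (l - 1)) := by
    rw [← Equiv.sum_comp Fin.revPerm]
    refine Finset.sum_congr rfl fun i _ => ?_
    rw [Fin.revPerm_apply, Fin.val_rev, Nat.cast_sub (by omega)]; push_cast; ring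
  have h3 : ∑ j, ((fold l (γ j) : ℤ) ^ 2 + fold l (γ j)) = ∑ i : Fin l, (((i : ℕ) : ℤ) ^ 2 + (i : ℕ)) := by
    rw [← Equiv.sum_comp σ (fun i : Fin l => ((i : ℕ) : ℤ) ^ 2 + (i : ℕ))]
    simp only [hσ]
  rw [h2] at h3
  simp only [h1, Finset.sum_add_distrib, Finset.sum_sub_distrib, ← Finset.mul_sum] at h3
  unfold critN
  zify at hn ⊢
  rw [hn] at h3
  linear_combination h3

theorem exists_A {l : ℕ} (γ : Fin l → ℕ) (hm : StrictMono γ) (σ : Equiv.Perm (Fin l))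
    (hσ : ∀ j, (σ j : ℕ) = fold l (γ j)) : ∃ A, A ⊆ Finset.range l ∧ γ = cA l A := by
  refine ⟨(Finset.univ.filter fun j => l ≤ γ j).image fun j => γ j - l, ?_⟩
  have hA : (Finset.univ.filter fun j => l ≤ γ j).image (fun j => γ j - l) ⊆ Finset.range l := by
    intro x hx
    simp only [Finset.mem_image, Finset.mem_filter, Finset.mem_univ, true_and] at hx
    obtain ⟨j, hj, rfl⟩ := hx
    have := hσ j
    rw [fold, if_pos hj] at this
    rw [Finset.mem_range, ← this]
    exact (σ j).2
  refine ⟨hA, cA_unique hA hm fun j => ?_⟩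
  by_cases hj : l ≤ γ j
  · obtain ⟨a, ha⟩ := Nat.exists_eq_add_of_le hj
    rw [ha, mem_EA]
    simp only [Finset.mem_image, Finset.mem_filter, Finset.mem_univ, true_and]
    exact ⟨j, hj, by omega⟩
  · rw [mem_EA_lt (by omega)]
    simp only [Finset.mem_image, Finset.mem_filter, Finset.mem_univ, true_and]
    rintro ⟨i, hi, h⟩
    have : σ i = σ j := by
      apply Fin.ext
      rw [hσ, hσ, fold, fold, if_pos hi, if_neg hj, h]
    have := σ.injective this
    subst this
    exact hj hi

end SymPart

section FinalDim
variable {k : Type} [Field k] [CharZero k] [IsAlgClosed k] {T : Type} [AddCommGroup T] [Module k T]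
  {l : ℕ} {E : Fin l → Fin l → Module.End k T} {M : Submodule k T}

theorem coeff_G {n p r : ℕ} (hn : n = 2 * p + r) (h : GlMod E n M)
    (hchi : chi E n M = esym k l p * hsym k l r) (γ : Fin l →₀ ℕ)
    (hne : coeff γ (Vand k l * chi E n (M ⊓ (casimir E).maxGenEigenspace (l * n : k))) ≠ 0) :
    (∃ σ : Equiv.Perm (Fin l), ∀ j, (σ j : ℕ) = fold l (γ j)) ∧
      (Finset.univ.filter fun j => l ≤ γ j).card = r ∧
      ∑ j, γ j = n + ∑ i : Fin l, (i : ℕ) := by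
  by_cases hc : critN n γ
  · rw [(h.coeff_eig γ).1 hc, hchi] at hne
    subst hn
    exact VEh_ne γ p r hc hne
  · exact absurd ((h.coeff_eig γ).2 hc) hne

theorem alt_G {n p r : ℕ} (h : GlMod E n M)
    (hchi : chi E n M = esym k l p * hsym k l r) :
    Alt (Vand k l * chi E n (M ⊓ (casimir E).maxGenEigenspace (l * n : k))) := by
  intro σ γ
  by_cases hc : critN n γ
  · rw [(h.coeff_eig γ).1 hc, (h.coeff_eig _).1 ((critN_perm σ γ).2 hc), hchi]
    exact alt_VEh p r σ γ
  · rw [(h.coeff_eig γ).2 hc, (h.coeff_eig _).2 (fun h2 => hc ((critN_perm σ γ).1 h2)), mul_zero]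

theorem dim_G {n p r : ℕ} (hn : n = 2 * p + r) (h : GlMod E n M)
    (hchi : chi E n M = esym k l p * hsym k l r) :
    (Module.finrank k (M ⊓ (casimir E).maxGenEigenspace (l * n : k) : Submodule k T) : k) *
      ∏ p ∈ prs l, (((p.2 : ℕ) : k) - (p.1 : ℕ)) =
    ∑ A ∈ (Finset.range l).powerset.filter (fun A => A.card = r ∧ A.sum id = p),
      ∏ p ∈ prs l, ((cA l A p.2 : k) - cA l A p.1) := by
  have hG := h.eig (l * n : k)
  have hsub : ∀ A ∈ (Finset.range l).powerset.filter (fun A => A.card = r ∧ A.sum id = p),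
      A ⊆ Finset.range l := fun A hA => by
    simp only [Finset.mem_filter, Finset.mem_powerset] at hA; exact hA.1
  rw [← dim_formula _ (cA l) (fun A hA => cA_mono (hsub A hA))
    (chi E n (M ⊓ (casimir E).maxGenEigenspace (l * n : k)))]
  · congr 1
    rw [hG.finrank_eq, chi, map_sum]
    push_cast
    refine Finset.sum_congr rfl fun α _ => ?_
    simp [aeval_monomial]
  · apply alt_expand (alt_G h hchi) _ _ (fun A hA => cA_mono (hsub A hA))
      (fun A hA B hB => cA_inj (hsub A hA) (hsub B hB))
    · intro A hA γ hγ
      have hA' := hsub A hA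
      simp only [Finset.mem_filter, Finset.mem_powerset] at hA
      obtain ⟨σ, hσ⟩ := cA_fold hA'
      have hs : ∑ j, γ j = n + ∑ i : Fin l, (i : ℕ) := by
        rw [hγ, cA_sum hA' (fun x => x), EA_sum hA', hA.2.1, hA.2.2]; omega
      have hr : (Finset.univ.filter fun j => l ≤ γ j).card = r := by
        rw [hγ, cA_card hA', hA.2.1]
      rw [← hγ] at hσ
      have hc : critN n γ := crit_of_fold γ σ hσ hs
      have hmono : StrictMono γ := by rw [hγ]; exact cA_mono hA'
      have h1 := VEh_val (k := k) γ p r σ hσ hr (by rw [hs, hn])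
      rw [← hchi, ← (h.coeff_eig γ).1 hc] at h1
      have hge : ∀ j : Fin l, (j : ℕ) ≤ γ j := by
        rintro ⟨j, hj⟩
        induction j with
        | zero => exact Nat.zero_le _
        | succ j ih =>
          have h2 := ih (by omega)
          have h3 : γ ⟨j, by omega⟩ < γ ⟨j + 1, hj⟩ := hmono (by simp [Fin.lt_def])
          simp only at h2 ⊢
          omega
      have hdec : γ = stair l + (γ - stair l) := by
        ext j
        have := hge j
        simp only [Finsupp.add_apply, Finsupp.tsub_apply, stair_apply]
        omega
      have h4 := hG.coeff_crit (casNil_eig _) (lam := γ - stair l) (by rw [← hdec]; exact hmono.monotone)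
        (by rw [← hdec]; exact hc)
      rw [← hdec] at h4
      rcases h1 with h1 | h1
      · exact h1
      · exfalso
        rw [h1] at h4
        have : ((wdim E (M ⊓ (casimir E).maxGenEigenspace (l * n : k)) (γ - stair l) + 1 : ℕ) : k) = 0 := by
          push_cast; rw [← h4]; ring
        exact Nat.cast_ne_zero.2 (Nat.succ_ne_zero _) this
    · intro γ hm hne
      obtain ⟨⟨σ, hσ⟩, hr, hs⟩ := coeff_G hn h hchi γ hne
      obtain ⟨A, hA, hγ⟩ := exists_A γ hm σ hσ
      refine ⟨A, ?_, hγ⟩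
      rw [hγ, cA_card hA] at hr
      rw [hγ, cA_sum hA (fun x => x), EA_sum hA] at hs
      simp only [Finset.mem_filter, Finset.mem_powerset]
      exact ⟨hA, hr, by omega⟩

/-- two homological degrees cannot share a weight -/
theorem no_common {n p r p' r' : ℕ} (hn : n = 2 * p + r) (hn' : n = 2 * p' + r') (hr : r ≠ r')
    {M' : Submodule k T} (h : GlMod E n M) (h' : GlMod E n M')
    (hchi : chi E n M = esym k l p * hsym k l r) (hchi' : chi E n M' = esym k l p' * hsym k l r')
    (N : Submodule k T) (hN : GlMod E n N) (hcas : CasNil E (l * n : k) N)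
    (hw : ∀ α, wdim E N α ≤ wdim E (M ⊓ (casimir E).maxGenEigenspace (l * n : k)) α)
    (hw' : ∀ α, wdim E N α ≤ wdim E (M' ⊓ (casimir E).maxGenEigenspace (l * n : k)) α) :
    N = ⊥ := by
  by_contra hne
  have hex : ∃ α, wdim E N α ≠ 0 := by
    by_contra hall
    push Not at hall
    have := hN.finrank_eq
    rw [Finset.sum_eq_zero fun α _ => hall α] at this
    have hf := hN.fin
    exact hne (Submodule.finrank_eq_zero.1 this)
  obtain ⟨α, hα⟩ := hex
  obtain ⟨lam, hl, -, hm, hcr⟩ := hN.exists_max hcas hα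
  have hmm : Monotone (stair l + lam : Fin l →₀ ℕ) := by
    intro a b hab
    have := hm hab
    have h2 : (a : ℕ) ≤ b := hab
    simp only [Finsupp.add_apply, stair_apply]
    omega
  have key : ∀ {p r : ℕ} {M : Submodule k T}, n = 2 * p + r → GlMod E n M →
      chi E n M = esym k l p * hsym k l r →
      (∀ α, wdim E N α ≤ wdim E (M ⊓ (casimir E).maxGenEigenspace (l * n : k)) α) →
      (Finset.univ.filter fun j => l ≤ (stair l + lam) j).card = r := by
    intro p r M hn h hchi hw
    refine (coeff_G hn h hchi (stair l + lam) ?_).2.1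
    rw [(h.eig _).coeff_crit (casNil_eig _) hmm hcr]
    have := hw lam
    exact Nat.cast_ne_zero.2 (by omega)
  exact hr ((key hn h hchi hw).symm.trans (key hn' h' hchi' hw'))

end FinalDim

section HookPart

/-- number of elements of `E` below `x` -/
def bw (E : Finset ℕ) (x : ℕ) : ℕ := ((Finset.range x).filter (· ∈ E)).card
/-- number of non-elements of `E` below `x` -/
def cw (E : Finset ℕ) (x : ℕ) : ℕ := ((Finset.range x).filter (· ∉ E)).card

theorem bw_add_cw (E : Finset ℕ) (x : ℕ) : bw E x + cw E x = x := by
  rw [bw, cw, Finset.card_filter_add_card_filter_not, Finset.card_range]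

theorem prod_count {M : Type*} [CommMonoid M] (P : ℕ → Prop) [DecidablePred P] (f : ℕ → M) (N : ℕ) :
    ∏ x ∈ (Finset.range N).filter P, f (((Finset.range x).filter P).card) =
      ∏ j ∈ Finset.range ((Finset.range N).filter P).card, f j := by
  induction N with
  | zero => simp
  | succ N ih =>
    rw [Finset.range_add_one, Finset.filter_insert]
    split_ifs with h
    · rw [Finset.prod_insert (by simp), Finset.card_insert_of_notMem (by simp), ih,
        Finset.prod_range_succ, mul_comm]
    · exact ih

/-- number of elements of `E` above `x` -/
def aw (E : Finset ℕ) (x : ℕ) : ℕ := (E.filter (x < ·)).card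

theorem bw_eq (E : Finset ℕ) (x : ℕ) : bw E x = (E.filter (· < x)).card := by
  rw [bw]; congr 1; ext y; simp [and_comm]

theorem aw_add_bw {E : Finset ℕ} {x : ℕ} (hx : x ∈ E) : aw E x + bw E x + 1 = E.card := by
  rw [aw, bw_eq]
  have h1 := Finset.card_filter_add_card_filter_not (s := E) (fun y => x < y)
  have h2 : E.filter (fun y => ¬ x < y) = insert x (E.filter (· < x)) := by
    ext y
    simp only [Finset.mem_filter, Finset.mem_insert, not_lt]
    constructor
    · rintro ⟨h, h'⟩
      rcases h'.lt_or_eq with h'' | rfl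
      · exact Or.inr ⟨h, h''⟩
      · exact Or.inl rfl
    · rintro (rfl | h)
      · exact ⟨hx, le_rfl⟩
      · exact ⟨h.1, h.2.le⟩
  rw [h2, Finset.card_insert_of_notMem (by simp)] at h1
  omega

theorem aw_lt {E : Finset ℕ} {x y : ℕ} (hx : y ∈ E) (h : x < y) : aw E y < aw E x := by
  apply Finset.card_lt_card
  rw [Finset.ssubset_iff_of_subset]
  · exact ⟨y, by simp [hx, h], by simp⟩
  · intro z hz
    simp only [Finset.mem_filter] at hz ⊢
    exact ⟨hz.1, h.trans hz.2⟩

theorem cw_lt {E : Finset ℕ} {x y : ℕ} (hx : x ∉ E) (h : x < y) : cw E x < cw E y := by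
  apply Finset.card_lt_card
  rw [Finset.ssubset_iff_of_subset]
  · exact ⟨x, by simp [hx, h], by simp⟩
  · intro z hz
    simp only [Finset.mem_filter, Finset.mem_range] at hz ⊢
    exact ⟨hz.1.trans h, hz.2⟩

theorem aw_lt_iff {E : Finset ℕ} {x y : ℕ} (hx : x ∈ E) (hy : y ∈ E) : aw E y < aw E x ↔ x < y := by
  constructor
  · intro h
    by_contra hle
    rcases (not_lt.1 hle).lt_or_eq with h' | rfl
    · have := aw_lt hx h'; omega
    · omega
  · exact aw_lt hy

theorem cw_le_iff {E : Finset ℕ} {x y : ℕ} (hx : x ∉ E) (hy : y ∉ E) : cw E x ≤ cw E y ↔ x ≤ y := by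
  constructor
  · intro h
    by_contra hle
    have := cw_lt hy (not_le.1 hle); omega
  · intro h
    rcases h.lt_or_eq with h' | rfl
    · exact (cw_lt hx h').le
    · rfl

theorem aw_inj {E : Finset ℕ} {x y : ℕ} (hx : x ∈ E) (hy : y ∈ E) (h : aw E x = aw E y) : x = y := by
  have h1 := aw_lt_iff hx hy
  have h2 := aw_lt_iff hy hx
  omega

theorem cw_inj {E : Finset ℕ} {x y : ℕ} (hx : x ∉ E) (hy : y ∉ E) (h : cw E x = cw E y) : x = y := by
  have h1 := cw_le_iff hx hy
  have h2 := cw_le_iff hy hx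
  omega

/-- gaps below `e` -/
def gap (E : Finset ℕ) (e : ℕ) : Finset ℕ := (Finset.range e).filter (· ∉ E)

theorem mem_gap {E : Finset ℕ} {e g : ℕ} : g ∈ gap E e ↔ g < e ∧ g ∉ E := by simp [gap]

/-- diagram from a beta-set -/
def dgm (E : Finset ℕ) : Finset (ℕ × ℕ) :=
  (E.sigma fun e => gap E e).image fun x => (aw E x.1, cw E x.2)

theorem dgm_inj (E : Finset ℕ) : Set.InjOn (fun x : (_ : ℕ) × ℕ => (aw E x.1, cw E x.2))
    (E.sigma fun e => gap E e : Finset ((_ : ℕ) × ℕ)) := by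
  rintro ⟨e, g⟩ h ⟨e', g'⟩ h' heq
  simp only [Finset.coe_sigma, Set.mem_sigma_iff, Finset.mem_coe, mem_gap] at h h'
  simp only [Prod.mk.injEq] at heq
  rw [aw_inj h.1 h'.1 heq.1, cw_inj h.2.2 h'.2.2 heq.2]

theorem dgm_prod {M : Type*} [CommMonoid M] (E : Finset ℕ) (f : ℕ × ℕ → M) :
    ∏ b ∈ dgm E, f b = ∏ e ∈ E, ∏ g ∈ gap E e, f (aw E e, cw E g) := by
  rw [dgm, Finset.prod_image (dgm_inj E), Finset.prod_sigma]

theorem mem_dgm {E : Finset ℕ} {b : ℕ × ℕ} : b ∈ dgm E ↔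
    ∃ e g, e ∈ E ∧ g ∉ E ∧ g < e ∧ b = (aw E e, cw E g) := by
  simp only [dgm, Finset.mem_image, Finset.mem_sigma, mem_gap]
  constructor
  · rintro ⟨⟨e, g⟩, h, rfl⟩; exact ⟨e, g, h.1, h.2.2, h.2.1, rfl⟩
  · rintro ⟨e, g, h1, h2, h3, rfl⟩; exact ⟨⟨e, g⟩, ⟨h1, h3, h2⟩, rfl⟩

theorem dgm_hook {E : Finset ℕ} {e g : ℕ} (he : e ∈ E) (hg : g ∈ gap E e) :
    ((dgm E).filter (fun x => x.1 = (aw E e, cw E g).1 ∧ (aw E e, cw E g).2 ≤ x.2)).card +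
      ((dgm E).filter (fun x => x.2 = (aw E e, cw E g).2 ∧ (aw E e, cw E g).1 < x.1)).card = e - g := by
  rw [mem_gap] at hg
  have h1 : (dgm E).filter (fun x => x.1 = aw E e ∧ cw E g ≤ x.2) =
      ((Finset.Ico g e).filter (· ∉ E)).image (fun y => (aw E e, cw E y)) := by
    ext x
    simp only [Finset.mem_filter, mem_dgm, Finset.mem_image, Finset.mem_Ico]
    constructor
    · rintro ⟨⟨e', g', h1, h2, h3, rfl⟩, h4, h5⟩
      have h6 := aw_inj h1 he h4
      subst h6
      exact ⟨g', ⟨⟨(cw_le_iff hg.2 h2).1 h5, h3⟩, h2⟩, rfl⟩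
    · rintro ⟨y, ⟨⟨h1, h2⟩, h3⟩, rfl⟩
      exact ⟨⟨e, y, he, h3, h2, rfl⟩, rfl, (cw_le_iff hg.2 h3).2 h1⟩
  have h2 : (dgm E).filter (fun x => x.2 = cw E g ∧ aw E e < x.1) =
      ((Finset.Ico g e).filter (· ∈ E)).image (fun y => (aw E y, cw E g)) := by
    ext x
    simp only [Finset.mem_filter, mem_dgm, Finset.mem_image, Finset.mem_Ico]
    constructor
    · rintro ⟨⟨e', g', k1, k2, k3, rfl⟩, k4, k5⟩
      have h6 := cw_inj k2 hg.2 k4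
      subst h6
      exact ⟨e', ⟨⟨k3.le, (aw_lt_iff k1 he).1 k5⟩, k1⟩, rfl⟩
    · rintro ⟨y, ⟨⟨h1, h2⟩, h3⟩, rfl⟩
      have hne : g ≠ y := fun h => hg.2 (h ▸ h3)
      exact ⟨⟨y, g, h3, hg.2, by omega, rfl⟩, rfl, (aw_lt_iff h3 he).2 h2⟩
  simp only
  rw [h1, h2, Finset.card_image_of_injOn, Finset.card_image_of_injOn, add_comm,
    Finset.card_filter_add_card_filter_not, Nat.card_Ico]
  · intro a ha b hb hab
    simp only [Finset.coe_filter, Set.mem_ofPred_eq] at ha hb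
    simp only [Prod.mk.injEq] at hab
    exact aw_inj ha.2 hb.2 hab.1
  · intro a ha b hb hab
    simp only [Finset.coe_filter, Set.mem_ofPred_eq] at ha hb
    simp only [Prod.mk.injEq] at hab
    exact cw_inj ha.2 hb.2 hab.2

theorem prod_range_sub (e : ℕ) : ∏ x ∈ Finset.range e, (e - x) = e.factorial := by
  rw [← Finset.prod_range_add_one_eq_factorial, ← Finset.prod_range_reflect]
  refine Finset.prod_congr rfl fun x hx => ?_
  have := Finset.mem_range.1 hx
  omega

theorem dgm_hooks (E : Finset ℕ) :
    (∏ b ∈ dgm E, (((dgm E).filter (fun x => x.1 = b.1 ∧ b.2 ≤ x.2)).card +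
      ((dgm E).filter (fun x => x.2 = b.2 ∧ b.1 < x.1)).card)) *
      ∏ e ∈ E, ∏ x ∈ E.filter (· < e), (e - x) = ∏ e ∈ E, e.factorial := by
  rw [dgm_prod, ← Finset.prod_mul_distrib]
  refine Finset.prod_congr rfl fun e he => ?_
  rw [Finset.prod_congr rfl fun g hg => dgm_hook he hg, ← prod_range_sub,
    ← Finset.prod_filter_mul_prod_filter_not (Finset.range e) (· ∉ E)]
  congr 1
  refine Finset.prod_congr ?_ fun _ _ => rfl
  ext y; simp [and_comm]

theorem exists_range (E : Finset ℕ) : ∃ N, (Finset.range N).filter (· ∈ E) = E := by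
  refine ⟨E.sup id + 1, ?_⟩
  ext x
  simp only [Finset.mem_filter, Finset.mem_range]
  refine ⟨fun h => h.2, fun h => ⟨?_, h⟩⟩
  have := Finset.le_sup (f := id) h
  simp only [id] at this
  omega

theorem prod_bw {M : Type*} [CommMonoid M] (E : Finset ℕ) (f : ℕ → M) :
    ∏ e ∈ E, f (bw E e) = ∏ j ∈ Finset.range E.card, f j := by
  obtain ⟨N, hN⟩ := exists_range E
  have := prod_count (· ∈ E) f N
  rw [hN] at this
  exact this

theorem dgm_content (E : Finset ℕ) :
    (∏ b ∈ dgm E, (E.card + b.2 - b.1)) * ∏ j ∈ Finset.range E.card, j.factorial =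
      ∏ e ∈ E, e.factorial := by
  rw [dgm_prod, ← prod_bw, ← Finset.prod_mul_distrib]
  refine Finset.prod_congr rfl fun e he => ?_
  have h1 := aw_add_bw he
  have h2 : ∀ g ∈ gap E e, E.card + cw E g - aw E e = (bw E e + 1) + cw E g := by
    intro g _; omega
  simp only
  rw [Finset.prod_congr rfl h2]
  have := prod_count (· ∉ E) (fun j => bw E e + 1 + j) e
  change ∏ g ∈ gap E e, (bw E e + 1 + cw E g) = ∏ j ∈ Finset.range (cw E e), (bw E e + 1 + j) at this
  rw [this, ← Nat.ascFactorial_eq_prod_range, mul_comm, Nat.factorial_mul_ascFactorial, bw_add_cw]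

theorem dgm_card (E : Finset ℕ) : (dgm E).card + ∑ j ∈ Finset.range E.card, j = ∑ e ∈ E, e := by
  have h := prod_bw (M := Multiplicative ℕ) E (fun j => Multiplicative.ofAdd j)
  have h' : ∑ e ∈ E, bw E e = ∑ j ∈ Finset.range E.card, j := h
  rw [dgm, Finset.card_image_of_injOn (dgm_inj E), Finset.card_sigma, ← h', ← Finset.sum_add_distrib]
  refine Finset.sum_congr rfl fun e _ => ?_
  have := bw_add_cw E e
  rw [add_comm]
  exact this


/-- rank of `a` in `A` from the top -/
theorem aw_hi {l : ℕ} {A : Finset ℕ} (a : ℕ) : aw (EA l A) (l + a) = aw A a := by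
  have : (EA l A).filter (l + a < ·) = (A.filter (a < ·)).image (fun x => l + x) := by
    ext x
    simp only [Finset.mem_filter, Finset.mem_image]
    constructor
    · rintro ⟨h, hx⟩
      obtain ⟨b, rfl⟩ := Nat.exists_eq_add_of_le (show l ≤ x by omega)
      exact ⟨b, ⟨(mem_EA b).1 h, by omega⟩, rfl⟩
    · rintro ⟨b, ⟨h, hb⟩, rfl⟩
      exact ⟨(mem_EA b).2 h, by omega⟩
  rw [aw, this, Finset.card_image_of_injective _ (fun a b h => by simpa using h), aw]

theorem gapA_card {A : Finset ℕ} {b : ℕ} (hb : b ∉ A) : A.card + (gap A b).card = b + aw A b := by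
  have h1 := bw_add_cw A b
  have h2 := Finset.card_filter_add_card_filter_not (s := A) (fun y => b < y)
  have h3 : A.filter (fun y => ¬ b < y) = A.filter (· < b) := by
    ext y
    simp only [Finset.mem_filter, not_lt]
    refine ⟨fun h => ⟨h.1, lt_of_le_of_ne h.2 fun h' => hb (h' ▸ h.1)⟩, fun h => ⟨h.1, h.2.le⟩⟩
  rw [h3, ← bw_eq] at h2
  change A.card + cw A b = b + (A.filter (fun y => b < y)).card
  omega

theorem inj_refl {l : ℕ} {S : Finset ℕ} (hS : ∀ x ∈ S, x < l) :
    Set.InjOn (fun a => l - 1 - a) (S : Set ℕ) := by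
  intro a ha b hb h
  have := hS a ha
  have := hS b hb
  simp only at h
  omega

theorem aw_lo {l : ℕ} {A : Finset ℕ} {b : ℕ} (hbl : b < l) (hb : b ∉ A) :
    aw (EA l A) (l - 1 - b) = b + aw A b := by
  have : (EA l A).filter (l - 1 - b < ·) = A.image (fun x => l + x) ∪
      (gap A b).image (fun x => l - 1 - x) := by
    ext x
    simp only [Finset.mem_filter, Finset.mem_image, Finset.mem_union, mem_gap]
    constructor
    · rintro ⟨h, hx⟩
      by_cases hl : l ≤ x
      · obtain ⟨b, rfl⟩ := Nat.exists_eq_add_of_le hl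
        exact Or.inl ⟨b, (mem_EA b).1 h, rfl⟩
      · exact Or.inr ⟨l - 1 - x, ⟨by omega, (mem_EA_lt (by omega)).1 h⟩, by omega⟩
    · rintro (⟨b, h, rfl⟩ | ⟨y, h, rfl⟩)
      · exact ⟨(mem_EA b).2 h, by omega⟩
      · refine ⟨(mem_EA_lt (by omega)).2 ?_, by omega⟩
        rw [show l - 1 - (l - 1 - y) = y by omega]
        exact h.2
  rw [aw, this, Finset.card_union_of_disjoint, Finset.card_image_of_injective _
    (fun a b h => by simpa using h), Finset.card_image_of_injOn, gapA_card hb]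
  · exact inj_refl fun x hx => by rw [mem_gap] at hx; omega
  · rw [Finset.disjoint_left]
    intro x hx hy
    simp only [Finset.mem_image, mem_gap] at hx hy
    obtain ⟨a, _, rfl⟩ := hx
    obtain ⟨b, hb, h⟩ := hy
    omega

theorem cw_lo {l : ℕ} {A : Finset ℕ} (hA : A ⊆ Finset.range l) {a : ℕ} (ha : a < l) :
    cw (EA l A) (l - 1 - a) = aw A a := by
  have : (Finset.range (l - 1 - a)).filter (· ∉ EA l A) =
      (A.filter (a < ·)).image (fun x => l - 1 - x) := by
    ext x
    simp only [Finset.mem_filter, Finset.mem_image, Finset.mem_range]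
    constructor
    · rintro ⟨hx, h⟩
      rw [mem_EA_lt (by omega), not_not] at h
      exact ⟨l - 1 - x, ⟨h, by omega⟩, by omega⟩
    · rintro ⟨y, ⟨h, hy⟩, rfl⟩
      have := Finset.mem_range.1 (hA h)
      refine ⟨by omega, ?_⟩
      rw [mem_EA_lt (by omega), not_not, show l - 1 - (l - 1 - y) = y by omega]
      exact h
  rw [cw, this, Finset.card_image_of_injOn, aw]
  exact inj_refl fun x hx => Finset.mem_range.1 (hA (Finset.mem_filter.1 hx).1)

theorem cw_hi {l : ℕ} {A : Finset ℕ} (hA : A ⊆ Finset.range l) {b : ℕ} (hb : b ∉ A) :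
    cw (EA l A) (l + b) = b + aw A b := by
  have : (Finset.range (l + b)).filter (· ∉ EA l A) = A.image (fun x => l - 1 - x) ∪
      (gap A b).image (fun x => l + x) := by
    ext x
    simp only [Finset.mem_filter, Finset.mem_image, Finset.mem_union, mem_gap, Finset.mem_range]
    constructor
    · rintro ⟨hx, h⟩
      by_cases hl : l ≤ x
      · obtain ⟨c, rfl⟩ := Nat.exists_eq_add_of_le hl
        exact Or.inr ⟨c, ⟨by omega, fun h' => h ((mem_EA c).2 h')⟩, rfl⟩
      · rw [mem_EA_lt (by omega), not_not] at h
        exact Or.inl ⟨l - 1 - x, h, by omega⟩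
    · rintro (⟨y, h, rfl⟩ | ⟨y, h, rfl⟩)
      · have := Finset.mem_range.1 (hA h)
        refine ⟨by omega, ?_⟩
        rw [mem_EA_lt (by omega), not_not, show l - 1 - (l - 1 - y) = y by omega]
        exact h
      · exact ⟨by omega, fun h' => h.2 ((mem_EA y).1 h')⟩
  rw [cw, this, Finset.card_union_of_disjoint, Finset.card_image_of_injOn,
    Finset.card_image_of_injective _ (fun a b h => by simpa using h), gapA_card hb]
  · exact inj_refl fun x hx => Finset.mem_range.1 (hA hx)
  · rw [Finset.disjoint_left]
    intro x hx hy
    simp only [Finset.mem_image, mem_gap] at hx hy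
    obtain ⟨a, ha, rfl⟩ := hx
    obtain ⟨b, hb, h⟩ := hy
    have := Finset.mem_range.1 (hA ha)
    omega

theorem aw_diff {A : Finset ℕ} {a b : ℕ} (h : b ≤ a) : aw A b ≤ aw A a + (a - b) := by
  have h1 : A.filter (b < ·) ⊆ A.filter (a < ·) ∪ Finset.Ioc b a := by
    intro x hx
    simp only [Finset.mem_filter, Finset.mem_union, Finset.mem_Ioc] at hx ⊢
    by_cases hxa : a < x
    · exact Or.inl ⟨hx.1, hxa⟩
    · exact Or.inr ⟨hx.2, not_lt.1 hxa⟩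
  have h2 := Finset.card_le_card h1
  have h3 := Finset.card_union_le (A.filter (a < ·)) (Finset.Ioc b a)
  rw [Nat.card_Ioc] at h3
  exact h2.trans h3

theorem mem_symDiagram {A : Finset ℕ} {i j : ℕ} : (i, j) ∈ symDiagram A ↔
    ∃ a ∈ A, (i = aw A a ∧ aw A a ≤ j ∧ j ≤ aw A a + a) ∨
      (j = aw A a ∧ aw A a + 1 ≤ i ∧ i ≤ aw A a + a) := by
  simp only [symDiagram, Finset.mem_biUnion, Finset.mem_union, Finset.mem_product,
    Finset.mem_singleton, Finset.mem_Icc, aw]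
  refine exists_congr fun a => and_congr_right fun _ => or_congr Iff.rfl ?_
  rw [and_comm]

theorem dgm_sub {l : ℕ} {A : Finset ℕ} (hA : A ⊆ Finset.range l) : dgm (EA l A) ⊆ symDiagram A := by
  intro b hb
  obtain ⟨e, g, he, hg, hlt, rfl⟩ := mem_dgm.1 hb
  rw [mem_symDiagram]
  by_cases hel : l ≤ e
  · obtain ⟨a, rfl⟩ := Nat.exists_eq_add_of_le hel
    have ha := (mem_EA a).1 he
    rw [aw_hi]
    by_cases hgl : l ≤ g
    · obtain ⟨c, rfl⟩ := Nat.exists_eq_add_of_le hgl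
      have hc : c ∉ A := fun h => hg ((mem_EA c).2 h)
      rw [cw_hi hA hc]
      have h1 : aw A a < aw A c := aw_lt ha (by omega)
      have h2 := aw_diff (A := A) (show c ≤ a by omega)
      exact ⟨a, ha, Or.inl ⟨rfl, by omega, by omega⟩⟩
    · have hc := hg
      rw [mem_EA_lt (by omega), not_not] at hc
      obtain ⟨c, rfl⟩ : ∃ c, g = l - 1 - c := ⟨l - 1 - g, by omega⟩
      by_cases hcl : c < l
      · rw [show l - 1 - (l - 1 - c) = c by omega] at hc
        rw [cw_lo hA hcl]
        rcases le_or_gt c a with h | h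
        · have h2 := aw_diff (A := A) h
          have h3 : aw A a ≤ aw A c := by
            rcases h.lt_or_eq with h' | rfl
            · exact (aw_lt ha h').le
            · rfl
          exact ⟨a, ha, Or.inl ⟨rfl, h3, by omega⟩⟩
        · have h2 := aw_diff (A := A) h.le
          have h3 := aw_lt hc h
          exact ⟨c, hc, Or.inr ⟨rfl, by omega, by omega⟩⟩
      · have hz := Finset.mem_range.1 (hA ha)
        rw [show l - 1 - c = l - 1 - (l - 1) by omega] at hc ⊢
        rw [show l - 1 - (l - 1 - (l - 1)) = l - 1 by omega] at hc
        rw [cw_lo hA (by omega)]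
        have h : l - 1 ≥ a := by omega
        rcases h.lt_or_eq with h | h
        · have h2 := aw_diff (A := A) h.le
          have h3 := aw_lt hc h
          exact ⟨l - 1, hc, Or.inr ⟨rfl, by omega, by omega⟩⟩
        · rw [← h]
          exact ⟨a, ha, Or.inl ⟨rfl, by omega, by omega⟩⟩
  · have hb' := he
    rw [mem_EA_lt (by omega)] at hb'
    have hc := hg
    rw [mem_EA_lt (by omega), not_not] at hc
    obtain ⟨x, hx, rfl⟩ : ∃ x, x < l ∧ e = l - 1 - x := ⟨l - 1 - e, by omega, by omega⟩
    obtain ⟨y, hy, rfl⟩ : ∃ y, y < l ∧ g = l - 1 - y := ⟨l - 1 - g, by omega, by omega⟩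
    rw [show l - 1 - (l - 1 - x) = x by omega] at hb'
    rw [show l - 1 - (l - 1 - y) = y by omega] at hc
    rw [aw_lo hx hb', cw_lo hA hy]
    have h1 : aw A y < aw A x := aw_lt hc (by omega)
    have h2 := aw_diff (A := A) (show x ≤ y by omega)
    exact ⟨y, hc, Or.inr ⟨rfl, by omega, by omega⟩⟩

theorem sym_card_le (A : Finset ℕ) : (symDiagram A).card ≤ 2 * A.sum id + A.card := by
  refine Finset.card_biUnion_le.trans ?_
  rw [Finset.mul_sum, Finset.card_eq_sum_ones, ← Finset.sum_add_distrib]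
  refine Finset.sum_le_sum fun a _ => (Finset.card_union_le _ _).trans ?_
  rw [Finset.card_product, Finset.card_product, Finset.card_singleton, Nat.card_Icc, Nat.card_Icc]
  simp only [id]
  omega

theorem dgm_eq {l : ℕ} {A : Finset ℕ} (hA : A ⊆ Finset.range l) : dgm (EA l A) = symDiagram A := by
  apply Finset.eq_of_subset_of_card_le (dgm_sub hA)
  have h1 := dgm_card (EA l A)
  rw [EA_card hA, EA_sum hA, Fin.sum_univ_eq_sum_range (fun i => i) l] at h1
  have := sym_card_le A
  omega

theorem prod_prs_nat {l : ℕ} (c : Fin l → ℕ) (hc : StrictMono c) :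
    ∏ p ∈ prs l, ((c p.2 : ℤ) - c p.1) =
      ((∏ e ∈ Finset.univ.image c, ∏ x ∈ (Finset.univ.image c).filter (· < e), (e - x) : ℕ) : ℤ) := by
  rw [Finset.prod_image fun a _ b _ h => hc.injective h]
  have h1 : ∀ j, (Finset.univ.image c).filter (· < c j) = (Finset.univ.filter (· < j)).image c := by
    intro j
    ext x
    simp only [Finset.mem_filter, Finset.mem_image, Finset.mem_univ, true_and]
    constructor
    · rintro ⟨⟨i, rfl⟩, h⟩; exact ⟨i, hc.lt_iff_lt.1 h, rfl⟩
    · rintro ⟨i, h, rfl⟩; exact ⟨⟨i, rfl⟩, hc h⟩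
  rw [prs, Finset.prod_filter, ← Finset.univ_product_univ, Finset.prod_product_right]
  push_cast
  refine Finset.prod_congr rfl fun j _ => ?_
  rw [h1, Finset.prod_image fun a _ b _ h => hc.injective h, Finset.prod_filter]
  refine Finset.prod_congr rfl fun i _ => ?_
  split_ifs with h
  · rw [Nat.cast_sub (hc h).le]
  · rfl

theorem prod_prs_id (l : ℕ) : ∏ p ∈ prs l, (((p.2 : ℕ) : ℤ) - (p.1 : ℕ)) =
    ((∏ j ∈ Finset.range l, j.factorial : ℕ) : ℤ) := by
  rw [prod_prs_nat (fun i : Fin l => (i : ℕ)) (fun a b h => h)]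
  have : Finset.univ.image (fun i : Fin l => (i : ℕ)) = Finset.range l := by
    ext x
    simp only [Finset.mem_image, Finset.mem_univ, true_and, Finset.mem_range]
    exact ⟨fun ⟨i, h⟩ => h ▸ i.2, fun h => ⟨⟨x, h⟩, rfl⟩⟩
  rw [this]
  congr 1
  refine Finset.prod_congr rfl fun e he => ?_
  rw [← prod_range_sub]
  refine Finset.prod_congr ?_ fun _ _ => rfl
  ext x
  have := Finset.mem_range.1 he
  simp only [Finset.mem_filter, Finset.mem_range]
  omega

theorem sf_dvd (l : ℕ) (c : Fin l → ℕ) : ((∏ j ∈ Finset.range l, j.factorial : ℕ) : ℤ) ∣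
    ∏ p ∈ prs l, ((c p.2 : ℤ) - c p.1) := by
  cases l with
  | zero => simp
  | succ n =>
    rw [Nat.prod_range_succ_factorial]
    have := Matrix.superFactorial_dvd_vandermonde_det (fun i : Fin (n + 1) => (c i : ℤ))
    rw [Matrix.det_vandermonde, Finset.prod_sigma'] at this
    convert this using 1
    refine Finset.prod_bij' (fun x _ => ⟨x.1, x.2⟩) (fun x _ => (x.1, x.2)) ?_ ?_ ?_ ?_ ?_
    · rintro ⟨a, b⟩ h; simpa [prs] using h
    · rintro ⟨a, b⟩ h; simpa [prs] using h
    · simp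
    · simp
    · simp

theorem dimSchur_eq {l : ℕ} {A : Finset ℕ} (hA : A ⊆ Finset.range l) :
    (dimSchur l (symDiagram A) : ℤ) * ∏ p ∈ prs l, (((p.2 : ℕ) : ℤ) - (p.1 : ℕ)) =
      ∏ p ∈ prs l, ((cA l A p.2 : ℤ) - cA l A p.1) := by
  obtain ⟨Q, hQ⟩ := sf_dvd l (cA l A)
  have h1 := dgm_content (EA l A)
  rw [← dgm_hooks (EA l A), EA_card hA, dgm_eq hA] at h1
  have h2 := prod_prs_nat (cA l A) (cA_mono hA)
  rw [cA_image hA] at h2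
  have hsf : 0 < ∏ j ∈ Finset.range l, j.factorial :=
    Finset.prod_pos fun j _ => Nat.factorial_pos j
  have hpos : 0 < (∏ b ∈ symDiagram A, (((symDiagram A).filter (fun x => x.1 = b.1 ∧ b.2 ≤ x.2)).card +
      ((symDiagram A).filter (fun x => x.2 = b.2 ∧ b.1 < x.1)).card)) := by
    refine Finset.prod_pos fun b hb => ?_
    have : 0 < ((symDiagram A).filter (fun x => x.1 = b.1 ∧ b.2 ≤ x.2)).card :=
      Finset.card_pos.2 ⟨b, by simp [hb]⟩
    omega
  have hQ0 : 0 ≤ Q := by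
    have h3 : 0 ≤ ((∏ j ∈ Finset.range l, j.factorial : ℕ) : ℤ) * Q := by
      rw [← hQ, h2]; positivity
    exact nonneg_of_mul_nonneg_right h3 (by exact_mod_cast hsf)
  lift Q to ℕ using hQ0
  rw [hQ] at h2
  rw [prod_prs_id, hQ, mul_comm]
  congr 1
  have h4 : (∏ j ∈ Finset.range l, j.factorial) * Q =
    ∏ e ∈ EA l A, ∏ x ∈ (EA l A).filter (· < e), (e - x) := by exact_mod_cast h2
  rw [← h4] at h1
  have h5 : (∏ b ∈ symDiagram A, (l + b.2 - b.1)) =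
      (∏ b ∈ symDiagram A, (((symDiagram A).filter (fun x => x.1 = b.1 ∧ b.2 ≤ x.2)).card +
      ((symDiagram A).filter (fun x => x.2 = b.2 ∧ b.1 < x.1)).card)) * Q := by
    apply Nat.eq_of_mul_eq_mul_right hsf
    rw [h1]; ring
  rw [dimSchur, h5, Nat.mul_div_cancel_left _ hpos]

end HookPart

section BettiG
variable {k : Type} [Field k] [CharZero k] [IsAlgClosed k] {T : Type} [AddCommGroup T] [Module k T]
  {l : ℕ} {E : Fin l → Fin l → Module.End k T} {M : Submodule k T}

theorem finrank_G {n p q : ℕ} (hn : n = 2 * p + 2 * q) (h : GlMod E n M)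
    (hchi : chi E n M = esym k l p * hsym k l (2 * q)) :
    Module.finrank k (M ⊓ (casimir E).maxGenEigenspace (l * n : k) : Submodule k T) =
      veroneseBetti l p q := by
  have h1 := dim_G hn h hchi
  have hV : ∏ p ∈ prs l, (((p.2 : ℕ) : k) - (p.1 : ℕ)) ≠ 0 := by
    refine Finset.prod_ne_zero_iff.2 fun x hx => ?_
    simp only [prs, Finset.mem_filter, Finset.mem_univ, true_and] at hx
    rw [sub_ne_zero]
    have : (x.1 : ℕ) < x.2 := hx
    exact fun h => by
      have := Nat.cast_injective h
      omega
  have h2 : ∑ A ∈ (Finset.range l).powerset.filter (fun A => A.card = 2 * q ∧ A.sum id = p),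
      ∏ p ∈ prs l, ((cA l A p.2 : k) - cA l A p.1) =
      (veroneseBetti l p q : k) * ∏ p ∈ prs l, (((p.2 : ℕ) : k) - (p.1 : ℕ)) := by
    rw [veroneseBetti, Nat.cast_sum, Finset.sum_mul]
    refine Finset.sum_congr rfl fun A hA => ?_
    simp only [Finset.mem_filter, Finset.mem_powerset] at hA
    have := congrArg (Int.cast (R := k)) (dimSchur_eq hA.1)
    push_cast at this
    exact this.symm
  rw [h2] at h1
  exact_mod_cast mul_right_cancel₀ hV h1

end BettiG

section AbsAlg
variable {R : Type} [Ring R] {l m : ℕ}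

/-- Kronecker symbol -/
def dl (R : Type) [Ring R] {ι : Type} [DecidableEq ι] (i j : ι) : R := if i = j then 1 else 0

section
variable {ι : Type} [DecidableEq ι]
theorem dl_comm (i j : ι) (x : R) : dl R i j * x = x * dl R i j := by
  unfold dl; split_ifs <;> simp
theorem dl_symm (i j : ι) : dl R i j = dl R j i := by
  unfold dl; simp only [eq_comm]
theorem sum_dl [Fintype ι] (i : ι) (f : ι → R) : ∑ j, dl R i j * f j = f i := by
  simp [dl]
theorem sum_dl' [Fintype ι] (i : ι) (f : ι → R) : ∑ j, dl R j i * f j = f i := by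
  simp [dl]
theorem sum_dlr [Fintype ι] (i : ι) (f : ι → R) : ∑ j, f j * dl R i j = f i := by
  simp [dl]
theorem sum_dlr' [Fintype ι] (i : ι) (f : ι → R) : ∑ j, f j * dl R j i = f i := by
  simp [dl]
theorem dl_dl (i j i' j' : ι) (x : R) : x * (dl R i j * dl R i' j') = dl R i j * (dl R i' j' * x) := by
  rw [← mul_assoc, ← dl_comm i j x, mul_assoc, ← dl_comm i' j' x]
theorem dl_self (i : ι) : dl R i i = 1 := by simp [dl]
end

/-- canonical (anti)commutation relations -/
structure CC (e f : Fin l → Fin l → R) (X P : Fin l → R) (et ps Y Q : Fin m → R) : Prop where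
  es : ∀ i j, e i j = e j i
  fs : ∀ i j, f i j = f j i
  ee : ∀ i j a b, e i j * e a b = -(e a b * e i j)
  ff : ∀ i j a b, f i j * f a b = -(f a b * f i j)
  fe : ∀ i j a b, f i j * e a b = dl R i a * dl R j b + dl R i b * dl R j a - e a b * f i j
  XX : ∀ i j, X i * X j = X j * X i
  PP : ∀ i j, P i * P j = P j * P i
  PX : ∀ i j, P i * X j = X j * P i + dl R i j
  Xe : ∀ i a b, X i * e a b = e a b * X i
  Xf : ∀ i a b, X i * f a b = f a b * X i
  Pe : ∀ i a b, P i * e a b = e a b * P i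
  Pf : ∀ i a b, P i * f a b = f a b * P i
  pp : ∀ a b, ps a * ps b = -(ps b * ps a)
  pn : ∀ a b, ps a * et b = dl R a b - et b * ps a
  YY : ∀ a b, Y a * Y b = Y b * Y a
  QY : ∀ a b, Q a * Y b = Y b * Q a + dl R a b
  Yp : ∀ a b, Y a * ps b = ps b * Y a
  Yn : ∀ a b, Y a * et b = et b * Y a
  Qp : ∀ a b, Q a * ps b = ps b * Q a
  Qn : ∀ a b, Q a * et b = et b * Q a
  XY : ∀ i a, X i * Y a = Y a * X i
  XQ : ∀ i a, X i * Q a = Q a * X i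
  Xn : ∀ i a, X i * et a = et a * X i
  Xp : ∀ i a, X i * ps a = ps a * X i
  PY : ∀ i a, P i * Y a = Y a * P i
  PQ : ∀ i a, P i * Q a = Q a * P i
  Pn : ∀ i a, P i * et a = et a * P i
  Pp : ∀ i a, P i * ps a = ps a * P i
  eY : ∀ i j a, e i j * Y a = Y a * e i j
  eQ : ∀ i j a, e i j * Q a = Q a * e i j
  en : ∀ i j a, e i j * et a = -(et a * e i j)
  ep : ∀ i j a, e i j * ps a = -(ps a * e i j)
  fY : ∀ i j a, f i j * Y a = Y a * f i j
  fQ : ∀ i j a, f i j * Q a = Q a * f i j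
  fn : ∀ i j a, f i j * et a = -(et a * f i j)
  fp : ∀ i j a, f i j * ps a = -(ps a * f i j)

variable {e f : Fin l → Fin l → R} {X P : Fin l → R} {et ps Y Q : Fin m → R}

/-- twice the x-part of the Koszul differential -/
def Dx (f : Fin l → Fin l → R) (X : Fin l → R) : R := ∑ i, ∑ j, X i * X j * f i j
/-- y-part of the Koszul differential -/
def Dy (ps Y : Fin m → R) : R := ∑ a, Y a * ps a
/-- twice the x-homotopy -/
def hx (e : Fin l → Fin l → R) (P : Fin l → R) : R := ∑ i, ∑ j, e i j * (P i * P j)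
/-- y-homotopy -/
def hy (et Q : Fin m → R) : R := ∑ a, et a * Q a
/-- gl action on the exterior algebra -/
def Ff (e f : Fin l → Fin l → R) (i j : Fin l) : R := ∑ b, e i b * f b j
/-- total gl action -/
def Eo (e f : Fin l → Fin l → R) (X P : Fin l → R) (i j : Fin l) : R := X i * P j + Ff e f i j
/-- y-degree -/
def Ny (et ps Y Q : Fin m → R) : R := ∑ a, (Y a * Q a + et a * ps a)

namespace CC


theorem Fe (h : CC e f X P et ps Y Q) (i j a b : Fin l) : Ff e f i j * e a b = e a b * Ff e f i j
    + (dl R j b * e i a + dl R j a * e i b) := by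
  have : ∀ c, e i c * f c j * e a b = e a b * (e i c * f c j) +
      (dl R c a * (dl R j b * e i c) + dl R c b * (dl R j a * e i c)) := by
    intro c
    have e1 : ∀ u v u' v' : Fin l, e i c * (dl R u v * dl R u' v') = dl R u v * (dl R u' v' * e i c) := by
      intro u v u' v'
      rw [dl_dl]
    rw [mul_assoc, h.fe, mul_sub, mul_add, ← mul_assoc (e i c) (e a b), h.ee i c a b, e1, e1]
    noncomm_ring
  rw [Ff, Finset.sum_mul, Finset.sum_congr rfl fun c _ => this c, Finset.sum_add_distrib,
    Finset.sum_add_distrib, sum_dl', sum_dl', Finset.mul_sum]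

theorem Fff (h : CC e f X P et ps Y Q) (i j a b : Fin l) : Ff e f i j * f a b = f a b * Ff e f i j
    - (dl R i a * f j b + dl R i b * f j a) := by
  have : ∀ c, e i c * f c j * f a b = f a b * (e i c * f c j) -
      (dl R b c * (dl R i a * f c j) + dl R a c * (dl R i b * f c j)) := by
    intro c
    rw [mul_assoc, h.ff, ← mul_assoc (f a b), h.fe, sub_mul, add_mul, dl_comm a, dl_symm a i, dl_symm b i]
    noncomm_ring
  rw [Ff, Finset.sum_mul, Finset.sum_congr rfl fun c _ => this c, Finset.sum_sub_distrib,
    Finset.sum_add_distrib, sum_dl, sum_dl, Finset.mul_sum, h.fs b j, h.fs a j]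

theorem FX (h : CC e f X P et ps Y Q) (i j a : Fin l) : X a * Ff e f i j = Ff e f i j * X a := by
  rw [Ff, Finset.sum_mul, Finset.mul_sum]
  refine Finset.sum_congr rfl fun c _ => ?_
  rw [← mul_assoc, h.Xe, mul_assoc, h.Xf, mul_assoc]

theorem FP (h : CC e f X P et ps Y Q) (i j a : Fin l) : P a * Ff e f i j = Ff e f i j * P a := by
  rw [Ff, Finset.sum_mul, Finset.mul_sum]
  refine Finset.sum_congr rfl fun c _ => ?_
  rw [← mul_assoc, h.Pe, mul_assoc, h.Pf, mul_assoc]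

theorem FF (h : CC e f X P et ps Y Q) (i j a b : Fin l) : Ff e f i j * Ff e f a b = Ff e f a b * Ff e f i j
    + dl R j a * Ff e f i b - dl R i b * Ff e f a j := by
  have : ∀ c, Ff e f i j * (e a c * f c b) = e a c * f c b * Ff e f i j +
      (dl R j c * (e i a * f c b) + dl R j a * (e i c * f c b)
      - (dl R i c * (e a c * f j b) + dl R i b * (e a c * f c j))) := by
    intro c
    rw [← mul_assoc, h.Fe, add_mul, mul_assoc (e a c), h.Fff, h.fs j c, mul_sub, mul_add,
      ← mul_assoc (e a c) (dl R i c), ← mul_assoc (e a c) (dl R i b), ← dl_comm, ← dl_comm]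
    noncomm_ring
  conv_lhs => rw [Ff.eq_1 e f a b, Finset.mul_sum]
  rw [Finset.sum_congr rfl fun c _ => this c, Finset.sum_add_distrib, Finset.sum_sub_distrib,
    Finset.sum_add_distrib, Finset.sum_add_distrib, sum_dl, sum_dl, ← Finset.sum_mul, ← Finset.mul_sum,
    ← Finset.mul_sum, h.es i a]
  simp only [← Ff.eq_1]
  noncomm_ring

theorem XPXP (h : CC e f X P et ps Y Q) (i j a b : Fin l) : X i * P j * (X a * P b) = X a * P b * (X i * P j)
    + dl R j a * (X i * P b) - dl R i b * (X a * P j) := by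
  have h1 : X i * P j * (X a * P b) = X i * X a * (P j * P b) + dl R j a * (X i * P b) := by
    rw [mul_assoc, ← mul_assoc (P j), h.PX, add_mul, mul_add, ← mul_assoc (X i) (dl R j a), ← dl_comm]
    noncomm_ring
  have h2 : X a * P b * (X i * P j) = X a * X i * (P b * P j) + dl R b i * (X a * P j) := by
    rw [mul_assoc, ← mul_assoc (P b), h.PX, add_mul, mul_add, ← mul_assoc (X a) (dl R b i), ← dl_comm]
    noncomm_ring
  rw [h1, h2, h.XX a i, h.PP b j, dl_symm b i]
  noncomm_ring

theorem XPF (h : CC e f X P et ps Y Q) (i j a b : Fin l) : X i * P j * Ff e f a b = Ff e f a b * (X i * P j) := by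
  rw [mul_assoc, h.FP, ← mul_assoc, h.FX, mul_assoc]

theorem EE (h : CC e f X P et ps Y Q) (i j a b : Fin l) : Eo e f X P i j * Eo e f X P a b = Eo e f X P a b * Eo e f X P i j
    + dl R j a * Eo e f X P i b - dl R i b * Eo e f X P a j := by
  simp only [Eo, add_mul, mul_add, h.FF i j a b, h.XPF i j a b, ← h.XPF a b i j]
  rw [h.XPXP i j a b]
  noncomm_ring

theorem EDx (h : CC e f X P et ps Y Q) (i j : Fin l) : Eo e f X P i j * Dx f X = Dx f X * Eo e f X P i j := by
  have key : ∀ a b, Eo e f X P i j * (X a * X b * f a b) = X a * X b * f a b * Eo e f X P i j +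
      ((dl R j a * (X i * X b * f a b) + dl R j b * (X i * X a * f a b)) -
       (dl R i a * (X a * X b * f j b) + dl R i b * (X a * X b * f j a))) := by
    intro a b
    have h1 : X i * P j * (X a * X b * f a b) = X a * X b * f a b * (X i * P j) +
        (dl R j a * (X i * X b * f a b) + dl R j b * (X i * X a * f a b)) := by
      have e1 : P j * (X a * X b) = X a * X b * P j + (dl R j a * X b + dl R j b * X a) := by
        rw [← mul_assoc, h.PX, add_mul, mul_assoc, h.PX, mul_add, ← dl_comm]
        noncomm_ring
      have e2 : X i * (X a * X b) = X a * X b * X i := by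
        rw [← mul_assoc, h.XX i a, mul_assoc, h.XX i b, mul_assoc]
      have e3 : X i * P j * f a b = f a b * (X i * P j) := by
        rw [mul_assoc, h.Pf, ← mul_assoc, h.Xf, mul_assoc]
      calc X i * P j * (X a * X b * f a b) = X i * (P j * (X a * X b)) * f a b := by noncomm_ring
        _ = X i * (X a * X b) * P j * f a b + (X i * dl R j a * X b * f a b + X i * dl R j b * X a * f a b) := by
          rw [e1]; noncomm_ring
        _ = X a * X b * (X i * P j * f a b) + (X i * dl R j a * X b * f a b + X i * dl R j b * X a * f a b) := by
          rw [e2]; noncomm_ring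
        _ = _ := by
          rw [e3, ← dl_comm, ← dl_comm]; noncomm_ring
    have h2 : Ff e f i j * (X a * X b * f a b) = X a * X b * f a b * Ff e f i j -
        (dl R i a * (X a * X b * f j b) + dl R i b * (X a * X b * f j a)) := by
      calc Ff e f i j * (X a * X b * f a b) = (Ff e f i j * X a) * X b * f a b := by noncomm_ring
        _ = X a * (Ff e f i j * X b) * f a b := by rw [← h.FX]; noncomm_ring
        _ = X a * X b * (Ff e f i j * f a b) := by rw [← h.FX]; noncomm_ring
        _ = X a * X b * f a b * Ff e f i j - (X a * X b * dl R i a * f j b + X a * X b * dl R i b * f j a) := by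
          rw [h.Fff]; noncomm_ring
        _ = _ := by rw [← dl_comm, ← dl_comm]; noncomm_ring
    rw [Eo, add_mul, h1, h2]; noncomm_ring
  rw [Dx, Finset.mul_sum, Finset.sum_mul]
  simp only [Finset.mul_sum, Finset.sum_mul, key, Finset.sum_add_distrib, Finset.sum_sub_distrib]
  rw [Finset.sum_comm (f := fun a b => dl R j a * (X i * X b * f a b)),
    Finset.sum_comm (f := fun a b => dl R i a * (X a * X b * f j b))]
  simp only [sum_dl]
  have e1 : ∀ b, X i * X b * f b j = X i * X b * f j b := fun b => by rw [h.fs b j]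
  have e2 : ∀ b, X b * X i * f j b = X i * X b * f j b := fun b => by rw [h.XX b i]
  simp only [e1, e2, sub_self, add_zero]


theorem sum4_rev (g : Fin l → Fin l → Fin l → Fin l → R) :
    ∑ i, ∑ b, ∑ j, ∑ c, g i b j c = ∑ i, ∑ b, ∑ j, ∑ c, g c j b i := by
  simp only [← Fintype.sum_prod_type']
  exact Fintype.sum_equiv ⟨fun x => (x.2.2.2, x.2.2.1, x.2.1, x.1),
    fun x => (x.2.2.2, x.2.2.1, x.2.1, x.1), fun _ => rfl, fun _ => rfl⟩ _ _ fun x => rfl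

theorem sumA (i : Fin l) (g : Fin l → Fin l → R) : ∑ a, ∑ b, dl R i a * g a b = ∑ b, g i b := by
  rw [Finset.sum_comm]; simp only [sum_dl]

theorem sumA' (i : Fin l) (g : Fin l → Fin l → R) : ∑ a, ∑ b, dl R a i * g a b = ∑ b, g i b := by
  rw [Finset.sum_comm]; simp only [sum_dl']

theorem sumFF (h : CC e f X P et ps Y Q) (h2 : ∀ x : R, x + x = 0 → x = 0) :
    ∑ i, ∑ j, Ff e f i j * Ff e f j i = ∑ i, Ff e f i i + (l : R) * ∑ i, Ff e f i i := by
  have key : ∀ i b j c, e i b * f b j * (e j c * f c i) =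
      dl R b j * (dl R j c * (e i b * f c i)) + dl R b c * (e i b * f c i)
        - e i b * e j c * f b j * f c i := by
    intro i b j c
    have : e i b * f b j * (e j c * f c i) = e i b * (f b j * e j c) * f c i := by noncomm_ring
    have e1 : ∀ u v u' v' : Fin l, e i b * (dl R u v * dl R u' v') = dl R u v * (dl R u' v' * e i b) := by
      intro u v u' v'
      rw [dl_dl]
    rw [this, h.fe, mul_sub, mul_add, e1, e1, dl_self, one_mul]
    noncomm_ring
  have q : ∑ i, ∑ b, ∑ j, ∑ c, e i b * e j c * f b j * f c i = 0 := by
    apply h2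
    nth_rewrite 2 [sum4_rev]
    simp only [← Finset.sum_add_distrib]
    refine Finset.sum_eq_zero fun i _ => Finset.sum_eq_zero fun b _ => Finset.sum_eq_zero fun j _ =>
      Finset.sum_eq_zero fun c _ => ?_
    rw [h.es c j, h.es b i, h.fs j b, h.fs i c, h.ee j c i b]
    noncomm_ring
  have e1 : ∑ i, ∑ j, Ff e f i j * Ff e f j i =
      ∑ i, ∑ b, ∑ j, ∑ c, e i b * f b j * (e j c * f c i) := by
    refine Finset.sum_congr rfl fun i _ => ?_
    rw [Finset.sum_comm]
    refine Finset.sum_congr rfl fun j _ => ?_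
    simp only [Ff, Finset.sum_mul_sum]
  rw [e1]
  simp only [key, Finset.sum_add_distrib, Finset.sum_sub_distrib]
  rw [q]
  simp only [← Finset.mul_sum, sum_dl, Finset.sum_const, Finset.card_univ, Fintype.card_fin, nsmul_eq_mul]
  simp only [Ff, ← Finset.mul_sum, sub_zero]
  simp only [Finset.mul_sum, ← mul_assoc, Nat.cast_comm]
  congr 1
  refine Finset.sum_congr rfl fun i _ => Finset.sum_congr rfl fun j _ => ?_
  rw [mul_assoc, mul_assoc, Nat.cast_comm]

theorem PPXX (h : CC e f X P et ps Y Q) (a b i j : Fin l) : P a * P b * (X i * X j) = X i * X j * (P a * P b) +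
    (dl R i a * (X j * P b) + dl R j a * (X i * P b) + dl R i b * (X j * P a) + dl R j b * (X i * P a))
    + (dl R i a * dl R j b + dl R i b * dl R j a) := by
  have e1 : P b * (X i * X j) = X i * X j * P b + (dl R i b * X j + dl R j b * X i) := by
    rw [← mul_assoc, h.PX, add_mul, mul_assoc, h.PX, mul_add, ← dl_comm, dl_symm b j, dl_symm b i]
    noncomm_ring
  have e2 : P a * (X i * X j) = X i * X j * P a + (dl R i a * X j + dl R j a * X i) := by
    rw [← mul_assoc, h.PX, add_mul, mul_assoc, h.PX, mul_add, ← dl_comm, dl_symm a j, dl_symm a i]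
    noncomm_ring
  have e3 : P a * (dl R i b * X j) = dl R i b * (X j * P a + dl R j a) := by
    rw [← mul_assoc, ← dl_comm, mul_assoc, h.PX, dl_symm a j]
  have e4 : P a * (dl R j b * X i) = dl R j b * (X i * P a + dl R i a) := by
    rw [← mul_assoc, ← dl_comm, mul_assoc, h.PX, dl_symm a i]
  rw [mul_assoc, e1, mul_add, ← mul_assoc, e2, mul_add, e3, e4, dl_comm i a (dl R j b)]
  noncomm_ring

theorem Dxhx (h : CC e f X P et ps Y Q) : Dx f X * hx e P + hx e P * Dx f X =
    2 * ∑ i, ∑ j, X i * X j * (P i * P j) + 4 * ∑ i, ∑ j, X i * P j * Ff e f j i +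
      2 * ∑ i, Ff e f i i := by
  have key : ∀ i j a b, X i * X j * f i j * (e a b * (P a * P b)) +
      e a b * (P a * P b) * (X i * X j * f i j) =
      dl R i a * (dl R j b * (X i * X j * (P a * P b))) + dl R i b * (dl R j a * (X i * X j * (P a * P b)))
      + (dl R i a * (X j * P b * (e a b * f i j)) + dl R j a * (X i * P b * (e a b * f i j))
        + dl R i b * (X j * P a * (e a b * f i j)) + dl R j b * (X i * P a * (e a b * f i j)))
      + (dl R i a * (dl R j b * (e a b * f i j)) + dl R i b * (dl R j a * (e a b * f i j))) := by
    intro i j a b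
    have c1 : ∀ u v, X u * P v * (e a b * f i j) = (e a b * f i j) * (X u * P v) := by
      intro u v
      rw [mul_assoc, ← mul_assoc (P v), h.Pe, mul_assoc, h.Pf, ← mul_assoc (X u), h.Xe,
        mul_assoc (e a b), ← mul_assoc (X u), h.Xf]
      simp only [mul_assoc]
    have c2 : ∀ u v, X u * X v * (e a b * f i j) = (e a b * f i j) * (X u * X v) := by
      intro u v
      rw [mul_assoc, ← mul_assoc (X v), h.Xe, mul_assoc, h.Xf, ← mul_assoc (X u), h.Xe,
        mul_assoc (e a b), ← mul_assoc (X u), h.Xf]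
      simp only [mul_assoc]
    have c3 : P a * P b * f i j = f i j * (P a * P b) := by
      rw [mul_assoc, h.Pf, ← mul_assoc, h.Pf, mul_assoc]
    have c4 : X i * X j * f i j = f i j * (X i * X j) := by
      rw [mul_assoc, h.Xf, ← mul_assoc, h.Xf, mul_assoc]
    have c5 : ∀ u v u' v' : Fin l, X i * X j * (dl R u v * dl R u' v') * (P a * P b) = 
        dl R u v * (dl R u' v' * (X i * X j * (P a * P b))) := by
      intro u v u' v'
      rw [dl_dl]
      simp only [mul_assoc]
    have c6 : ∀ (u v : Fin l) (x : R), e a b * f i j * (dl R u v * x) = dl R u v * (e a b * f i j * x) := by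
      intro u v x
      rw [← mul_assoc, ← dl_comm u v (e a b * f i j), mul_assoc]
    have c7 : ∀ u v u' v' : Fin l, e a b * f i j * (dl R u v * dl R u' v') =
        dl R u v * (dl R u' v' * (e a b * f i j)) := by
      intro u v u' v'
      rw [c6, ← dl_comm]
    have t1 : X i * X j * f i j * (e a b * (P a * P b)) = 
        X i * X j * (dl R i a * dl R j b) * (P a * P b) + X i * X j * (dl R i b * dl R j a) * (P a * P b)
        - e a b * f i j * (X i * X j * (P a * P b)) := by
      rw [← mul_assoc (e a b * f i j), ← c2]
      have : X i * X j * f i j * (e a b * (P a * P b)) = X i * X j * (f i j * e a b) * (P a * P b) := by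
        simp only [mul_assoc]
      rw [this, h.fe]; noncomm_ring
    have t2 : e a b * (P a * P b) * (X i * X j * f i j) = e a b * f i j * (P a * P b * (X i * X j)) := by
      rw [c4, mul_assoc, ← mul_assoc (P a * P b), c3]; simp only [mul_assoc]
    rw [t1, t2, h.PPXX, c5, c5, mul_add, mul_add, mul_add, mul_add, mul_add, mul_add, c6, c6, c6, c6, c7, c7]
    simp only [c1]
    abel
  have : Dx f X * hx e P + hx e P * Dx f X = ∑ i, ∑ j, ∑ a, ∑ b,
      (X i * X j * f i j * (e a b * (P a * P b)) +
      e a b * (P a * P b) * (X i * X j * f i j)) := by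
    have A : Dx f X * hx e P = ∑ i, ∑ j, X i * X j * f i j * hx e P := by
      simp only [Dx, Finset.sum_mul]
    have B : hx e P * Dx f X = ∑ i, ∑ j, hx e P * (X i * X j * f i j) := by
      simp only [Dx, Finset.mul_sum]
    rw [A, B]
    simp only [hx, Finset.mul_sum]
    simp only [Finset.sum_mul, Finset.sum_add_distrib]
  rw [this]
  simp only [key, Finset.sum_add_distrib, sumA, sum_dl]
  have s1 : ∑ i, ∑ j, X i * X j * (P j * P i) = ∑ i, ∑ j, X i * X j * (P i * P j) :=
    Finset.sum_congr rfl fun i _ => Finset.sum_congr rfl fun j _ => by rw [h.PP j i]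
  have s2 : ∀ i j, ∑ b, X j * P b * (e i b * f i j) = ∑ b, X j * P b * (e b i * f i j) := fun i j =>
    Finset.sum_congr rfl fun b _ => by rw [h.es i b]
  have s3 : ∀ i j, ∑ b, X i * P b * (e j b * f i j) = ∑ b, X i * P b * (e b j * f j i) := fun i j =>
    Finset.sum_congr rfl fun b _ => by rw [h.es j b, h.fs i j]
  have s4 : ∀ i j, ∑ b, X i * P b * (e b j * f i j) = ∑ b, X i * P b * (e b j * f j i) := fun i j =>
    Finset.sum_congr rfl fun b _ => by rw [h.fs i j]
  have s5 : ∑ i, ∑ j, ∑ b, X i * P b * (e b j * f j i) = ∑ i, ∑ j, X i * P j * Ff e f j i := by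
    refine Finset.sum_congr rfl fun i _ => ?_
    rw [Finset.sum_comm]
    refine Finset.sum_congr rfl fun b _ => ?_
    rw [Ff, Finset.mul_sum]
  have s6 : ∑ i, ∑ j, ∑ b, X j * P b * (e b i * f i j) = ∑ i, ∑ j, X i * P j * Ff e f j i := by
    rw [Finset.sum_comm, s5]
  have s7 : ∑ i, ∑ j, e i j * f i j = ∑ i, Ff e f i i :=
    Finset.sum_congr rfl fun i _ => Finset.sum_congr rfl fun j _ => by rw [h.fs i j]
  have s8 : ∑ i, ∑ j, e j i * f i j = ∑ i, Ff e f i i := by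
    rw [← s7]
    exact Finset.sum_congr rfl fun i _ => Finset.sum_congr rfl fun j _ => by rw [h.es i j]
  have s9 : ∑ i, ∑ j, ∑ b, X i * P b * (e b j * f i j) = ∑ i, ∑ j, X i * P j * Ff e f j i := by
    rw [← s5]
    exact Finset.sum_congr rfl fun i _ => Finset.sum_congr rfl fun j _ => s4 i j
  simp only [s1, s2, s3, s9, s5, s6, s7, s8]
  noncomm_ring

theorem sumXPXP (h : CC e f X P et ps Y Q) : ∑ i, ∑ j, X i * P j * (X j * P i) = ∑ i, ∑ j, X i * X j * (P i * P j) +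
    (l : R) * ∑ i, X i * P i := by
  have key : ∀ i j, X i * P j * (X j * P i) = X i * X j * (P i * P j) + X i * P i := by
    intro i j
    have : X i * P j * (X j * P i) = X i * (P j * X j) * P i := by simp only [mul_assoc]
    rw [this, h.PX, dl_self, h.PP i j]; noncomm_ring
  simp only [key, Finset.sum_add_distrib, Finset.sum_const, Finset.card_univ, Fintype.card_fin, nsmul_eq_mul,
    Finset.mul_sum]

theorem Dxhx_cas (h : CC e f X P et ps Y Q) (h2 : ∀ x : R, x + x = 0 → x = 0) : Dx f X * hx e P + hx e P * Dx f X =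
    2 * (∑ i, ∑ j, Eo e f X P i j * Eo e f X P j i - (l : R) * ∑ i, Eo e f X P i i) := by
  have c : ∑ i, ∑ j, Eo e f X P i j * Eo e f X P j i = ∑ i, ∑ j, X i * P j * (X j * P i)
      + 2 * ∑ i, ∑ j, X i * P j * Ff e f j i + ∑ i, ∑ j, Ff e f i j * Ff e f j i := by
    have s : ∑ i, ∑ j, Ff e f i j * (X j * P i) = ∑ i, ∑ j, X i * P j * Ff e f j i := by
      rw [Finset.sum_comm]
      exact Finset.sum_congr rfl fun i _ => Finset.sum_congr rfl fun j _ => by rw [h.XPF]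
    simp only [Eo, add_mul, mul_add, Finset.sum_add_distrib]
    rw [s]; noncomm_ring
  have d : ∑ i, Eo e f X P i i = ∑ i, X i * P i + ∑ i, Ff e f i i := by
    simp only [Eo, Finset.sum_add_distrib]
  rw [h.Dxhx, c, d, h.sumFF h2, h.sumXPXP]
  noncomm_ring

theorem Dyhx (h : CC e f X P et ps Y Q) : Dy ps Y * hx e P + hx e P * Dy ps Y = 0 := by
  have key : ∀ a i j, Y a * ps a * (e i j * (P i * P j)) + e i j * (P i * P j) * (Y a * ps a) = 0 := by
    intro a i j
    have c1 : P i * P j * (Y a * ps a) = Y a * ps a * (P i * P j) := by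
      rw [mul_assoc, ← mul_assoc (P j), h.PY, mul_assoc (Y a), h.Pp, ← mul_assoc, h.PY, mul_assoc, ← mul_assoc (P i),
        h.Pp]
      simp only [mul_assoc]
    have c2 : e i j * (Y a * ps a) = -(Y a * ps a * e i j) := by
      rw [← mul_assoc, h.eY, mul_assoc, h.ep]; noncomm_ring
    rw [mul_assoc (e i j), c1, ← mul_assoc (e i j) (Y a * ps a), c2]; noncomm_ring
  have A : Dy ps Y * hx e P = ∑ a, ∑ i, ∑ j, Y a * ps a * (e i j * (P i * P j)) := by
    rw [Dy, Finset.sum_mul]; simp only [hx, Finset.mul_sum]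
  have B : hx e P * Dy ps Y = ∑ a, ∑ i, ∑ j, e i j * (P i * P j) * (Y a * ps a) := by
    rw [Dy, Finset.mul_sum]; simp only [hx, Finset.sum_mul]
  rw [A, B]
  simp only [← Finset.sum_add_distrib, key, Finset.sum_const_zero]

theorem Dxhy (h : CC e f X P et ps Y Q) : Dx f X * hy et Q + hy et Q * Dx f X = 0 := by
  have key : ∀ a i j, et a * Q a * (X i * X j * f i j) + X i * X j * f i j * (et a * Q a) = 0 := by
    intro a i j
    have c1 : X i * X j * (et a * Q a) = et a * Q a * (X i * X j) := by
      rw [mul_assoc, ← mul_assoc (X j), h.Xn, mul_assoc (et a), h.XQ, ← mul_assoc, h.Xn, mul_assoc, ← mul_assoc (X i),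
        h.XQ]
      simp only [mul_assoc]
    have c2 : f i j * (et a * Q a) = -(et a * Q a * f i j) := by
      rw [← mul_assoc, h.fn, neg_mul, mul_assoc, h.fQ]; noncomm_ring
    rw [mul_assoc (X i * X j), c2, mul_neg, ← mul_assoc (X i * X j), c1]; noncomm_ring
  have A : hy et Q * Dx f X = ∑ a, ∑ i, ∑ j, et a * Q a * (X i * X j * f i j) := by
    rw [hy, Finset.sum_mul]; simp only [Dx, Finset.mul_sum]
  have B : Dx f X * hy et Q = ∑ a, ∑ i, ∑ j, X i * X j * f i j * (et a * Q a) := by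
    rw [hy, Finset.mul_sum]; simp only [Dx, Finset.sum_mul]
  rw [add_comm, A, B]
  simp only [← Finset.sum_add_distrib, key, Finset.sum_const_zero]

theorem Dyhy (h : CC e f X P et ps Y Q) : Dy ps Y * hy et Q + hy et Q * Dy ps Y = Ny et ps Y Q := by
  have key : ∀ a b, Y a * ps a * (et b * Q b) + et b * Q b * (Y a * ps a) =
      dl R a b * (Y a * Q b) + dl R a b * (et b * ps a) := by
    intro a b
    have t1 : Y a * ps a * (et b * Q b) = Y a * (ps a * et b) * Q b := by simp only [mul_assoc]
    have t2 : et b * Q b * (Y a * ps a) = et b * (Q b * Y a) * ps a := by simp only [mul_assoc]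
    have t3 : Y a * (et b * ps a) * Q b = et b * (Y a * Q b) * ps a := by
      rw [← mul_assoc, h.Yn, mul_assoc (et b), mul_assoc (et b), mul_assoc (Y a), ← h.Qp]
      simp only [mul_assoc]
    rw [t1, t2, h.pn, h.QY, mul_sub, sub_mul, t3, ← dl_comm, mul_add (et b), dl_symm b a, ← dl_comm a b (et b)]
    noncomm_ring
  have A : Dy ps Y * hy et Q = ∑ a, ∑ b, Y a * ps a * (et b * Q b) := by
    rw [Dy, Finset.sum_mul]; simp only [hy, Finset.mul_sum]
  have B : hy et Q * Dy ps Y = ∑ a, ∑ b, et b * Q b * (Y a * ps a) := by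
    rw [Dy, Finset.mul_sum]; simp only [hy, Finset.sum_mul]
  rw [A, B]
  simp only [← Finset.sum_add_distrib, key, sum_dl, Ny]
  simp only [Finset.sum_add_distrib, sum_dl]

theorem EDy (h : CC e f X P et ps Y Q) (i j : Fin l) : Eo e f X P i j * Dy ps Y = Dy ps Y * Eo e f X P i j := by
  rw [Dy, Finset.mul_sum, Finset.sum_mul]
  refine Finset.sum_congr rfl fun a _ => ?_
  have h1 : X i * P j * (Y a * ps a) = Y a * ps a * (X i * P j) := by
    rw [mul_assoc, ← mul_assoc (P j), h.PY, mul_assoc (Y a), h.Pp, ← mul_assoc, h.XY, mul_assoc, ← mul_assoc (X i),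
      h.Xp]
    simp only [mul_assoc]
  have h2 : Ff e f i j * (Y a * ps a) = Y a * ps a * Ff e f i j := by
    rw [Ff, Finset.mul_sum, Finset.sum_mul]
    refine Finset.sum_congr rfl fun b _ => ?_
    rw [mul_assoc, ← mul_assoc (f b j), h.fY, mul_assoc (Y a), h.fp, mul_neg, mul_neg, ← mul_assoc, h.eY, mul_assoc,
      ← mul_assoc (e i b), h.ep]
    noncomm_ring
  rw [Eo, add_mul, mul_add, h1, h2]

theorem ENy (h : CC e f X P et ps Y Q) (i j : Fin l) : Eo e f X P i j * Ny et ps Y Q = Ny et ps Y Q * Eo e f X P i j := by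
  rw [Ny, Finset.mul_sum, Finset.sum_mul]
  refine Finset.sum_congr rfl fun a _ => ?_
  have a1 : X i * P j * (Y a * Q a) = Y a * Q a * (X i * P j) := by
    rw [mul_assoc, ← mul_assoc (P j), h.PY, mul_assoc (Y a), h.PQ, ← mul_assoc, h.XY, mul_assoc, ← mul_assoc (X i),
      h.XQ]
    simp only [mul_assoc]
  have a2 : X i * P j * (et a * ps a) = et a * ps a * (X i * P j) := by
    rw [mul_assoc, ← mul_assoc (P j), h.Pn, mul_assoc (et a), h.Pp, ← mul_assoc, h.Xn, mul_assoc, ← mul_assoc (X i),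
      h.Xp]
    simp only [mul_assoc]
  have a3 : Ff e f i j * (Y a * Q a) = Y a * Q a * Ff e f i j := by
    rw [Ff, Finset.mul_sum, Finset.sum_mul]
    refine Finset.sum_congr rfl fun b _ => ?_
    rw [mul_assoc, ← mul_assoc (f b j), h.fY, mul_assoc (Y a), h.fQ, ← mul_assoc, h.eY, mul_assoc,
      ← mul_assoc (e i b), h.eQ]
    simp only [mul_assoc]
  have a4 : Ff e f i j * (et a * ps a) = et a * ps a * Ff e f i j := by
    rw [Ff, Finset.mul_sum, Finset.sum_mul]
    refine Finset.sum_congr rfl fun b _ => ?_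
    have c1 : f b j * (et a * ps a) = et a * ps a * f b j := by
      rw [← mul_assoc, h.fn, neg_mul, mul_assoc, h.fp]; noncomm_ring
    have c2 : e i b * (et a * ps a) = et a * ps a * e i b := by
      rw [← mul_assoc, h.en, neg_mul, mul_assoc, h.ep]; noncomm_ring
    rw [mul_assoc, c1, ← mul_assoc, c2, mul_assoc]
  simp only [Eo, add_mul, mul_add, a1, a2, a3, a4]
  abel

theorem hxNy (h : CC e f X P et ps Y Q) : hx e P * Ny et ps Y Q = Ny et ps Y Q * hx e P := by
  rw [hx, Finset.sum_mul, Finset.mul_sum]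
  refine Finset.sum_congr rfl fun i _ => ?_
  rw [Finset.sum_mul, Finset.mul_sum]
  refine Finset.sum_congr rfl fun j _ => ?_
  rw [Ny, Finset.mul_sum, Finset.sum_mul]
  refine Finset.sum_congr rfl fun a _ => ?_
  have a1 : P i * P j * (Y a * Q a) = Y a * Q a * (P i * P j) := by
    rw [mul_assoc, ← mul_assoc (P j), h.PY, mul_assoc (Y a), h.PQ, ← mul_assoc, h.PY, mul_assoc, ← mul_assoc (P i),
      h.PQ]
    simp only [mul_assoc]
  have a2 : P i * P j * (et a * ps a) = et a * ps a * (P i * P j) := by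
    rw [mul_assoc, ← mul_assoc (P j), h.Pn, mul_assoc (et a), h.Pp, ← mul_assoc, h.Pn, mul_assoc, ← mul_assoc (P i),
      h.Pp]
    simp only [mul_assoc]
  have a3 : e i j * (Y a * Q a) = Y a * Q a * e i j := by
    rw [← mul_assoc, h.eY, mul_assoc, h.eQ, mul_assoc]
  have a4 : e i j * (et a * ps a) = et a * ps a * e i j := by
    rw [← mul_assoc, h.en, neg_mul, mul_assoc, h.ep]; noncomm_ring
  rw [mul_add, add_mul, mul_assoc (e i j) (P i * P j), a1, mul_assoc (e i j) (P i * P j), a2,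
    ← mul_assoc (e i j) (Y a * Q a), a3, ← mul_assoc (e i j) (et a * ps a), a4]
  simp only [mul_assoc]

theorem DxDx (h : CC e f X P et ps Y Q) (h2 : ∀ x : R, x + x = 0 → x = 0) : Dx f X * Dx f X = 0 := by
  have key : ∀ i j a b, X i * X j * f i j * (X a * X b * f a b) + X a * X b * f a b * (X i * X j * f i j) = 0 := by
    intro i j a b
    have c : ∀ i j a b, X i * X j * f i j * (X a * X b * f a b) = X i * X j * (X a * X b) * (f i j * f a b) := by
      intro i j a b
      rw [mul_assoc (X i * X j), ← mul_assoc (f i j), ← mul_assoc (f i j), ← h.Xf, mul_assoc (X a), ← h.Xf]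
      simp only [mul_assoc]
    have d : X a * X b * (X i * X j) = X i * X j * (X a * X b) := by
      have : ∀ u, X a * X b * X u = X u * (X a * X b) := fun u => by
        rw [mul_assoc, h.XX b u, ← mul_assoc, h.XX a u, mul_assoc]
      rw [← mul_assoc, this, mul_assoc, this, mul_assoc]
    rw [c, c a b i j, d, h.ff a b i j]; noncomm_ring
  apply h2
  have A : Dx f X * Dx f X = ∑ i, ∑ j, ∑ a, ∑ b, X i * X j * f i j * (X a * X b * f a b) := by
    conv_lhs => rw [Dx.eq_1, Finset.sum_mul]
    simp only [Finset.sum_mul]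
    simp only [Finset.mul_sum]
  have B : Dx f X * Dx f X = ∑ i, ∑ j, ∑ a, ∑ b, X a * X b * f a b * (X i * X j * f i j) := by
    conv_lhs => rw [Dx.eq_1, Finset.mul_sum]
    simp only [Finset.mul_sum]
    simp only [Finset.sum_mul]
  nth_rewrite 1 [A]
  rw [B]
  simp only [← Finset.sum_add_distrib, key, Finset.sum_const_zero]

theorem DyDy (h : CC e f X P et ps Y Q) (h2 : ∀ x : R, x + x = 0 → x = 0) : Dy ps Y * Dy ps Y = 0 := by
  have key : ∀ a b, Y a * ps a * (Y b * ps b) + Y b * ps b * (Y a * ps a) = 0 := by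
    intro a b
    have c : ∀ a b, Y a * ps a * (Y b * ps b) = Y a * Y b * (ps a * ps b) := by
      intro a b
      rw [mul_assoc, ← mul_assoc (ps a), ← h.Yp]; simp only [mul_assoc]
    rw [c, c b a, h.YY b a, h.pp b a]; noncomm_ring
  apply h2
  have A : Dy ps Y * Dy ps Y = ∑ a, ∑ b, Y a * ps a * (Y b * ps b) := by
    rw [Dy, Finset.sum_mul_sum]
  have B : Dy ps Y * Dy ps Y = ∑ a, ∑ b, Y b * ps b * (Y a * ps a) := by
    rw [A, Finset.sum_comm]
  nth_rewrite 1 [A]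
  rw [B]
  simp only [← Finset.sum_add_distrib, key, Finset.sum_const_zero]

theorem DxDy (h : CC e f X P et ps Y Q) : Dx f X * Dy ps Y + Dy ps Y * Dx f X = 0 := by
  have key : ∀ a i j, Y a * ps a * (X i * X j * f i j) + X i * X j * f i j * (Y a * ps a) = 0 := by
    intro a i j
    have c1 : X i * X j * (Y a * ps a) = Y a * ps a * (X i * X j) := by
      rw [mul_assoc, ← mul_assoc (X j), h.XY, mul_assoc (Y a), h.Xp, ← mul_assoc, h.XY, mul_assoc, ← mul_assoc (X i),
        h.Xp]
      simp only [mul_assoc]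
    have c2 : f i j * (Y a * ps a) = -(Y a * ps a * f i j) := by
      rw [← mul_assoc, h.fY, mul_assoc, h.fp]; noncomm_ring
    rw [mul_assoc (X i * X j), c2, mul_neg, ← mul_assoc (X i * X j), c1]; noncomm_ring
  have A : Dy ps Y * Dx f X = ∑ a, ∑ i, ∑ j, Y a * ps a * (X i * X j * f i j) := by
    rw [Dy, Finset.sum_mul]; simp only [Dx, Finset.mul_sum]
  have B : Dx f X * Dy ps Y = ∑ a, ∑ i, ∑ j, X i * X j * f i j * (Y a * ps a) := by
    rw [Dy, Finset.mul_sum]; simp only [Dx, Finset.sum_mul]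
  rw [add_comm, A, B]
  simp only [← Finset.sum_add_distrib, key, Finset.sum_const_zero]

end CC
end AbsAlg

section Fit
variable {k V : Type} [Field k] [AddCommGroup V] [Module k V]

theorem fit_ev (Θ : Module.End k V) (B : Submodule k V) [FiniteDimensional k B]
    (hs : ∀ v ∈ B, Θ v ∈ B) : ∀ᶠ N in Filter.atTop,
    (∀ v ∈ B, ∃ v0 ∈ B ⊓ Θ.maxGenEigenspace 0, ∃ u ∈ B, v = v0 + (Θ ^ N) u) ∧
    (∀ u ∈ B, (Θ ^ N) u ∈ Θ.maxGenEigenspace 0 → (Θ ^ N) u = 0) := by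
  set g : Module.End k B := Θ.restrict hs with hg
  have hpow : ∀ n (u : B), ((g ^ n) u : V) = (Θ ^ n) u := by
    intro n
    induction n with
    | zero => intro u; simp
    | succ n ih => intro u; rw [pow_succ, pow_succ, Module.End.mul_apply, Module.End.mul_apply, ih]; rfl
  have hc := LinearMap.isCompl_iSup_ker_pow_iInf_range_pow g
  have hmem : ∀ u : B, u ∈ ⨆ n, LinearMap.ker (g ^ n) ↔ (u : V) ∈ Θ.maxGenEigenspace 0 := by
    intro u
    rw [Submodule.mem_iSup_of_directed, Module.End.mem_maxGenEigenspace]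
    · simp only [LinearMap.mem_ker, zero_smul, sub_zero]
      refine exists_congr fun n => ?_
      rw [← hpow, ZeroMemClass.coe_eq_zero]
    · refine Monotone.directed_le ?_
      intro a b hab
      intro x hx
      rw [LinearMap.mem_ker] at *
      obtain ⟨c, rfl⟩ := Nat.exists_eq_add_of_le' hab
      rw [pow_add, Module.End.mul_apply, hx, map_zero]
  filter_upwards [LinearMap.eventually_iInf_range_pow_eq g] with N hN
  rw [hN] at hc
  constructor
  · intro v hv
    have : (⟨v, hv⟩ : B) ∈ (⨆ n, LinearMap.ker (g ^ n)) ⊔ LinearMap.range (g ^ N) := by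
      rw [hc.sup_eq_top]; trivial
    obtain ⟨a, ha, b, ⟨u, rfl⟩, hab⟩ := Submodule.mem_sup.1 this
    refine ⟨a, ⟨a.2, (hmem a).1 ha⟩, u, u.2, ?_⟩
    have := congrArg (Subtype.val) hab
    rw [← hpow]; exact this.symm
  · intro u hu h
    have h1 : (g ^ N) ⟨u, hu⟩ ∈ ⨆ n, LinearMap.ker (g ^ n) := by
      rw [hmem, hpow]; exact h
    have h2 : (g ^ N) ⟨u, hu⟩ ∈ (⨆ n, LinearMap.ker (g ^ n)) ⊓ LinearMap.range (g ^ N) := ⟨h1, ⟨_, rfl⟩⟩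
    rw [hc.inf_eq_bot, Submodule.mem_bot] at h2
    rw [← hpow N ⟨u, hu⟩, h2]; rfl

theorem fit_dim (D h Θ : Module.End k V) (hD : ∀ v, D (D v) = 0) (hΘ : ∀ v, Θ v = D (h v) + h (D v))
    (B0 B1 : Submodule k V) [FiniteDimensional k B0] [FiniteDimensional k B1]
    (s0 : ∀ v ∈ B0, Θ v ∈ B0) (s1 : ∀ v ∈ B1, Θ v ∈ B1) (hD1 : ∀ v ∈ B1, D v ∈ B0)
    (hh : ∀ v ∈ B0, h v ∈ B1) :
    Module.finrank k ↥(LinearMap.ker D ⊓ B0) + Module.finrank k ↥(Submodule.map D (B1 ⊓ Θ.maxGenEigenspace 0)) =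
    Module.finrank k ↥(Submodule.map D B1) + Module.finrank k ↥(LinearMap.ker D ⊓ (B0 ⊓ Θ.maxGenEigenspace 0)) := by
  have hcomm : ∀ v, D (Θ v) = Θ (D v) := by
    intro v; rw [hΘ, hΘ, map_add, hD, hD, map_zero, zero_add, add_zero]
  have hcommN : ∀ n v, D ((Θ ^ n) v) = (Θ ^ n) (D v) := by
    intro n
    induction n with
    | zero => intro v; simp
    | succ n ih => intro v; rw [pow_succ, Module.End.mul_apply, Module.End.mul_apply, ih, hcomm]
  have hsN : ∀ n v, v ∈ LinearMap.ker D ⊓ B0 → (Θ ^ n) v ∈ LinearMap.ker D ⊓ B0 := by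
    intro n
    induction n with
    | zero => intro v hv; simpa using hv
    | succ n ih =>
      intro v hv
      rw [pow_succ, Module.End.mul_apply]
      refine ih _ ⟨?_, s0 _ hv.2⟩
      show D (Θ v) = 0
      rw [hcomm, LinearMap.mem_ker.1 hv.1, map_zero]
  have hGD : ∀ v ∈ Θ.maxGenEigenspace 0, D v ∈ Θ.maxGenEigenspace 0 := by
    intro v hv
    rw [Module.End.mem_maxGenEigenspace] at *
    obtain ⟨n, hn⟩ := hv
    refine ⟨n, ?_⟩
    simp only [zero_smul, sub_zero] at *
    rw [← hcommN, hn, map_zero]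
  have : FiniteDimensional k ↥(LinearMap.ker D ⊓ B0) := Submodule.finiteDimensional_of_le inf_le_right
  have : FiniteDimensional k ↥(LinearMap.ker D ⊓ (B0 ⊓ Θ.maxGenEigenspace 0)) :=
    Submodule.finiteDimensional_of_le (inf_le_right.trans inf_le_left)
  obtain ⟨N, ⟨⟨⟨a1, a2⟩, ⟨b1, b2⟩⟩, ⟨c1, c2⟩⟩, hN⟩ :=
    ((((fit_ev Θ B0 s0).and (fit_ev Θ B1 s1)).and
    (fit_ev Θ (LinearMap.ker D ⊓ B0) (fun v hv => by simpa using hsN 1 v hv))).and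
      (Filter.eventually_gt_atTop 0)).exists
  obtain ⟨N, rfl⟩ : ∃ M, N = M + 1 := ⟨N - 1, by omega⟩
  have hle : Submodule.map D B1 ≤ LinearMap.ker D ⊓ B0 := by
    rintro _ ⟨w, hw, rfl⟩
    exact ⟨hD w, hD1 w hw⟩
  have claim1 : LinearMap.ker D ⊓ (B0 ⊓ Θ.maxGenEigenspace 0) ⊔ Submodule.map D B1 = LinearMap.ker D ⊓ B0 := by
    apply le_antisymm
    · exact sup_le (inf_le_inf_left _ inf_le_left) hle
    · intro v hv
      obtain ⟨v0, hv0, u, hu, rfl⟩ := c1 v hv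
      refine Submodule.add_mem_sup ⟨hv0.1.1, hv0.1.2, hv0.2⟩ ?_
      rw [pow_succ', Module.End.mul_apply]
      have := hsN N u hu
      rw [hΘ, LinearMap.mem_ker.1 this.1, map_zero, add_zero]
      exact ⟨_, hh _ this.2, rfl⟩
  have claim2 : LinearMap.ker D ⊓ (B0 ⊓ Θ.maxGenEigenspace 0) ⊓ Submodule.map D B1 =
      Submodule.map D (B1 ⊓ Θ.maxGenEigenspace 0) := by
    apply le_antisymm
    · rintro v ⟨⟨-, -, hG⟩, w, hw, rfl⟩
      obtain ⟨w0, hw0, u, hu, rfl⟩ := b1 w hw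
      refine ⟨w0, hw0, ?_⟩
      rw [map_add] at hG ⊢
      have h1 := (Submodule.add_mem_iff_right _ (hGD _ hw0.2)).1 hG
      rw [hcommN] at h1 ⊢
      rw [a2 _ (hD1 u hu) h1, add_zero]
    · rintro _ ⟨w, hw, rfl⟩
      exact ⟨⟨hD w, hD1 w hw.1, hGD w hw.2⟩, w, hw.1, rfl⟩
  have := Submodule.finrank_sup_add_finrank_inf_eq (LinearMap.ker D ⊓ (B0 ⊓ Θ.maxGenEigenspace 0)) (Submodule.map D B1)
  rw [claim1, claim2] at this
  rw [this, add_comm]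

end Fit

section Main
variable {k V : Type} [Field k] [AddCommGroup V] [Module k V] {l m : ℕ}

theorem rank_null (D : Module.End k V) (S : Submodule k V) [FiniteDimensional k S] :
    Module.finrank k S = Module.finrank k ↥(LinearMap.ker D ⊓ S) + Module.finrank k ↥(Submodule.map D S) := by
  have h := LinearMap.finrank_range_add_finrank_ker (D.domRestrict S)
  rw [LinearMap.range_domRestrict, LinearMap.ker_domRestrict] at h
  have h2 : Module.finrank k ↥(Submodule.comap S.subtype (LinearMap.ker D)) =
      Module.finrank k ↥(LinearMap.ker D ⊓ S) := by
    rw [inf_comm, ← Submodule.map_comap_subtype]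
    exact (Submodule.finrank_map_subtype_eq S _).symm
  rw [← h, ← h2, add_comm]

theorem wdim_map [CharZero k] [IsAlgClosed k] {E : Fin l → Fin l → Module.End k V} {n : ℕ} {G : Submodule k V}
    (hG : GlMod E n G) (D : Module.End k V) (hD : ∀ i j v, D (E i j v) = E i j (D v))
    (hN : GlMod E n (Submodule.map D G)) (α : Fin l →₀ ℕ) :
    wdim E (Submodule.map D G) α ≤ wdim E G α := by
  have hK : GlMod E n (LinearMap.ker D ⊓ G) := by
    refine hG.mono inf_le_right fun i j v hv => ⟨?_, hG.stable i j v hv.2⟩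
    show D (E i j v) = 0
    rw [hD, LinearMap.mem_ker.1 hv.1, map_zero]
  have hle : ∀ α, wdim E G α ≤ wdim E (LinearMap.ker D ⊓ G) α + wdim E (Submodule.map D G) α := by
    intro α
    have := hG.finwt α
    have := hN.finwt α
    rw [wdim, rank_null D]
    apply add_le_add
    · rw [wdim, inf_assoc]
    · apply Submodule.finrank_mono
      rintro _ ⟨v, hv, rfl⟩
      refine ⟨⟨v, hv.1, rfl⟩, ?_⟩
      have h2 := mem_wtSp.1 hv.2
      rw [SetLike.mem_coe, mem_wtSp]
      intro i
      rw [← hD, h2, map_smul]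
  have := hG.fin
  have h1 := rank_null D G
  rw [hG.finrank_eq, hK.finrank_eq, hN.finrank_eq, ← Finset.sum_add_distrib] at h1
  by_cases hα : ∑ i, α i = n
  · have h3 := (Finset.sum_eq_sum_iff_of_le (fun β _ => hle β)).1 h1 α
      (by rw [Finset.mem_finsuppAntidiag]; exact ⟨hα, Finset.subset_univ _⟩)
    omega
  · rw [hN.wdim_zero hα]; exact Nat.zero_le _

theorem glRel_of_CC {e f : Fin l → Fin l → Module.End k V} {X P : Fin l → Module.End k V}
    {et ps Y Q : Fin m → Module.End k V} (h : CC e f X P et ps Y Q) : GlRel (Eo e f X P) := by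
  intro i j a b
  rw [h.EE i j a b]
  congr 1
  · congr 1
    unfold dl; split_ifs <;> simp
  · unfold dl; split_ifs <;> simp

theorem main_abs [CharZero k] [IsAlgClosed k] {e f : Fin l → Fin l → Module.End k V}
    {X P : Fin l → Module.End k V}
    {et ps Y Q : Fin m → Module.End k V} (h : CC e f X P et ps Y Q)
    (n : ℕ) (D : Module.End k V) (hDdef : D = (2⁻¹ : k) • Dx f X + Dy ps Y)
    (T : ℕ → Submodule k V) (hfin : ∀ p, FiniteDimensional k (T p))
    (D0 : ∀ v ∈ T 0, D v = 0) (D1 : ∀ p, ∀ v ∈ T (p + 1), D v ∈ T p)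
    (hxT : ∀ p, ∀ v ∈ T p, hx e P v ∈ T (p + 1))
    (hyT : ∀ p, ∀ v ∈ T p, hy et Q v ∈ T (p + 1))
    (hM : ∀ p, GlMod (Eo e f X P) n (T p ⊓ (Ny et ps Y Q).maxGenEigenspace 0))
    (hdeg : ∀ p, ∀ v ∈ T p ⊓ (Ny et ps Y Q).maxGenEigenspace 0, ∑ i, Eo e f X P i i v = (n : k) • v)
    (hchi : ∀ p r, n = 2 * p + r → chi (Eo e f X P) n (T p ⊓ (Ny et ps Y Q).maxGenEigenspace 0) =
      esym k l p * hsym k l r)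
    (hbot : ∀ p, n < 2 * p → T p = ⊥) (p q : ℕ) (hn : n = 2 * p + 2 * q) :
    Module.finrank k ↥(LinearMap.ker D ⊓ T p) = Module.finrank k ↥(Submodule.map D (T (p + 1))) +
      veroneseBetti l p q := by
  have h2 : ∀ x : Module.End k V, x + x = 0 → x = 0 := by
    intro x hx
    rw [← two_smul k] at hx
    exact (smul_eq_zero.1 hx).resolve_left two_ne_zero
  have hDD : D * D = 0 := by
    have h3 := h.DxDy
    rw [hDdef]
    simp only [add_mul, mul_add, smul_mul_assoc, mul_smul_comm, h.DxDx h2, h.DyDy h2, smul_zero, zero_add, add_zero]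
    rw [← smul_add, add_comm, h3, smul_zero]
  have hDD' : ∀ v, D (D v) = 0 := fun v => by
    rw [← Module.End.mul_apply, hDD]; rfl
  set N := Ny et ps Y Q with hNdef
  set E := Eo e f X P with hE
  have hNy : N = D * hy et Q + hy et Q * D := by
    rw [hNdef, ← h.Dyhy, hDdef]
    have h3 := h.Dxhy
    simp only [add_mul, mul_add, smul_mul_assoc, mul_smul_comm]
    have : (2⁻¹ : k) • (Dx f X * hy et Q) + (2⁻¹ : k) • (hy et Q * Dx f X) = 0 := by
      rw [← smul_add, h3, smul_zero]
    rw [add_add_add_comm, this, zero_add]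
  have hNy' : ∀ v, N v = D (hy et Q v) + hy et Q (D v) := fun v => by rw [hNy]; rfl
  have NT : ∀ p, ∀ v ∈ T p, N v ∈ T p := by
    intro p v hv
    rw [hNy']
    cases p with
    | zero => rw [D0 v hv, map_zero, add_zero]; exact D1 _ _ (hyT _ _ hv)
    | succ p => exact (T (p+1)).add_mem (D1 _ _ (hyT _ _ hv)) (hyT _ _ (D1 _ _ hv))
  set M : ℕ → Submodule k V := fun p => T p ⊓ N.maxGenEigenspace 0 with hMdef
  have hDN : Commute N D := by
    show N * D = D * N
    rw [hNy, add_mul, mul_add, mul_assoc (hy et Q), hDD, mul_zero, add_zero, ← mul_assoc D D, hDD, zero_mul, zero_add,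
      mul_assoc]
  have hhN : Commute N (hx e P) := h.hxNy.symm
  have MD0 : ∀ v ∈ M 0, D v = 0 := fun v hv => D0 v hv.1
  have MD1 : ∀ p, ∀ v ∈ M (p + 1), D v ∈ M p := fun p v hv =>
    ⟨D1 p v hv.1, Module.End.mapsTo_maxGenEigenspace_of_comm hDN 0 hv.2⟩
  have Mhx : ∀ p, ∀ v ∈ M p, ((2⁻¹ : k) • hx e P) v ∈ M (p + 1) := fun p v hv =>
    (M (p+1)).smul_mem _ ⟨hxT p v hv.1, Module.End.mapsTo_maxGenEigenspace_of_comm hhN 0 hv.2⟩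
  set Θ : Module.End k V := (2⁻¹ : k) • (casimir E - (l : k) • ∑ i, E i i) with hΘdef
  have hΘ : Θ = D * ((2⁻¹ : k) • hx e P) + ((2⁻¹ : k) • hx e P) * D := by
    have h3 := h.Dxhx_cas h2
    have h4 := h.Dyhx
    have e1 : D * ((2⁻¹ : k) • hx e P) + ((2⁻¹ : k) • hx e P) * D =
      (2⁻¹ * 2⁻¹ : k) • (Dx f X * hx e P + hx e P * Dx f X) + (2⁻¹ : k) • (Dy ps Y * hx e P + hx e P * Dy ps Y) := by
      rw [hDdef]
      simp only [add_mul, mul_add, smul_mul_assoc, mul_smul_comm, smul_add, smul_smul]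
      abel
    have e2 : (2 : Module.End k V) * (∑ i, ∑ j, Eo e f X P i j * Eo e f X P j i - (l : Module.End k V) * ∑ i, Eo e f X P i i)
        = (2 : k) • (casimir E - (l : k) • ∑ i, E i i) := by
      rw [two_mul, two_smul, casimir]
      have : (l : k) • ∑ i, E i i = (l : Module.End k V) * ∑ i, Eo e f X P i i := by
        rw [← nsmul_eq_mul, Nat.cast_smul_eq_nsmul]
      rw [this]
    rw [e1, h3, h4, smul_zero, add_zero, e2, smul_smul, hΘdef]
    congr 1
    norm_num
  have hΘ' : ∀ v, Θ v = D (((2⁻¹ : k) • hx e P) v) + ((2⁻¹ : k) • hx e P) (D v) := fun v => by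
    conv_lhs => rw [hΘ]
    rfl
  have ΘM : ∀ p, ∀ v ∈ M p, Θ v ∈ M p := by
    intro p v hv
    rw [hΘ']
    cases p with
    | zero => rw [MD0 v hv, map_zero, add_zero]; exact MD1 _ _ (Mhx _ _ hv)
    | succ p => exact (M (p+1)).add_mem (MD1 _ _ (Mhx _ _ hv)) (Mhx _ _ (MD1 _ _ hv))
  have hMfin : ∀ p, FiniteDimensional k (M p) := fun p => (hM p).fin
  -- eigen spaces
  have hΘc : ∀ p, ∀ v ∈ M p, (casimir E - (l * n : k) • 1) v = (2 : k) • Θ v := by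
    intro p v hv
    rw [hΘdef, LinearMap.smul_apply, smul_smul, mul_inv_cancel₀ two_ne_zero, one_smul, LinearMap.sub_apply,
      LinearMap.sub_apply, LinearMap.smul_apply, LinearMap.smul_apply, LinearMap.sum_apply, hdeg p v hv, smul_smul]
    rfl
  have hpow : ∀ p j, ∀ v ∈ M p, ((casimir E - (l * n : k) • 1) ^ j) v = ((2 : k) ^ j) • (Θ ^ j) v := by
    intro p j
    induction j with
    | zero => intro v hv; simp
    | succ j ih =>
      intro v hv
      rw [pow_succ, Module.End.mul_apply, hΘc p v hv, map_smul, ih _ (ΘM p v hv), smul_smul, pow_succ' Θ, pow_succ' (2 : k)]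
      rw [← pow_succ' Θ, pow_succ Θ]; rfl
  have hG : ∀ p, M p ⊓ Θ.maxGenEigenspace 0 = M p ⊓ (casimir E).maxGenEigenspace (l * n : k) := by
    intro p
    ext v
    simp only [Submodule.mem_inf, Module.End.mem_maxGenEigenspace]
    refine and_congr_right fun hv => exists_congr fun j => ?_
    rw [hpow p j v hv, zero_smul, sub_zero, smul_eq_zero, or_iff_right (pow_ne_zero _ two_ne_zero)]
  have hDE : ∀ i j v, D (E i j v) = E i j (D v) := by
    intro i j v
    have : D * E i j = E i j * D := by
      rw [hDdef, add_mul, mul_add, smul_mul_assoc, mul_smul_comm, h.EDx, h.EDy]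
    exact congrArg (fun F : Module.End k V => F v) this
  set G : ℕ → Submodule k V := fun p => M p ⊓ (casimir E).maxGenEigenspace (l * n : k) with hGdef
  have hGm : ∀ p, GlMod E n (G p) := fun p => (hM p).eig _
  have hcasD : Commute (casimir E) D := by
    show casimir E * D = D * casimir E
    have : ∀ i j, E i j * D = D * E i j := fun i j => LinearMap.ext fun v => (hDE i j v).symm
    simp only [casimir, Finset.sum_mul, Finset.mul_sum]
    refine Finset.sum_congr rfl fun i _ => Finset.sum_congr rfl fun j _ => ?_
    rw [mul_assoc, this, ← mul_assoc, this, mul_assoc]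
  have hDG : ∀ p, ∀ v ∈ G (p + 1), D v ∈ G p := fun p v hv =>
    ⟨MD1 p v hv.1, Module.End.mapsTo_maxGenEigenspace_of_comm hcasD _ hv.2⟩
  have hvan : ∀ p, Submodule.map D (G (p + 1)) = ⊥ := by
    intro p
    by_cases hp : n < 2 * (p + 1)
    · have : G (p + 1) = ⊥ := by
        rw [eq_bot_iff, ← hbot _ hp]; exact inf_le_left.trans inf_le_left
      rw [this, Submodule.map_bot]
    · have hle : Submodule.map D (G (p + 1)) ≤ G p := by
        rintro _ ⟨v, hv, rfl⟩; exact hDG p v hv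
      have hN : GlMod E n (Submodule.map D (G (p + 1))) := by
        refine (hGm p).mono hle ?_
        rintro i j _ ⟨v, hv, rfl⟩
        exact ⟨E i j v, (hGm (p+1)).stable i j v hv, hDE i j v⟩
      refine no_common (p := p + 1) (r := n - 2 * (p + 1)) (p' := p) (r' := n - 2 * p) (n := n) (by omega) (by omega) (by omega)
        (hM (p+1)) (hM p) (hchi _ _ (by omega)) (hchi _ _ (by omega)) _ hN ?_ ?_ ?_
      · intro v hv
        exact casNil_eig _ v (hle hv)
      · intro α
        exact wdim_map (hGm (p+1)) D hDE hN α
      · intro α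
        have := (hGm p).finwt α
        exact Submodule.finrank_mono (inf_le_inf_right _ hle)
  have f1 := fit_dim D (hy et Q) N hDD' hNy' (T p) (T (p + 1)) (NT p) (NT (p+1)) (D1 p) (hyT p)
  have f2 := fit_dim D ((2⁻¹ : k) • hx e P) Θ hDD' hΘ' (M p) (M (p + 1)) (ΘM p) (ΘM (p+1)) (MD1 p) (Mhx p)
  rw [hG, hG] at f2
  change _ + Module.finrank k ↥(Submodule.map D (G (p + 1))) = _ + Module.finrank k ↥(LinearMap.ker D ⊓ G p) at f2
  change _ + Module.finrank k ↥(Submodule.map D (M (p + 1))) = _ + Module.finrank k ↥(LinearMap.ker D ⊓ M p) at f1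
  have hker : LinearMap.ker D ⊓ G p = G p := by
    rw [inf_eq_right]
    intro v hv
    rw [LinearMap.mem_ker]
    cases p with
    | zero => exact MD0 v hv.1
    | succ p =>
      have : D v ∈ Submodule.map D (G (p + 1)) := ⟨v, hv, rfl⟩
      rw [hvan] at this
      exact (Submodule.mem_bot k).1 this
  rw [hvan, hker, finrank_bot, finrank_G hn (hM p) (hchi _ _ hn)] at f2
  omega

end Main

section Diag
variable {k : Type} [Field k] {V : Type} [AddCommGroup V] [Module k V] {l : ℕ}
variable {I : Type} [Fintype I]

theorem diag_pow (b : I → V) (A : Module.End k V) (a : I → k) (hA : ∀ s, A (b s) = a s • b s)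
    (μ : k) (c : I → k) (j : ℕ) :
    ((A - μ • 1) ^ j) (∑ s, c s • b s) = ∑ s, (c s * (a s - μ) ^ j) • b s := by
  induction j with
  | zero => simp
  | succ j ih =>
    rw [pow_succ', Module.End.mul_apply, ih, map_sum]
    refine Finset.sum_congr rfl fun s _ => ?_
    rw [map_smul, LinearMap.sub_apply, LinearMap.smul_apply, Module.End.one_apply, hA, ← sub_smul,
      smul_smul]
    ring_nf

theorem diag_pow_eq_zero (b : I → V) (hb : LinearIndependent k b) (A : Module.End k V) (a : I → k)
    (hA : ∀ s, A (b s) = a s • b s)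
    (μ : k) (c : I → k) (j : ℕ) (h : ((A - μ • 1) ^ j) (∑ s, c s • b s) = 0) (s : I)
    (hs : c s ≠ 0) : a s = μ := by
  rw [diag_pow b A a hA] at h
  have := Fintype.linearIndependent_iff.1 hb _ h s
  rcases mul_eq_zero.1 this with h | h
  · exact absurd h hs
  · exact sub_eq_zero.1 (eq_zero_of_pow_eq_zero h)

theorem mem_span_range_sum (b : I → V) {v : V} (hv : v ∈ Submodule.span k (Set.range b)) :
    ∃ c : I → k, v = ∑ s, c s • b s := by
  obtain ⟨c, hc⟩ := (Submodule.mem_span_range_iff_exists_fun k).1 hv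
  exact ⟨c, hc.symm⟩

variable [CharZero k]

theorem diag_wdim (b : I → V) (hb : LinearIndependent k b) (wt : I → Fin l →₀ ℕ) (ν : I → ℕ)
    (E : Fin l → Fin l → Module.End k V) (N : Module.End k V)
    (hE : ∀ i s, E i i (b s) = (wt s i : k) • b s) (hN : ∀ s, N (b s) = (ν s : k) • b s)
    (α : Fin l →₀ ℕ) [DecidableEq I] :
    wdim E (Submodule.span k (Set.range b) ⊓ N.maxGenEigenspace 0) α =
      (Finset.univ.filter fun s => ν s = 0 ∧ wt s = α).card := by
  have : Submodule.span k (Set.range b) ⊓ N.maxGenEigenspace 0 ⊓ wtSp E α =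
      Submodule.span k (Set.range fun s : {s // ν s = 0 ∧ wt s = α} => b s.1) := by
    apply le_antisymm
    · rintro v ⟨⟨hv, hv2⟩, hv3⟩
      obtain ⟨c, rfl⟩ := mem_span_range_sum b hv
      refine Submodule.sum_mem _ fun s _ => ?_
      by_cases hs : c s = 0
      · simp [hs]
      refine Submodule.smul_mem _ _ (Submodule.subset_span ⟨⟨s, ?_, ?_⟩, rfl⟩)
      · obtain ⟨j, hj⟩ := (Module.End.mem_maxGenEigenspace _ _ _).1 hv2
        have := diag_pow_eq_zero b hb N _ hN 0 c j hj s hs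
        exact_mod_cast this
      · ext i
        have h1 := mem_wtSp.1 hv3 i
        have := diag_pow_eq_zero b hb (E i i) _ (hE i) (α i : k) c 1 (by
          rw [pow_one, LinearMap.sub_apply, h1, LinearMap.smul_apply, Module.End.one_apply, sub_self]) s hs
        exact_mod_cast this
    · rw [Submodule.span_le]
      rintro _ ⟨⟨s, h1, h2⟩, rfl⟩
      refine ⟨⟨Submodule.subset_span ⟨s, rfl⟩, ?_⟩, ?_⟩
      · refine (Module.End.mem_maxGenEigenspace _ _ _).2 ⟨1, ?_⟩
        simp [hN, h1]
      · rw [SetLike.mem_coe, mem_wtSp]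
        intro i
        subst h2
        exact hE i s
  rw [wdim, this]
  refine (finrank_span_eq_card (hb.comp (Subtype.val : {s // ν s = 0 ∧ wt s = α} → I) Subtype.val_injective)).trans ?_
  rw [Fintype.card_subtype]

theorem diag_GlMod (b : I → V) (hb : LinearIndependent k b) (wt : I → Fin l →₀ ℕ) (ν : I → ℕ)
    (E : Fin l → Fin l → Module.End k V) (N : Module.End k V)
    (hE : ∀ i s, E i i (b s) = (wt s i : k) • b s) (hN : ∀ s, N (b s) = (ν s : k) • b s)
    (hrel : GlRel E) (hcomm : ∀ i j, E i j * N = N * E i j) (n : ℕ)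
    (hT : ∀ i j, ∀ v ∈ Submodule.span k (Set.range b), E i j v ∈ Submodule.span k (Set.range b))
    (hn : ∀ s, ν s = 0 → ∑ i, wt s i = n) :
    GlMod E n (Submodule.span k (Set.range b) ⊓ N.maxGenEigenspace 0) where
  rel := hrel
  fin := by
    have : FiniteDimensional k (Submodule.span k (Set.range b)) :=
      FiniteDimensional.span_of_finite k (Set.finite_range b)
    exact Submodule.finiteDimensional_of_le inf_le_left
  stable := by
    rintro i j v ⟨h1, h2⟩
    refine ⟨hT i j v h1, ?_⟩
    exact Module.End.mapsTo_maxGenEigenspace_of_comm (hcomm i j).symm 0 h2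
  wts := by
    rintro v ⟨hv, hv2⟩ hne χ hχ
    obtain ⟨c, rfl⟩ := mem_span_range_sum b hv
    obtain ⟨s, hs⟩ : ∃ s, c s ≠ 0 := by
      by_contra! h
      exact hne (by simp [h])
    refine ⟨wt s, hn s ?_, fun i => ?_⟩
    · obtain ⟨j, hj⟩ := (Module.End.mem_maxGenEigenspace _ _ _).1 hv2
      have := diag_pow_eq_zero b hb N _ hN 0 c j hj s hs
      exact_mod_cast this
    · exact (diag_pow_eq_zero b hb (E i i) _ (hE i) (χ i) c 1 (by
          rw [pow_one, LinearMap.sub_apply, hχ, LinearMap.smul_apply, Module.End.one_apply, sub_self]) s hs).symm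
  ss := by
    rintro v ⟨hv, hv2⟩ i μ h
    obtain ⟨c, rfl⟩ := mem_span_range_sum b hv
    have h1 := diag_pow b (E i i) _ (hE i) μ c 1
    rw [pow_one] at h1
    rw [h1]
    refine Finset.sum_eq_zero fun s _ => ?_
    by_cases hs : c s = 0
    · simp [hs]
    · rw [diag_pow_eq_zero b hb (E i i) _ (hE i) μ c 2 (by rw [pow_two]; exact h) s hs]
      simp

theorem diag_deg (b : I → V) (hb : LinearIndependent k b) (wt : I → Fin l →₀ ℕ) (ν : I → ℕ)
    (E : Fin l → Fin l → Module.End k V) (N : Module.End k V)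
    (hE : ∀ i s, E i i (b s) = (wt s i : k) • b s) (hN : ∀ s, N (b s) = (ν s : k) • b s)
    (n : ℕ) (hn : ∀ s, ν s = 0 → ∑ i, wt s i = n) (v : V)
    (hv : v ∈ Submodule.span k (Set.range b) ⊓ N.maxGenEigenspace 0) :
    ∑ i, E i i v = (n : k) • v := by
  obtain ⟨hv, hv2⟩ := hv
  obtain ⟨c, rfl⟩ := mem_span_range_sum b hv
  simp only [map_sum, map_smul, hE]
  rw [Finset.sum_comm, Finset.smul_sum]
  refine Finset.sum_congr rfl fun s _ => ?_
  by_cases hs : c s = 0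
  · simp [hs]
  obtain ⟨j, hj⟩ := (Module.End.mem_maxGenEigenspace _ _ _).1 hv2
  have h1 := diag_pow_eq_zero b hb N _ hN 0 c j hj s hs
  rw [← hn s (by exact_mod_cast h1), ← Finset.smul_sum, ← Finset.sum_smul, Nat.cast_sum, smul_comm]

theorem diag_chi (b : I → V) (hb : LinearIndependent k b) (wt : I → Fin l →₀ ℕ) (ν : I → ℕ)
    (E : Fin l → Fin l → Module.End k V) (N : Module.End k V)
    (hE : ∀ i s, E i i (b s) = (wt s i : k) • b s) (hN : ∀ s, N (b s) = (ν s : k) • b s)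
    (n : ℕ) (hM : GlMod E n (Submodule.span k (Set.range b) ⊓ N.maxGenEigenspace 0)) :
    chi E n (Submodule.span k (Set.range b) ⊓ N.maxGenEigenspace 0) =
      ∑ s, if ν s = 0 then monomial (wt s) (1 : k) else 0 := by
  classical
  ext α
  rw [hM.coeff_chi, diag_wdim b hb wt ν E N hE hN, coeff_sum, Finset.card_filter, Nat.cast_sum]
  refine Finset.sum_congr rfl fun s _ => ?_
  by_cases h1 : ν s = 0 <;> by_cases h2 : wt s = α <;> simp [h1, h2, coeff_monomial]

end Diag

section Ops
variable {k : Type} [Field k] {W : Type} [AddCommGroup W] [Module k W] {l m : ℕ}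
variable {A : Type} [AddCommGroup A] [Module k A]

/-- coordinate vectors and dual functionals on the space of linear forms -/
structure WD (xx : Fin l → Fin l → W) (yy : Fin m → W) (th : Fin l → Fin l → Module.Dual k W)
    (ps : Fin m → Module.Dual k W) : Prop where
  xs : ∀ i j, xx i j = xx j i
  ts : ∀ i j, th i j = th j i
  tx : ∀ i j a b, th i j (xx a b) = dl k i a * dl k j b + dl k i b * dl k j a
  ty : ∀ i j a, th i j (yy a) = 0
  px : ∀ a i j, ps a (xx i j) = 0
  py : ∀ a b, ps a (yy b) = dl k a b

/-- exterior multiplication -/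
noncomputable def eOp (k : Type) [Field k] {W : Type} [AddCommGroup W] [Module k W] (w : W) :
    Module.End k (ExteriorAlgebra k W) := LinearMap.mulLeft k (ExteriorAlgebra.ι k w)

/-- contraction -/
noncomputable def cOp (k : Type) [Field k] {W : Type} [AddCommGroup W] [Module k W]
    (d : Module.Dual k W) :
    Module.End k (ExteriorAlgebra k W) := CliffordAlgebra.contractLeft (Q := (0 : QuadraticForm k W)) d

theorem eOp_apply (w : W) (x : ExteriorAlgebra k W) : eOp k w x = ExteriorAlgebra.ι k w * x := rfl

theorem cOp_ι_mul (d : Module.Dual k W) (w : W) (x : ExteriorAlgebra k W) :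
    cOp k d (ExteriorAlgebra.ι k w * x) = d w • x - ExteriorAlgebra.ι k w * cOp k d x :=
  CliffordAlgebra.contractLeft_ι_mul (Q := (0 : QuadraticForm k W)) d w x

theorem cOp_one (d : Module.Dual k W) : cOp k d (1 : ExteriorAlgebra k W) = 0 :=
  CliffordAlgebra.contractLeft_one (Q := (0 : QuadraticForm k W)) d

theorem cOp_eOp (d : Module.Dual k W) (w : W) : cOp k d * eOp k w = d w • 1 - eOp k w * cOp k d := by
  apply LinearMap.ext; intro x
  simp only [Module.End.mul_apply, eOp_apply, cOp_ι_mul, LinearMap.sub_apply, LinearMap.smul_apply,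
    Module.End.one_apply]

theorem eOp_eOp (w v : W) : eOp k w * eOp k v = -(eOp k v * eOp k w) := by
  apply LinearMap.ext; intro x
  simp only [Module.End.mul_apply, eOp_apply, LinearMap.neg_apply, ← mul_assoc]
  rw [eq_neg_iff_add_eq_zero, ← add_mul, ExteriorAlgebra.ι_add_mul_swap, zero_mul]

theorem cOp_cOp (d d' : Module.Dual k W) : cOp k d * cOp k d' = -(cOp k d' * cOp k d) := by
  apply LinearMap.ext; intro x
  exact CliffordAlgebra.contractLeft_comm (Q := (0 : QuadraticForm k W)) d d' x

/-- act on left factor -/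
noncomputable abbrev oL (A : Type) [AddCommGroup A] [Module k A] (a : Module.End k (ExteriorAlgebra k W)) :
    Module.End k (TensorProduct k (ExteriorAlgebra k W) A) :=
  Module.End.rTensorAlgHom k (ExteriorAlgebra k W) A a

/-- act on right factor -/
noncomputable abbrev oR (W : Type) [AddCommGroup W] [Module k W] (a : Module.End k A) :
    Module.End k (TensorProduct k (ExteriorAlgebra k W) A) :=
  Module.End.lTensorAlgHom k A (ExteriorAlgebra k W) a

theorem oL_tmul (a : Module.End k (ExteriorAlgebra k W)) (x : ExteriorAlgebra k W) (g : A) :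
    oL A a (TensorProduct.tmul k x g) = TensorProduct.tmul k (a x) g := rfl
theorem oR_tmul (a : Module.End k A) (x : ExteriorAlgebra k W) (g : A) :
    oR W a (TensorProduct.tmul k x g) = TensorProduct.tmul k x (a g) := rfl

theorem oR_oL (a : Module.End k (ExteriorAlgebra k W)) (b : Module.End k A) :
    oR W b * oL A a = oL A a * oR W b := by
  apply TensorProduct.ext'
  intro x g
  rfl

end Ops

section Ops2
variable {k : Type} [Field k] {W : Type} [AddCommGroup W] [Module k W] {l m : ℕ}

/-- multiplication by a variable -/
noncomputable def vX (k : Type) [Field k] {σ : Type} (i : σ) : Module.End k (MvPolynomial σ k) :=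
  LinearMap.mulLeft k (X i)
/-- derivation -/
noncomputable def vP (k : Type) [Field k] {σ : Type} (i : σ) : Module.End k (MvPolynomial σ k) :=
  (pderiv i).toLinearMap

theorem vX_apply {σ : Type} (i : σ) (g : MvPolynomial σ k) : vX k i g = X i * g := rfl
theorem vP_apply {σ : Type} (i : σ) (g : MvPolynomial σ k) : vP k i g = pderiv i g := rfl

theorem vX_vX {σ : Type} (i j : σ) : vX k i * vX k j = vX k j * vX k i := by
  apply LinearMap.ext; intro g
  simp only [Module.End.mul_apply, vX_apply]; ring

theorem pderiv_comm' {σ : Type} (i j : σ) (g : MvPolynomial σ k) :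
    pderiv i (pderiv j g) = pderiv j (pderiv i g) := by
  classical
  have : ⁅(pderiv i : Derivation k (MvPolynomial σ k) (MvPolynomial σ k)), (pderiv j : Derivation k (MvPolynomial σ k) (MvPolynomial σ k))⁆ = 0 := by
    apply MvPolynomial.derivation_ext
    intro a
    rw [Derivation.commutator_apply, pderiv_X, pderiv_X]
    simp [Pi.single_apply, apply_ite]
  have h := congrArg (fun D => D g) this
  simp only [Derivation.commutator_apply, Derivation.zero_apply] at h
  exact sub_eq_zero.1 h

theorem vP_vP {σ : Type} (i j : σ) : vP k i * vP k j = vP k j * vP k i := by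
  apply LinearMap.ext; intro g
  exact pderiv_comm' i j g

theorem vP_vX {σ : Type} [DecidableEq σ] (i j : σ) :
    vP k i * vX k j = vX k j * vP k i + if i = j then 1 else 0 := by
  apply LinearMap.ext; intro g
  rw [LinearMap.add_apply]
  simp only [Module.End.mul_apply, vX_apply, vP_apply]
  rw [Derivation.leibniz, pderiv_X, Pi.single_apply]
  simp only [@eq_comm _ j i]
  split_ifs <;> simp

theorem vP_vX_ne {σ : Type} {i j : σ} (h : i ≠ j) : vP k i * vX k j = vX k j * vP k i := by
  classical
  rw [vP_vX, if_neg h, add_zero]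

theorem CC_ops {xx : Fin l → Fin l → W} {yy : Fin m → W} {th : Fin l → Fin l → Module.Dual k W}
    {ps : Fin m → Module.Dual k W} (h : WD xx yy th ps) :
    CC (R := Module.End k (TensorProduct k (ExteriorAlgebra k W) (MvPolynomial (Fin l ⊕ Fin m) k)))
      (fun i j => oL _ (eOp k (xx i j))) (fun i j => oL _ (cOp k (th i j)))
      (fun i => oR _ (vX k (Sum.inl i))) (fun i => oR _ (vP k (Sum.inl i)))
      (fun a => oL _ (eOp k (yy a))) (fun a => oL _ (cOp k (ps a)))
      (fun a => oR _ (vX k (Sum.inr a))) (fun a => oR _ (vP k (Sum.inr a))) where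
  es i j := by simp only [h.xs i j]
  fs i j := by simp only [h.ts i j]
  ee i j a b := by simp only [← map_mul, ← map_neg]; rw [eOp_eOp]
  ff i j a b := by simp only [← map_mul, ← map_neg]; rw [cOp_cOp]
  fe i j a b := by
    simp only [← map_mul]; rw [cOp_eOp, h.tx, map_sub, map_smul, map_one]
    congr 1
    unfold dl
    split_ifs <;> simp [add_smul]
  XX i j := by simp only [← map_mul]; rw [vX_vX]
  PP i j := by simp only [← map_mul]; rw [vP_vP]
  PX i j := by
    simp only [← map_mul]; rw [vP_vX, map_add]
    congr 1
    unfold dl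
    simp only [Sum.inl.injEq]
    split_ifs <;> simp
  Xe i a b := oR_oL _ _
  Xf i a b := oR_oL _ _
  Pe i a b := oR_oL _ _
  Pf i a b := oR_oL _ _
  pp a b := by simp only [← map_mul, ← map_neg]; rw [cOp_cOp]
  pn a b := by
    simp only [← map_mul]; rw [cOp_eOp, h.py, map_sub, map_smul, map_one]
    congr 1
    unfold dl
    split_ifs <;> simp
  YY a b := by simp only [← map_mul]; rw [vX_vX]
  QY i j := by
    simp only [← map_mul]; rw [vP_vX, map_add]
    congr 1
    unfold dl
    simp only [Sum.inr.injEq]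
    split_ifs <;> simp
  Yp a b := oR_oL _ _
  Yn a b := oR_oL _ _
  Qp a b := oR_oL _ _
  Qn a b := oR_oL _ _
  XY i a := by simp only [← map_mul]; rw [vX_vX]
  XQ i a := by simp only [← map_mul]; rw [vP_vX_ne (by simp)]
  Xn i a := oR_oL _ _
  Xp i a := oR_oL _ _
  PY i a := by simp only [← map_mul]; rw [vP_vX_ne (by simp)]
  PQ i a := by simp only [← map_mul]; rw [vP_vP]
  Pn i a := oR_oL _ _
  Pp i a := oR_oL _ _
  eY i j a := (oR_oL _ _).symm
  eQ i j a := (oR_oL _ _).symm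
  en i j a := by simp only [← map_mul, ← map_neg]; rw [eOp_eOp]
  ep i j a := by
    simp only [← map_mul, ← map_neg]; rw [cOp_eOp, h.px, zero_smul, zero_sub, neg_neg]
  fY i j a := (oR_oL _ _).symm
  fQ i j a := (oR_oL _ _).symm
  fn i j a := by
    simp only [← map_mul, ← map_neg]; rw [cOp_eOp, h.ty, zero_smul, zero_sub]
  fp i j a := by simp only [← map_mul, ← map_neg]; rw [cOp_cOp]

end Ops2

section Concrete
variable {k : Type} [Field k] {l m : ℕ}

theorem wps_inl (i : Fin l) : wps l m (Sum.inl i) = 1 := rfl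
theorem wps_inr (a : Fin m) : wps l m (Sum.inr a) = 2 := rfl
theorem wps_pos (s : Fin l ⊕ Fin m) : 0 < wps l m s := by
  rcases s with i | a <;> simp [wps]

theorem mem_wPart {q : ℕ} {g : MvPolynomial (Fin l ⊕ Fin m) k} :
    g ∈ wPart k l m q ↔ IsWeightedHomogeneous (wps l m) g q :=
  mem_weightedHomogeneousSubmodule _ _ _ _

theorem whom_zero {g : MvPolynomial (Fin l ⊕ Fin m) k} (h : IsWeightedHomogeneous (wps l m) g 0) :
    g = C (coeff 0 g) := by
  classical
  ext d
  rw [coeff_C]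
  split_ifs with hd
  · rw [hd]
  · by_contra hne
    have h1 := h hne
    apply hd
    rw [Finsupp.weight_apply, Finsupp.sum_fintype _ _ (by simp)] at h1
    ext s
    have := (Finset.sum_eq_zero_iff.1 h1) s (Finset.mem_univ _)
    simp only [smul_eq_mul, mul_eq_zero] at this
    have hp := wps_pos s
    simp only [Finsupp.coe_zero, Pi.zero_apply]
    omega

theorem pderiv_whom {g : MvPolynomial (Fin l ⊕ Fin m) k} {q : ℕ}
    (h : IsWeightedHomogeneous (wps l m) g q) (s : Fin l ⊕ Fin m) (hq : q < wps l m s) :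
    pderiv s g = 0 := by
  classical
  ext d
  rw [coeff_zero, coeff_pderiv]
  by_contra hne
  have h1 := h (left_ne_zero_of_mul hne)
  rw [map_add, Finsupp.weight_single] at h1
  simp only [smul_eq_mul, one_mul] at h1
  omega

/-- quadratic coordinate vector -/
noncomputable def xxv (k : Type) [Field k] (l m : ℕ) (i j : Fin l) : wPart k l m 2 :=
  ⟨X (Sum.inl i) * X (Sum.inl j), mem_wPart.2
    ((isWeightedHomogeneous_X k (wps l m) (Sum.inl i)).mul
      (isWeightedHomogeneous_X k (wps l m) (Sum.inl j)))⟩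

/-- linear coordinate vector -/
noncomputable def yyv (k : Type) [Field k] (l m : ℕ) (a : Fin m) : wPart k l m 2 :=
  ⟨X (Sum.inr a), mem_wPart.2 (isWeightedHomogeneous_X k (wps l m) (Sum.inr a))⟩

/-- dual functional -/
noncomputable def thv (k : Type) [Field k] (l m : ℕ) (i j : Fin l) : Module.Dual k (wPart k l m 2) :=
  lcoeff k 0 ∘ₗ vP k (Sum.inl i) ∘ₗ vP k (Sum.inl j) ∘ₗ (wPart k l m 2).subtype

/-- dual functional -/
noncomputable def psv (k : Type) [Field k] (l m : ℕ) (a : Fin m) : Module.Dual k (wPart k l m 2) :=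
  lcoeff k 0 ∘ₗ vP k (Sum.inr a) ∘ₗ (wPart k l m 2).subtype

theorem thv_apply (i j : Fin l) (w : wPart k l m 2) :
    thv k l m i j w = coeff 0 (pderiv (Sum.inl i) (pderiv (Sum.inl j) w.1)) := rfl
theorem psv_apply (a : Fin m) (w : wPart k l m 2) :
    psv k l m a w = coeff 0 (pderiv (Sum.inr a) w.1) := rfl

theorem pd_inl (i a : Fin l) : pderiv (Sum.inl i) (X (Sum.inl a) : MvPolynomial (Fin l ⊕ Fin m) k) =
    C (dl k i a) := by
  rw [pderiv_X, Pi.single_apply, dl]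
  simp only [Sum.inl.injEq, @eq_comm _ a i]
  split_ifs <;> simp

theorem WD_conc : WD (xxv k l m) (yyv k l m) (thv k l m) (psv k l m) where
  xs i j := Subtype.ext (mul_comm _ _)
  ts i j := LinearMap.ext fun w => by rw [thv_apply, thv_apply, pderiv_comm']
  tx i j a b := by
    rw [thv_apply]
    simp only [xxv, Derivation.leibniz, pd_inl, map_add, smul_eq_mul, pderiv_C, mul_zero, zero_add,
      ← C_mul, coeff_add, coeff_C]
    simp only [if_true]
    ring
  ty i j a := by
    rw [thv_apply]
    simp [yyv, pderiv_X]
  px a i j := by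
    rw [psv_apply]
    simp [xxv, Derivation.leibniz, pderiv_X]
  py a b := by
    rw [psv_apply]
    simp only [yyv, pderiv_X, Pi.single_apply, Sum.inr.injEq, dl]
    by_cases h : a = b
    · simp [h]
    · simp [h, Ne.symm h]

theorem key_W [CharZero k] (w : wPart k l m 2) :
    (w.1 : MvPolynomial (Fin l ⊕ Fin m) k) = (2⁻¹ : k) • (∑ i, ∑ j, thv k l m i j w • (X (Sum.inl i) * X (Sum.inl j))) +
      ∑ a, psv k l m a w • X (Sum.inr a) := by
  have hw := mem_wPart.1 w.2
  have e1 := hw.sum_weight_X_mul_pderiv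
  rw [Fintype.sum_sum_type] at e1
  simp only [wps_inl, wps_inr, one_smul] at e1
  have e2 : ∀ a, pderiv (Sum.inr a) w.1 = C (psv k l m a w) := fun a =>
    whom_zero (hw.pderiv (n' := 0) (by simp [wps_inr]))
  have e3 : ∀ i, pderiv (Sum.inl i) w.1 = ∑ j, thv k l m i j w • X (Sum.inl j) := fun i => by
    have h1 : IsWeightedHomogeneous (wps l m) (pderiv (Sum.inl i) w.1) 1 :=
      hw.pderiv (n' := 1) (by simp [wps_inl])
    have e4 := h1.sum_weight_X_mul_pderiv
    rw [Fintype.sum_sum_type] at e4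
    simp only [wps_inl, wps_inr, one_smul] at e4
    rw [← e4]
    have e5 : ∀ a, pderiv (Sum.inr a) (pderiv (Sum.inl i) w.1) = 0 := fun a => by
      rw [pderiv_comm', e2, pderiv_C]
    simp only [e5, mul_zero, smul_zero, Finset.sum_const_zero, add_zero]
    refine Finset.sum_congr rfl fun j _ => ?_
    have h2 : IsWeightedHomogeneous (wps l m) (pderiv (Sum.inl j) (pderiv (Sum.inl i) w.1)) 0 :=
      h1.pderiv (n' := 0) (by simp [wps_inl])
    rw [whom_zero h2, WD_conc.ts i j, thv_apply, smul_eq_C_mul, mul_comm]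
  have e6 : (2 : k) • w.1 = ∑ i, ∑ j, thv k l m i j w • (X (Sum.inl i) * X (Sum.inl j)) +
      (2 : k) • ∑ a, psv k l m a w • X (Sum.inr a) := by
    have : (2 : k) • w.1 = 2 • w.1 := by rw [ofNat_smul_eq_nsmul]
    rw [this, ← e1, Finset.smul_sum]
    congr 1
    · refine Finset.sum_congr rfl fun i _ => ?_
      rw [e3, Finset.mul_sum]
      refine Finset.sum_congr rfl fun j _ => ?_
      rw [mul_smul_comm]
    · refine Finset.sum_congr rfl fun a _ => ?_
      rw [e2, smul_eq_C_mul (X (Sum.inr a)), mul_comm, ofNat_smul_eq_nsmul k 2]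
  have h2 : (2 : k) ≠ 0 := two_ne_zero
  calc w.1 = (2⁻¹ : k) • ((2 : k) • w.1) := by rw [smul_smul, inv_mul_cancel₀ h2, one_smul]
    _ = _ := by rw [e6, smul_add, smul_smul (2⁻¹ : k) 2, inv_mul_cancel₀ h2, one_smul]

end Concrete

section Koszul
variable {k : Type} [Field k] {l m : ℕ}

/-- ambient space -/
abbrev VV (k : Type) [Field k] (l m : ℕ) : Type :=
  TensorProduct k (ExteriorAlgebra k (wPart k l m 2)) (MvPolynomial (Fin l ⊕ Fin m) k)

noncomputable def op_e (k : Type) [Field k] (l m : ℕ) (i j : Fin l) : Module.End k (VV k l m) :=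
  oL _ (eOp k (xxv k l m i j))
noncomputable def op_f (k : Type) [Field k] (l m : ℕ) (i j : Fin l) : Module.End k (VV k l m) :=
  oL _ (cOp k (thv k l m i j))
noncomputable def op_X (k : Type) [Field k] (l m : ℕ) (i : Fin l) : Module.End k (VV k l m) :=
  oR _ (vX k (Sum.inl i))
noncomputable def op_P (k : Type) [Field k] (l m : ℕ) (i : Fin l) : Module.End k (VV k l m) :=
  oR _ (vP k (Sum.inl i))
noncomputable def op_n (k : Type) [Field k] (l m : ℕ) (a : Fin m) : Module.End k (VV k l m) :=
  oL _ (eOp k (yyv k l m a))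
noncomputable def op_p (k : Type) [Field k] (l m : ℕ) (a : Fin m) : Module.End k (VV k l m) :=
  oL _ (cOp k (psv k l m a))
noncomputable def op_Y (k : Type) [Field k] (l m : ℕ) (a : Fin m) : Module.End k (VV k l m) :=
  oR _ (vX k (Sum.inr a))
noncomputable def op_Q (k : Type) [Field k] (l m : ℕ) (a : Fin m) : Module.End k (VV k l m) :=
  oR _ (vP k (Sum.inr a))

theorem CC_conc : CC (op_e k l m) (op_f k l m) (op_X k l m) (op_P k l m) (op_n k l m) (op_p k l m)
    (op_Y k l m) (op_Q k l m) := CC_ops WD_conc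

open TensorProduct

section tm
variable (x : ExteriorAlgebra k (wPart k l m 2)) (g : MvPolynomial (Fin l ⊕ Fin m) k)
theorem op_e_tmul (i j : Fin l) : op_e k l m i j (x ⊗ₜ g) = (ExteriorAlgebra.ι k (xxv k l m i j) * x) ⊗ₜ g := rfl
theorem op_f_tmul (i j : Fin l) : op_f k l m i j (x ⊗ₜ g) = (cOp k (thv k l m i j) x) ⊗ₜ g := rfl
theorem op_n_tmul (a : Fin m) : op_n k l m a (x ⊗ₜ g) = (ExteriorAlgebra.ι k (yyv k l m a) * x) ⊗ₜ g := rfl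
theorem op_p_tmul (a : Fin m) : op_p k l m a (x ⊗ₜ g) = (cOp k (psv k l m a) x) ⊗ₜ g := rfl
theorem op_X_tmul (i : Fin l) : op_X k l m i (x ⊗ₜ g) = x ⊗ₜ (X (Sum.inl i) * g) := rfl
theorem op_Y_tmul (i : Fin m) : op_Y k l m i (x ⊗ₜ g) = x ⊗ₜ (X (Sum.inr i) * g) := rfl
theorem op_P_tmul (i : Fin l) : op_P k l m i (x ⊗ₜ g) = x ⊗ₜ (pderiv (Sum.inl i) g) := rfl
theorem op_Q_tmul (i : Fin m) : op_Q k l m i (x ⊗ₜ g) = x ⊗ₜ (pderiv (Sum.inr i) g) := rfl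
end tm

/-- Koszul differential -/
noncomputable def DD (k : Type) [Field k] (l m : ℕ) : Module.End k (VV k l m) :=
  (2⁻¹ : k) • Dx (op_f k l m) (op_X k l m) + Dy (op_p k l m) (op_Y k l m)

theorem DD_tmul (x : ExteriorAlgebra k (wPart k l m 2)) (g : MvPolynomial (Fin l ⊕ Fin m) k) :
    DD k l m (x ⊗ₜ g) = (2⁻¹ : k) • (∑ i, ∑ j, (cOp k (thv k l m i j) x) ⊗ₜ[k] (X (Sum.inl i) * X (Sum.inl j) * g))
      + ∑ a, (cOp k (psv k l m a) x) ⊗ₜ[k] (X (Sum.inr a) * g) := by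
  simp only [DD, Dx, Dy, LinearMap.add_apply, LinearMap.smul_apply, LinearMap.sum_apply,
    Module.End.mul_apply, op_f_tmul, op_X_tmul, op_p_tmul, op_Y_tmul, mul_assoc]

theorem DD_one (g : MvPolynomial (Fin l ⊕ Fin m) k) : DD k l m (1 ⊗ₜ g) = 0 := by
  simp only [DD_tmul, cOp_one, zero_tmul, Finset.sum_const_zero, smul_zero, add_zero]

theorem DD_ι_mul [CharZero k] (w : wPart k l m 2) (x : ExteriorAlgebra k (wPart k l m 2))
    (g : MvPolynomial (Fin l ⊕ Fin m) k) :
    DD k l m ((ExteriorAlgebra.ι k w * x) ⊗ₜ g) = x ⊗ₜ (w.1 * g) - oL _ (eOp k w) (DD k l m (x ⊗ₜ g)) := by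
  conv_rhs => rw [key_W w]
  rw [DD_tmul, DD_tmul]
  simp only [cOp_ι_mul, sub_tmul, Finset.sum_sub_distrib, map_add, map_smul, map_sum, oL_tmul, eOp_apply,
    add_mul, tmul_add, smul_tmul, smul_mul_assoc, tmul_smul, Finset.sum_mul, tmul_sum, smul_sub]
  abel

theorem DD_ιMulti [CharZero k] (p : ℕ) (v : Fin (p + 1) → wPart k l m 2)
    (g : MvPolynomial (Fin l ⊕ Fin m) k) :
    DD k l m ((ExteriorAlgebra.ιMulti k (p + 1) v) ⊗ₜ g) =
      ∑ i : Fin (p + 1), ((-1 : k) ^ (i : ℕ)) •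
        (ExteriorAlgebra.ιMulti k p (fun j => v (i.succAbove j))) ⊗ₜ[k] ((v i).1 * g) := by
  induction p with
  | zero =>
    rw [ExteriorAlgebra.ιMulti_succ_apply, DD_ι_mul, ExteriorAlgebra.ιMulti_zero_apply, DD_one]
    simp
  | succ p ih =>
    rw [ExteriorAlgebra.ιMulti_succ_apply, DD_ι_mul, ih]
    conv_rhs => rw [Fin.sum_univ_succ]
    simp only [map_sum, map_smul, oL_tmul, eOp_apply, Fin.val_zero, pow_zero, one_smul]
    rw [sub_eq_add_neg, ← Finset.sum_neg_distrib]
    congr 1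
    refine Finset.sum_congr rfl fun i _ => ?_
    rw [ExteriorAlgebra.ιMulti_succ_apply, Fin.val_succ, pow_succ, mul_neg_one]
    refine (neg_smul (R := k) (M := VV k l m) ((-1 : k) ^ (i : ℕ)) _).symm.trans ?_
    simp only [Matrix.vecTail, Function.comp_def, Fin.succ_succAbove_zero, Fin.succ_succAbove_succ]

end Koszul

section Stab
variable {k : Type} [Field k] {l m : ℕ}
open TensorProduct

theorem ep_succ {W : Type} [AddCommGroup W] [Module k W] (p : ℕ) :
    (⋀[k]^(p+1) W : Submodule k (ExteriorAlgebra k W)) = LinearMap.range (ExteriorAlgebra.ι k (M := W)) * (⋀[k]^p W) :=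
  pow_succ' _ _

theorem ep_ι_mul {W : Type} [AddCommGroup W] [Module k W] {p : ℕ} (w : W) {x : ExteriorAlgebra k W}
    (hx : x ∈ (⋀[k]^p W : Submodule k (ExteriorAlgebra k W))) :
    ExteriorAlgebra.ι k w * x ∈ (⋀[k]^(p+1) W : Submodule k (ExteriorAlgebra k W)) := by
  rw [ep_succ]
  exact Submodule.mul_mem_mul ⟨w, rfl⟩ hx

theorem cOp_ep_zero {W : Type} [AddCommGroup W] [Module k W] (d : Module.Dual k W) {x : ExteriorAlgebra k W}
    (hx : x ∈ (⋀[k]^0 W : Submodule k (ExteriorAlgebra k W))) : cOp k d x = 0 := by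
  have : x ∈ (1 : Submodule k (ExteriorAlgebra k W)) := by
    rw [← pow_zero (LinearMap.range (ExteriorAlgebra.ι k (M := W)))]; exact hx
  obtain ⟨c, rfl⟩ := Submodule.mem_one.1 this
  rw [Algebra.algebraMap_eq_smul_one, map_smul, cOp_one, smul_zero]

theorem cOp_ep {W : Type} [AddCommGroup W] [Module k W] (d : Module.Dual k W) (p : ℕ) {x : ExteriorAlgebra k W}
    (hx : x ∈ (⋀[k]^(p+1) W : Submodule k (ExteriorAlgebra k W))) :
    cOp k d x ∈ (⋀[k]^p W : Submodule k (ExteriorAlgebra k W)) := by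
  induction p generalizing x with
  | zero =>
    rw [ep_succ] at hx
    refine Submodule.mul_induction_on hx ?_ ?_
    · rintro _ ⟨w, rfl⟩ y hy
      rw [cOp_ι_mul, cOp_ep_zero d hy, mul_zero, sub_zero]
      exact Submodule.smul_mem _ _ hy
    · intro y z hy hz
      rw [map_add]
      exact Submodule.add_mem _ hy hz
  | succ p ih =>
    rw [ep_succ] at hx
    refine Submodule.mul_induction_on hx ?_ ?_
    · rintro _ ⟨w, rfl⟩ y hy
      rw [cOp_ι_mul]
      exact Submodule.sub_mem _ (Submodule.smul_mem _ _ hy) (ep_ι_mul w (ih hy))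
    · intro y z hy hz
      rw [map_add]
      exact Submodule.add_mem _ hy hz

/-- the graded pieces of the Koszul complex of total degree `n` -/
noncomputable def TT (k : Type) [Field k] (l m n p : ℕ) : Submodule k (VV k l m) :=
  Submodule.span k {z | ∃ x ∈ (⋀[k]^p (wPart k l m 2) : Submodule k (ExteriorAlgebra k (wPart k l m 2))),
    ∃ r : ℕ, ∃ g ∈ wPart k l m r, 2 * p + r = n ∧ z = x ⊗ₜ g}

theorem TT_mem {n p r : ℕ} {x : ExteriorAlgebra k (wPart k l m 2)}
    (hx : x ∈ (⋀[k]^p (wPart k l m 2) : Submodule k (ExteriorAlgebra k (wPart k l m 2))))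
    {g : MvPolynomial (Fin l ⊕ Fin m) k} (hg : g ∈ wPart k l m r) (h : 2 * p + r = n) :
    (x ⊗ₜ g : VV k l m) ∈ TT k l m n p := Submodule.subset_span ⟨x, hx, r, g, hg, h, rfl⟩

theorem TT_le {n p : ℕ} (L : Module.End k (VV k l m)) (S : Submodule k (VV k l m))
    (h : ∀ x ∈ (⋀[k]^p (wPart k l m 2) : Submodule k (ExteriorAlgebra k (wPart k l m 2))),
      ∀ r, ∀ g ∈ wPart k l m r, 2 * p + r = n → L (x ⊗ₜ g) ∈ S) :
    ∀ v ∈ TT k l m n p, L v ∈ S := by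
  intro v hv
  have : TT k l m n p ≤ S.comap L := by
    rw [TT, Submodule.span_le]
    rintro _ ⟨x, hx, r, g, hg, hr, rfl⟩
    exact h x hx r g hg hr
  exact this hv

theorem TT_bot {n p : ℕ} (h : n < 2 * p) : TT k l m n p = ⊥ := by
  rw [TT, Submodule.span_eq_bot]
  rintro _ ⟨x, hx, r, g, hg, hr, rfl⟩
  omega

theorem X_wPart (s : Fin l ⊕ Fin m) {r r' : ℕ} {g : MvPolynomial (Fin l ⊕ Fin m) k} (hg : g ∈ wPart k l m r)
    (h : r' = wps l m s + r) : X s * g ∈ wPart k l m r' := by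
  subst h
  exact mem_wPart.2 ((isWeightedHomogeneous_X k (wps l m) s).mul (mem_wPart.1 hg))

theorem P_wPart (s : Fin l ⊕ Fin m) {r : ℕ} {g : MvPolynomial (Fin l ⊕ Fin m) k} (hg : g ∈ wPart k l m r) :
    pderiv s g = 0 ∨ ∃ r', r' + wps l m s = r ∧ pderiv s g ∈ wPart k l m r' := by
  by_cases h : r < wps l m s
  · exact Or.inl (pderiv_whom (mem_wPart.1 hg) s h)
  · refine Or.inr ⟨r - wps l m s, by omega, ?_⟩
    exact mem_wPart.2 ((mem_wPart.1 hg).pderiv (by omega))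

theorem DD_T0 (n : ℕ) : ∀ v ∈ TT k l m n 0, DD k l m v = 0 := by
  refine TT_le (DD k l m) ⊥ ?_
  intro x hx r g hg hr
  rw [Submodule.mem_bot, DD_tmul]
  simp only [cOp_ep_zero _ hx, zero_tmul, Finset.sum_const_zero, smul_zero, add_zero]

theorem DD_T1 (n p : ℕ) : ∀ v ∈ TT k l m n (p + 1), DD k l m v ∈ TT k l m n p := by
  refine TT_le (DD k l m) _ ?_
  intro x hx r g hg hr
  rw [DD_tmul]
  refine Submodule.add_mem _ (Submodule.smul_mem _ _ (Submodule.sum_mem _ fun i _ =>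
    Submodule.sum_mem _ fun j _ => ?_)) (Submodule.sum_mem _ fun a _ => ?_)
  · rw [mul_assoc]
    exact TT_mem (cOp_ep _ p hx) (X_wPart _ (X_wPart _ hg rfl) rfl) (by rw [wps_inl, wps_inl]; omega)
  · exact TT_mem (cOp_ep _ p hx) (X_wPart _ hg rfl) (by rw [wps_inr]; omega)

theorem hx_T (n p : ℕ) : ∀ v ∈ TT k l m n p, hx (op_e k l m) (op_P k l m) v ∈ TT k l m n (p + 1) := by
  refine TT_le _ _ ?_
  intro x hx r g hg hr
  simp only [_root_.hx, LinearMap.sum_apply, Module.End.mul_apply, op_P_tmul, op_e_tmul]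
  refine Submodule.sum_mem _ fun i _ => Submodule.sum_mem _ fun j _ => ?_
  rcases P_wPart (Sum.inl j) hg with h | ⟨r', h', h⟩
  · rw [h, map_zero, tmul_zero]; exact Submodule.zero_mem _
  rcases P_wPart (Sum.inl i) h with h1 | ⟨r'', h1', h1⟩
  · rw [h1, tmul_zero]; exact Submodule.zero_mem _
  rw [wps_inl] at h' h1'
  exact TT_mem (ep_ι_mul _ hx) h1 (by omega)

theorem hy_T (n p : ℕ) : ∀ v ∈ TT k l m n p, hy (op_n k l m) (op_Q k l m) v ∈ TT k l m n (p + 1) := by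
  refine TT_le _ _ ?_
  intro x hx r g hg hr
  simp only [hy, LinearMap.sum_apply, Module.End.mul_apply, op_Q_tmul, op_n_tmul]
  refine Submodule.sum_mem _ fun i _ => ?_
  rcases P_wPart (Sum.inr i) hg with h | ⟨r', h', h⟩
  · rw [h, tmul_zero]; exact Submodule.zero_mem _
  rw [wps_inr] at h'
  exact TT_mem (ep_ι_mul _ hx) h (by omega)

/-- the gl operators -/
noncomputable abbrev EE (k : Type) [Field k] (l m : ℕ) : Fin l → Fin l → Module.End k (VV k l m) :=
  Eo (op_e k l m) (op_f k l m) (op_X k l m) (op_P k l m)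

/-- the y-degree operator -/
noncomputable abbrev NN (k : Type) [Field k] (l m : ℕ) : Module.End k (VV k l m) :=
  Ny (op_n k l m) (op_p k l m) (op_Y k l m) (op_Q k l m)

theorem EE_tmul (i j : Fin l) (x : ExteriorAlgebra k (wPart k l m 2)) (g : MvPolynomial (Fin l ⊕ Fin m) k) :
    EE k l m i j (x ⊗ₜ g) = x ⊗ₜ (X (Sum.inl i) * pderiv (Sum.inl j) g) +
      (∑ b, ExteriorAlgebra.ι k (xxv k l m i b) * cOp k (thv k l m b j) x) ⊗ₜ g := by
  simp only [Eo, Ff, LinearMap.add_apply, LinearMap.sum_apply, Module.End.mul_apply, op_P_tmul, op_X_tmul,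
    op_e_tmul, op_f_tmul, sum_tmul]

theorem NN_tmul (x : ExteriorAlgebra k (wPart k l m 2)) (g : MvPolynomial (Fin l ⊕ Fin m) k) :
    NN k l m (x ⊗ₜ g) = x ⊗ₜ (∑ a, X (Sum.inr a) * pderiv (Sum.inr a) g) +
      (∑ a, ExteriorAlgebra.ι k (yyv k l m a) * cOp k (psv k l m a) x) ⊗ₜ g := by
  simp only [Ny, LinearMap.add_apply, LinearMap.sum_apply, Module.End.mul_apply, op_Q_tmul, op_Y_tmul,
    op_n_tmul, op_p_tmul, sum_tmul, tmul_sum, Finset.sum_add_distrib]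

theorem EE_T (n p : ℕ) (i j : Fin l) : ∀ v ∈ TT k l m n p, EE k l m i j v ∈ TT k l m n p := by
  refine TT_le _ _ ?_
  intro x hx r g hg hr
  rw [EE_tmul, sum_tmul]
  refine Submodule.add_mem _ ?_ (Submodule.sum_mem _ fun b _ => ?_)
  · rcases P_wPart (Sum.inl j) hg with h | ⟨r', h', h⟩
    · rw [h, mul_zero, tmul_zero]; exact Submodule.zero_mem _
    rw [wps_inl] at h'
    exact TT_mem hx (X_wPart _ h rfl) (by rw [wps_inl]; omega)
  · cases p with
    | zero => rw [cOp_ep_zero _ hx, mul_zero, zero_tmul]; exact Submodule.zero_mem _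
    | succ p => exact TT_mem (ep_ι_mul _ (cOp_ep _ p hx)) hg hr

end Stab

section WBasis
variable {k : Type} [Field k] {l m : ℕ}

/-- index set for the basis of linear forms -/
abbrev JJ (l m : ℕ) : Type := {a : Fin l × Fin l // a ∈ lePrs l} ⊕ Fin m

/-- basis vectors of linear forms -/
noncomputable def bv (k : Type) [Field k] (l m : ℕ) : JJ l m → wPart k l m 2 :=
  Sum.elim (fun a => xxv k l m a.1.1 a.1.2) (fun a => yyv k l m a)

/-- dual vectors -/
noncomputable def bvd (k : Type) [Field k] (l m : ℕ) : JJ l m → Module.Dual k (wPart k l m 2) :=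
  Sum.elim (fun a => thv k l m a.1.1 a.1.2) (fun a => psv k l m a)

/-- weights of basis vectors -/
noncomputable def bwt (l m : ℕ) : JJ l m → Fin l →₀ ℕ :=
  Sum.elim (fun a => Finsupp.single a.1.1 1 + Finsupp.single a.1.2 1) (fun _ => 0)

/-- y-degrees of basis vectors -/
def bnu (l m : ℕ) : JJ l m → ℕ := Sum.elim (fun _ => 0) (fun _ => 1)

theorem bvd_ne [CharZero k] (s : JJ l m) : bvd k l m s (bv k l m s) ≠ 0 := by
  have h := WD_conc (k := k) (l := l) (m := m)
  rcases s with ⟨⟨i, j⟩, ha⟩ | a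
  · simp only [bvd, bv, Sum.elim_inl, h.tx, dl]
    by_cases hij : i = j
    · simp [hij, one_add_one_eq_two]
    · simp [hij]
  · simp [bvd, bv, h.py, dl]

theorem bvd_zero (s t : JJ l m) (hst : s ≠ t) : bvd k l m s (bv k l m t) = 0 := by
  have h := WD_conc (k := k) (l := l) (m := m)
  rcases s with ⟨⟨i, j⟩, ha⟩ | a <;> rcases t with ⟨⟨i', j'⟩, ha'⟩ | a'
  · simp only [bvd, bv, Sum.elim_inl, h.tx, dl]
    simp only [ne_eq, Sum.inl.injEq, Subtype.mk.injEq, Prod.mk.injEq, not_and] at hst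
    simp only [lePrs, Finset.mem_filter, Finset.mem_univ, true_and] at ha ha'
    by_cases h1 : i = i'
    · simp only [hst h1, if_false, mul_zero, zero_add]
      by_cases h2 : i = j'
      · by_cases h3 : j = i'
        · exfalso; apply hst h1; rw [h3, ← h1, h2]
        · simp [h3]
      · simp [h2]
    · simp only [h1, if_false, zero_mul, zero_add]
      by_cases h2 : i = j'
      · by_cases h3 : j = i'
        · exfalso; apply h1; subst h2 h3; exact le_antisymm ha ha'
        · simp [h3]
      · simp [h2]
  · simp [bvd, bv, h.ty]
  · simp [bvd, bv, h.px]
  · have : a ≠ a' := fun e => hst (by rw [e])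
    simp [bvd, bv, h.py, dl, this]

theorem bv_li [CharZero k] : LinearIndependent k (bv k l m) := by
  rw [Fintype.linearIndependent_iff]
  intro c hc s
  have := congrArg (bvd k l m s) hc
  rw [map_sum, map_zero, Finset.sum_eq_single s] at this
  · rw [map_smul, smul_eq_mul] at this
    exact (mul_eq_zero.1 this).resolve_right (bvd_ne s)
  · intro t _ ht
    rw [map_smul, bvd_zero s t ht.symm, smul_zero]
  · simp

theorem bv_span [CharZero k] : ⊤ ≤ Submodule.span k (Set.range (bv k l m)) := by
  rintro w -
  have e : w = (2⁻¹ : k) • (∑ i, ∑ j, thv k l m i j w • xxv k l m i j) +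
      ∑ a, psv k l m a w • yyv k l m a := by
    apply Subtype.ext
    refine (key_W w).trans ?_
    simp [xxv, yyv]
  rw [e]
  refine Submodule.add_mem _ (Submodule.smul_mem _ _ (Submodule.sum_mem _ fun i _ =>
    Submodule.sum_mem _ fun j _ => Submodule.smul_mem _ _ (Submodule.subset_span ?_)))
    (Submodule.sum_mem _ fun a _ => Submodule.smul_mem _ _ (Submodule.subset_span ⟨Sum.inr a, rfl⟩))
  rcases le_total i j with h | h
  · exact ⟨Sum.inl ⟨(i, j), by simpa [lePrs] using h⟩, rfl⟩
  · refine ⟨Sum.inl ⟨(j, i), by simpa [lePrs] using h⟩, ?_⟩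
    exact WD_conc.xs j i

/-- the basis of linear forms -/
noncomputable def bB (k : Type) [Field k] [CharZero k] (l m : ℕ) : Module.Basis (JJ l m) k (wPart k l m 2) :=
  Module.Basis.mk bv_li bv_span

theorem bB_apply [CharZero k] (s : JJ l m) : bB k l m s = bv k l m s := by
  simp [bB]

theorem bv_wt (i : Fin l) (s : JJ l m) :
    ∑ b, thv k l m b i (bv k l m s) • xxv k l m i b = (bwt l m s i : k) • bv k l m s := by
  have h := WD_conc (k := k) (l := l) (m := m)
  rcases s with ⟨⟨a, a'⟩, ha⟩ | a
  · simp only [bv, bwt, Sum.elim_inl, h.tx, add_smul, Finset.sum_add_distrib]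
    have e1 : ∑ b, (dl k b a * dl k i a') • xxv k l m i b = dl k i a' • xxv k l m a a' := by
      rw [Finset.sum_eq_single a]
      · rw [dl_self, one_mul]
        by_cases hi : i = a'
        · rw [hi, h.xs]
        · simp [dl, hi]
      · intro b _ hb; simp [dl, hb]
      · simp
    have e2 : ∑ b, (dl k b a' * dl k i a) • xxv k l m i b = dl k i a • xxv k l m a a' := by
      rw [Finset.sum_eq_single a']
      · rw [dl_self, one_mul]
        by_cases hi : i = a
        · rw [hi]
        · simp [dl, hi]
      · intro b _ hb; simp [dl, hb]
      · simp
    rw [e1, e2, ← add_smul]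
    congr 1
    simp only [dl, Finsupp.add_apply, Finsupp.single_apply, Nat.cast_add, Nat.cast_ite, Nat.cast_one,
      Nat.cast_zero, @eq_comm _ a i, @eq_comm _ a' i]
    exact add_comm _ _
  · simp [bv, bwt, h.ty]

theorem bv_nu (s : JJ l m) :
    ∑ a, psv k l m a (bv k l m s) • yyv k l m a = (bnu l m s : k) • bv k l m s := by
  have h := WD_conc (k := k) (l := l) (m := m)
  rcases s with ⟨⟨a, a'⟩, ha⟩ | a
  · simp [bv, bnu, h.px]
  · simp [bv, bnu, h.py, dl]

end WBasis

section Diag2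
variable {k : Type} [Field k] {W : Type} [AddCommGroup W] [Module k W]

theorem diag_ιMulti {B : Type} [Fintype B] (u : B → W) (d : B → Module.Dual k W) (p : ℕ) (v : Fin p → W)
    (c : Fin p → k) (hv : ∀ j, ∑ b, d b (v j) • u b = c j • v j) :
    ∑ b, ExteriorAlgebra.ι k (u b) * cOp k (d b) (ExteriorAlgebra.ιMulti k p v) =
      (∑ j, c j) • ExteriorAlgebra.ιMulti k p v := by
  induction p with
  | zero =>
    simp only [ExteriorAlgebra.ιMulti_zero_apply, cOp_one]
    simp
  | succ p ih =>
    have ih' := ih (Matrix.vecTail v) (fun j => c j.succ) (fun j => hv j.succ)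
    rw [ExteriorAlgebra.ιMulti_succ_apply]
    have : ∀ b, ExteriorAlgebra.ι k (u b) * cOp k (d b) (ExteriorAlgebra.ι k (v 0) *
          ExteriorAlgebra.ιMulti k p (Matrix.vecTail v)) =
        ExteriorAlgebra.ι k (d b (v 0) • u b) * ExteriorAlgebra.ιMulti k p (Matrix.vecTail v) +
        ExteriorAlgebra.ι k (v 0) * (ExteriorAlgebra.ι k (u b) *
          cOp k (d b) (ExteriorAlgebra.ιMulti k p (Matrix.vecTail v))) := by
      intro b
      rw [cOp_ι_mul, mul_sub, mul_smul_comm, map_smul, smul_mul_assoc, sub_eq_add_neg]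
      congr 1
      rw [← mul_assoc, ← mul_assoc, ← neg_mul]
      congr 1
      exact (eq_neg_of_add_eq_zero_left (ExteriorAlgebra.ι_add_mul_swap (R := k) (v 0) (u b))).symm
    simp only [this]
    rw [Finset.sum_add_distrib, ← Finset.sum_mul, ← map_sum, hv 0, ← Finset.mul_sum, ih', Fin.sum_univ_succ,
      map_smul, smul_mul_assoc, mul_smul_comm, ← add_smul]

end Diag2

section TBasis
variable {k : Type} [Field k] {l m : ℕ}
open TensorProduct

/-- exponents of weight `r` -/
abbrev Mon (l m r : ℕ) : Type := {s : (Fin l ⊕ Fin m) →₀ ℕ // Finsupp.weight (wps l m) s = r}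

noncomputable instance MonFintype (l m r : ℕ) : Fintype (Mon l m r) := by
  have : Finite (Mon l m r) :=
    (Finsupp.finite_of_nat_weight_eq (wps l m) (fun s => (wps_pos s).ne') r).to_subtype
  exact Fintype.ofFinite _

/-- x-exponents -/
noncomputable def xdeg (s : (Fin l ⊕ Fin m) →₀ ℕ) : Fin l →₀ ℕ :=
  Finsupp.equivFunOnFinite.symm fun i => s (Sum.inl i)

theorem xdeg_apply (s : (Fin l ⊕ Fin m) →₀ ℕ) (i : Fin l) : xdeg s i = s (Sum.inl i) := rfl

theorem weight_wps (s : (Fin l ⊕ Fin m) →₀ ℕ) :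
    Finsupp.weight (wps l m) s = ∑ i, xdeg s i + 2 * ∑ a, s (Sum.inr a) := by
  rw [Finsupp.weight_apply, Finsupp.sum_fintype _ _ (by simp), Fintype.sum_sum_type, Finset.mul_sum]
  simp [wps_inl, wps_inr, xdeg_apply, mul_comm]

theorem wPart_span {r : ℕ} {g : MvPolynomial (Fin l ⊕ Fin m) k} (hg : g ∈ wPart k l m r) :
    g ∈ Submodule.span k (Set.range fun s : Mon l m r => (monomial s.1 (1 : k))) := by
  rw [g.as_sum]
  refine Submodule.sum_mem _ fun s hs => ?_
  have h1 : Finsupp.weight (wps l m) s = r := (mem_wPart.1 hg) (mem_support_iff.1 hs)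
  rw [← mul_one (coeff s g), ← smul_eq_mul, ← smul_monomial]
  exact Submodule.smul_mem _ _ (Submodule.subset_span ⟨⟨s, h1⟩, rfl⟩)

theorem mon_li (r : ℕ) : LinearIndependent k (fun s : Mon l m r => (monomial s.1 (1 : k))) := by
  have h := (basisMonomials (Fin l ⊕ Fin m) k).linearIndependent
  rw [coe_basisMonomials] at h
  exact h.comp (Subtype.val : Mon l m r → _) Subtype.val_injective

theorem hsym_mon (r : ℕ) :
    ∑ s : Mon l m r, (if ∑ a, s.1 (Sum.inr a) = 0 then monomial (xdeg s.1) (1 : k) else 0) = hsym k l r := by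
  rw [hsym, ← Finset.sum_filter]
  refine Finset.sum_bij (fun s _ => xdeg s.1) ?_ ?_ ?_ ?_
  · intro s hs
    rw [Finset.mem_filter] at hs
    have := weight_wps s.1
    rw [hs.2, s.2] at this
    rw [Finset.mem_finsuppAntidiag]
    have h9 : ∑ i, xdeg s.1 i = r := by omega
    exact ⟨h9, Finset.subset_univ _⟩
  · intro s hs t ht hst
    apply Subtype.ext
    ext (i | a)
    · rw [← xdeg_apply, hst, xdeg_apply]
    · rw [Finset.mem_filter] at hs ht
      rw [Finset.sum_eq_zero_iff.1 hs.2 a (Finset.mem_univ _), Finset.sum_eq_zero_iff.1 ht.2 a (Finset.mem_univ _)]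
  · intro β hβ
    rw [Finset.mem_finsuppAntidiag] at hβ
    let s : (Fin l ⊕ Fin m) →₀ ℕ := Finsupp.equivFunOnFinite.symm (Sum.elim β 0)
    have h1 : xdeg s = β := by ext i; rfl
    have h2 : ∑ a, s (Sum.inr a) = 0 := Finset.sum_eq_zero fun a _ => rfl
    refine ⟨⟨s, ?_⟩, ?_, h1⟩
    · have h9 : ∑ i, β i = r := hβ.1
      rw [weight_wps, h1, h2]; omega
    · rw [Finset.mem_filter]; exact ⟨Finset.mem_univ _, h2⟩
  · intro s _; rfl

variable {J : Type} [LinearOrder J] [Fintype J] (B : Module.Basis J k (wPart k l m 2))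
  (wtJ : J → Fin l →₀ ℕ) (nuJ : J → ℕ)

/-- basis of Koszul terms -/
noncomputable def tb (p r : ℕ) (s : Set.powersetCard J p × Mon l m r) : VV k l m :=
  (ExteriorAlgebra.ιMulti k p (B ∘ Set.powersetCard.ofFinEmbEquiv.symm s.1)) ⊗ₜ (monomial s.2.1 (1 : k))

theorem ep_li (p : ℕ) : LinearIndependent k fun S : Set.powersetCard J p =>
      (ExteriorAlgebra.ιMulti k p (B ∘ Set.powersetCard.ofFinEmbEquiv.symm S)) := by
  have := (B.exteriorPower p).linearIndependent.map' (⋀[k]^p (wPart k l m 2)).subtype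
    (Submodule.ker_subtype _)
  rw [exteriorPower.coe_basis] at this
  exact this

set_option maxHeartbeats 1000000 in
theorem tb_li (p r : ℕ) : LinearIndependent k (tb B p r) := by
  have := LinearIndependent.tmul_of_flat_left (ep_li B p) (mon_li (k := k) (l := l) (m := m) r)
  unfold tb
  exact this

theorem ep_span (p : ℕ) {x : ExteriorAlgebra k (wPart k l m 2)}
    (hx : x ∈ (⋀[k]^p (wPart k l m 2) : Submodule k (ExteriorAlgebra k (wPart k l m 2)))) :
    x ∈ Submodule.span k (Set.range fun S : Set.powersetCard J p =>
      (ExteriorAlgebra.ιMulti k p (B ∘ Set.powersetCard.ofFinEmbEquiv.symm S))) := by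
  have h1 : (⟨x, hx⟩ : ⋀[k]^p (wPart k l m 2)) ∈ Submodule.span k (Set.range (B.exteriorPower p)) := by
    rw [Module.Basis.span_eq]; trivial
  rw [exteriorPower.coe_basis] at h1
  have h2 := Submodule.mem_map_of_mem (f := (⋀[k]^p (wPart k l m 2)).subtype) h1
  rw [Submodule.map_span, ← Set.range_comp] at h2
  exact h2

theorem tb_mem {n p r : ℕ} (hr : 2 * p + r = n) (s : Set.powersetCard J p × Mon l m r) :
    tb B p r s ∈ TT k l m n p := by
  refine TT_mem (r := r) (ExteriorAlgebra.ιMulti_range k p (Set.mem_range_self _)) ?_ hr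
  exact mem_wPart.2 (isWeightedHomogeneous_monomial _ _ _ s.2.2)

theorem tb_span {n p r : ℕ} (hr : 2 * p + r = n) :
    TT k l m n p = Submodule.span k (Set.range (tb B p r)) := by
  apply le_antisymm
  · rw [TT, Submodule.span_le]
    rintro _ ⟨x, hx, r', g, hg, hr', rfl⟩
    obtain rfl : r = r' := by omega
    have h1 := ep_span B p hx
    have h2 := wPart_span hg
    clear hx
    induction h1 using Submodule.span_induction with
    | mem x hx' =>
      obtain ⟨S, rfl⟩ := hx'
      clear hg
      induction h2 using Submodule.span_induction with
      | mem g hg' =>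
        obtain ⟨s, rfl⟩ := hg'
        exact Submodule.subset_span ⟨(S, s), rfl⟩
      | zero => rw [tmul_zero]; exact Submodule.zero_mem _
      | add g h _ _ hg hh => rw [tmul_add]; exact Submodule.add_mem _ hg hh
      | smul c g _ hg => rw [tmul_smul]; exact Submodule.smul_mem _ c hg
    | zero => rw [zero_tmul]; exact Submodule.zero_mem _
    | add x y hx1 hy1 hx2 hy2 =>
      rw [add_tmul]
      exact Submodule.add_mem _ hx2 hy2
    | smul c x _ hx2 => rw [← smul_tmul']; exact Submodule.smul_mem _ c hx2
  · rw [Submodule.span_le]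
    rintro _ ⟨s, rfl⟩
    exact tb_mem B hr s

/-- weights of basis of Koszul terms -/
noncomputable def twt (p r : ℕ) (s : Set.powersetCard J p × Mon l m r) : Fin l →₀ ℕ :=
  ∑ t ∈ s.1.1, wtJ t + xdeg s.2.1

/-- y-degrees of basis of Koszul terms -/
noncomputable def tnu (p r : ℕ) (s : Set.powersetCard J p × Mon l m r) : ℕ :=
  ∑ t ∈ s.1.1, nuJ t + ∑ a, s.2.1 (Sum.inr a)

theorem sum_emb {M : Type} [AddCommMonoid M] (p : ℕ) (S : Set.powersetCard J p) (f : J → M) :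
    ∑ j : Fin p, f (Set.powersetCard.ofFinEmbEquiv.symm S j) = ∑ t ∈ S.1, f t := by
  refine (Finset.sum_map Finset.univ (Set.powersetCard.ofFinEmbEquiv.symm S).toEmbedding f).symm.trans ?_
  congr 1
  ext t
  rw [Finset.mem_map]
  have := Set.powersetCard.mem_range_ofFinEmbEquiv_symm_iff_mem S t
  simp only [Finset.mem_univ, true_and]
  exact this

theorem tb_E (hwt : ∀ i s, ∑ b, thv k l m b i (B s) • xxv k l m i b = (wtJ s i : k) • B s)
    (p r : ℕ) (i : Fin l) (s : Set.powersetCard J p × Mon l m r) :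
    EE k l m i i (tb B p r s) = (twt wtJ p r s i : k) • tb B p r s := by
  rw [tb, EE_tmul, diag_ιMulti (fun b => xxv k l m i b) (fun b => thv k l m b i) p (B ∘ Set.powersetCard.ofFinEmbEquiv.symm s.1)
    (fun j => (wtJ (Set.powersetCard.ofFinEmbEquiv.symm s.1 j) i : k)) (fun j => hwt i _),
    sum_emb p s.1 (fun t => (wtJ t i : k)), X_mul_pderiv_monomial, twt, Finsupp.add_apply,
    Finsupp.finsetSum_apply, xdeg_apply, Nat.cast_add, Nat.cast_sum, add_smul, add_comm, smul_tmul', ← Nat.cast_smul_eq_nsmul k,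
    tmul_smul]

theorem tb_N (hnu : ∀ s, ∑ a, psv k l m a (B s) • yyv k l m a = (nuJ s : k) • B s)
    (p r : ℕ) (s : Set.powersetCard J p × Mon l m r) :
    NN k l m (tb B p r s) = (tnu nuJ p r s : k) • tb B p r s := by
  rw [tb, NN_tmul, diag_ιMulti (fun a => yyv k l m a) (fun b => psv k l m b) p (B ∘ Set.powersetCard.ofFinEmbEquiv.symm s.1)
    (fun j => (nuJ (Set.powersetCard.ofFinEmbEquiv.symm s.1 j) : k)) (fun j => hnu _),
    sum_emb p s.1 (fun t => (nuJ t : k))]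
  simp only [X_mul_pderiv_monomial]
  rw [tnu, Nat.cast_add, Nat.cast_sum, add_smul, add_comm, smul_tmul', ← Finset.sum_smul,
    ← Nat.cast_smul_eq_nsmul k, tmul_smul]

theorem twt_sum (h2 : ∀ t, nuJ t = 0 → ∑ i, wtJ t i = 2) {n p r : ℕ} (hr : 2 * p + r = n)
    (s : Set.powersetCard J p × Mon l m r) (hs : tnu nuJ p r s = 0) : ∑ i, twt wtJ p r s i = n := by
  rw [tnu, Nat.add_eq_zero_iff] at hs
  have h1 := weight_wps s.2.1
  rw [s.2.2, hs.2] at h1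
  simp only [twt, Finsupp.add_apply, Finset.sum_add_distrib, Finsupp.finsetSum_apply]
  rw [Finset.sum_comm, Finset.sum_congr rfl fun t ht => h2 t (Finset.sum_eq_zero_iff.1 hs.1 t ht),
    Finset.sum_const, s.1.2]
  simp only [smul_eq_mul]
  omega

theorem tb_chi (p r : ℕ) :
    (∑ s : Set.powersetCard J p × Mon l m r, if tnu nuJ p r s = 0 then monomial (twt wtJ p r s) (1 : k) else 0) =
    (∑ S ∈ (Finset.univ : Finset J).powersetCard p, ∏ t ∈ S, if nuJ t = 0 then monomial (wtJ t) (1 : k) else 0) *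
      hsym k l r := by
  rw [← hsym_mon (m := m), Fintype.sum_prod_type]
  have h1 : ∀ F : Finset J → MvPolynomial (Fin l) k, ∑ S ∈ (Finset.univ : Finset J).powersetCard p, F S =
      ∑ S : Set.powersetCard J p, F S.1 := by
    intro F
    refine (Finset.sum_subtype _ (fun S => ?_) F)
    rw [Finset.mem_powersetCard]
    exact ⟨fun h => h.2, fun h => ⟨Finset.subset_univ _, h⟩⟩
  rw [h1, Finset.sum_mul_sum]
  refine Finset.sum_congr rfl fun S _ => Finset.sum_congr rfl fun s _ => ?_
  have h3 : ∀ U : Finset J, ∏ t ∈ U, (if nuJ t = 0 then monomial (wtJ t) (1 : k) else 0) =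
      if ∑ t ∈ U, nuJ t = 0 then monomial (∑ t ∈ U, wtJ t) 1 else 0 := by
    intro U
    split_ifs with h
    · rw [Finset.prod_congr rfl fun t ht => if_pos (Finset.sum_eq_zero_iff.1 h t ht), ← monomial_sum_one]
    · have : ∃ t ∈ U, nuJ t ≠ 0 := by
        by_contra! h'
        exact h (Finset.sum_eq_zero h')
      obtain ⟨t, ht, h''⟩ := this
      exact Finset.prod_eq_zero ht (if_neg h'')
  rw [h3, tnu, twt]
  by_cases ha : ∑ t ∈ S.1, nuJ t = 0 <;> by_cases hb : ∑ a, s.1 (Sum.inr a) = 0 <;>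
    simp only [ha, hb, if_true, if_false, add_zero, zero_add, mul_zero, zero_mul, Nat.add_eq_zero_iff, and_true, and_false, false_and]
  rw [monomial_mul, one_mul]

end TBasis

section Main
variable {k : Type} [Field k] {l m : ℕ}

theorem esym_JJ (p : ℕ) :
    (∑ S ∈ (Finset.univ : Finset (JJ l m)).powersetCard p, ∏ t ∈ S,
      if bnu l m t = 0 then monomial (bwt l m t) (1 : k) else 0) = esym k l p := by
  classical
  have hsub : ((Finset.univ : Finset {a : Fin l × Fin l // a ∈ lePrs l}).map
      (Function.Embedding.inl (β := Fin m))).powersetCard p ⊆ (Finset.univ : Finset (JJ l m)).powersetCard p :=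
    Finset.powersetCard_mono (Finset.subset_univ _)
  rw [← Finset.sum_subset hsub]
  · rw [Finset.powersetCard_map, Finset.sum_map, esym]
    have h2 : lePrs l = (Finset.univ : Finset {a : Fin l × Fin l // a ∈ lePrs l}).map
        (Function.Embedding.subtype _) := by
      ext a; simp
    conv_rhs => rw [h2, Finset.powersetCard_map, Finset.sum_map]
    refine Finset.sum_congr rfl fun S _ => ?_
    simp only [Finset.mapEmbedding_apply, RelEmbedding.coe_toEmbedding, Finset.prod_map]
    refine Finset.prod_congr rfl fun a _ => ?_
    simp only [Function.Embedding.inl_apply, bnu, bwt, Sum.elim_inl, if_true, Function.Embedding.subtype_apply]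
    rw [X, X, monomial_mul, one_mul]
  · intro S hS hS'
    rw [Finset.mem_powersetCard] at hS hS'
    have : ¬ S ⊆ (Finset.univ : Finset {a : Fin l × Fin l // a ∈ lePrs l}).map
      (Function.Embedding.inl (β := Fin m)) := fun h => hS' ⟨h, hS.2⟩
    rw [Finset.not_subset] at this
    obtain ⟨t, ht, ht'⟩ := this
    refine Finset.prod_eq_zero ht ?_
    rcases t with a | a
    · exact absurd (Finset.mem_map.2 ⟨a, Finset.mem_univ _, rfl⟩) ht'
    · simp [bnu]

theorem bwt_two (t : JJ l m) (ht : bnu l m t = 0) : ∑ i, bwt l m t i = 2 := by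
  rcases t with a | a
  · simp [bwt, Finset.sum_add_distrib, Finsupp.single_apply]
  · simp [bnu] at ht

theorem GlMod_bot {V : Type} [AddCommGroup V] [Module k V] (E : Fin l → Fin l → Module.End k V)
    (h : GlRel E) (n : ℕ) : GlMod E n (⊥ : Submodule k V) where
  rel := h
  fin := inferInstance
  stable := by rintro i j v hv; rw [Submodule.mem_bot] at hv; simp [hv]
  wts := by intro v hv h0; exact absurd ((Submodule.mem_bot k).1 hv) h0
  ss := by rintro v hv i c -; rw [Submodule.mem_bot] at hv; simp [hv]

theorem tb_all [CharZero k] {J : Type} [LinearOrder J] [Fintype J] (B : Module.Basis J k (wPart k l m 2))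
    (wtJ : J → Fin l →₀ ℕ) (nuJ : J → ℕ)
    (hwt : ∀ i s, ∑ b, thv k l m b i (B s) • xxv k l m i b = (wtJ s i : k) • B s)
    (hnu : ∀ s, ∑ a, psv k l m a (B s) • yyv k l m a = (nuJ s : k) • B s)
    (h2 : ∀ t, nuJ t = 0 → ∑ i, wtJ t i = 2)
    (hes : ∀ p, (∑ S ∈ (Finset.univ : Finset J).powersetCard p, ∏ t ∈ S,
      if nuJ t = 0 then monomial (wtJ t) (1 : k) else 0) = esym k l p) (n p r : ℕ) (hr : n = 2 * p + r) :
    FiniteDimensional k (TT k l m n p) ∧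
    GlMod (EE k l m) n (TT k l m n p ⊓ (NN k l m).maxGenEigenspace 0) ∧
    (∀ v ∈ TT k l m n p ⊓ (NN k l m).maxGenEigenspace 0, ∑ i, EE k l m i i v = (n : k) • v) ∧
    chi (EE k l m) n (TT k l m n p ⊓ (NN k l m).maxGenEigenspace 0) = esym k l p * hsym k l r := by
  have hst := EE_T (k := k) (l := l) (m := m) n p
  rw [tb_span B hr.symm] at hst ⊢
  have hM := diag_GlMod (tb B p r) (tb_li B p r) (twt wtJ p r) (tnu nuJ p r) (EE k l m) (NN k l m)
    (tb_E B wtJ hwt p r) (tb_N B nuJ hnu p r) (glRel_of_CC CC_conc) (CC_conc.ENy) n hst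
    (twt_sum wtJ nuJ h2 hr.symm)
  refine ⟨FiniteDimensional.span_of_finite k (Set.finite_range _), hM, ?_, ?_⟩
  · exact diag_deg (tb B p r) (tb_li B p r) (twt wtJ p r) (tnu nuJ p r) (EE k l m) (NN k l m)
      (tb_E B wtJ hwt p r) (tb_N B nuJ hnu p r) n (twt_sum wtJ nuJ h2 hr.symm)
  · rw [diag_chi (tb B p r) (tb_li B p r) (twt wtJ p r) (tnu nuJ p r) (EE k l m) (NN k l m)
      (tb_E B wtJ hwt p r) (tb_N B nuJ hnu p r) n hM, tb_chi, hes]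

theorem tt_all [CharZero k] (n p r : ℕ) (hr : n = 2 * p + r) :
    FiniteDimensional k (TT k l m n p) ∧
    GlMod (EE k l m) n (TT k l m n p ⊓ (NN k l m).maxGenEigenspace 0) ∧
    (∀ v ∈ TT k l m n p ⊓ (NN k l m).maxGenEigenspace 0, ∑ i, EE k l m i i v = (n : k) • v) ∧
    chi (EE k l m) n (TT k l m n p ⊓ (NN k l m).maxGenEigenspace 0) = esym k l p * hsym k l r := by
  refine @tb_all k _ l m _ (JJ l m) (LinearOrder.lift' (Fintype.equivFin (JJ l m)) (Equiv.injective _))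
    _ (bB k l m) (bwt l m) (bnu l m) ?_ ?_ bwt_two esym_JJ n p r hr
  · intro i s; rw [bB_apply]; exact bv_wt i s
  · intro s; rw [bB_apply]; exact bv_nu s

theorem tt_fin [CharZero k] (n p : ℕ) : FiniteDimensional k (TT k l m n p) := by
  rcases lt_or_ge n (2 * p) with h | h
  · rw [TT_bot h]; infer_instance
  · exact (tt_all n p (n - 2 * p) (by omega)).1

theorem main_conc [CharZero k] [IsAlgClosed k] (n p q : ℕ) (hn : n = 2 * p + 2 * q) :
    Module.finrank k ↥(LinearMap.ker (DD k l m) ⊓ TT k l m n p) =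
      Module.finrank k ↥(Submodule.map (DD k l m) (TT k l m n (p + 1))) + veroneseBetti l p q := by
  refine main_abs (CC_conc (k := k) (l := l) (m := m)) n (DD k l m) rfl (TT k l m n) (tt_fin n) (DD_T0 n) (DD_T1 n)
    (hx_T n) (hy_T n) ?_ ?_ (fun p r hr => (tt_all n p r hr).2.2.2) (fun p => TT_bot) p q hn
  · intro p
    rcases lt_or_ge n (2 * p) with h | h
    · rw [TT_bot h, bot_inf_eq]; exact GlMod_bot _ (glRel_of_CC CC_conc) n
    · exact (tt_all n p (n - 2 * p) (by omega)).2.1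
  · intro p
    rcases lt_or_ge n (2 * p) with h | h
    · rw [TT_bot h, bot_inf_eq]; intro v hv; rw [Submodule.mem_bot] at hv; simp [hv]
    · exact (tt_all n p (n - 2 * p) (by omega)).2.2.1
end Main

section Link
variable {k : Type} [Field k] {l m : ℕ}

/-- inclusion of Koszul terms -/
noncomputable def JI (k : Type) [Field k] (l m p r : ℕ) : wKoszulTerm k l m p r →ₗ[k] VV k l m :=
  TensorProduct.map (⋀[k]^p (wPart k l m 2)).subtype (wPart k l m r).subtype

theorem JI_tmul {p r : ℕ} (x : ⋀[k]^p (wPart k l m 2)) (g : wPart k l m r) :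
    JI k l m p r (TensorProduct.tmul k x g) = TensorProduct.tmul k x.1 g.1 := rfl

theorem JI_inj (p r : ℕ) : Function.Injective (JI k l m p r) :=
  TensorProduct.map_injective_of_flat_flat _ _ (Submodule.subtype_injective _) (Submodule.subtype_injective _)

theorem JI_range (n p r : ℕ) (hr : 2 * p + r = n) : LinearMap.range (JI k l m p r) = TT k l m n p := by
  apply le_antisymm
  · rintro _ ⟨z, rfl⟩
    induction z using TensorProduct.induction_on with
    | zero => rw [map_zero]; exact Submodule.zero_mem _
    | tmul x g => rw [JI_tmul]; exact TT_mem x.2 g.2 hr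
    | add x y hx hy => rw [map_add]; exact Submodule.add_mem _ hx hy
  · rw [TT, Submodule.span_le]
    rintro _ ⟨x, hx, r', g, hg, hr', rfl⟩
    obtain rfl : r = r' := by omega
    exact ⟨TensorProduct.tmul k ⟨x, hx⟩ ⟨g, hg⟩, rfl⟩

theorem wWedge_ind (p : ℕ) (C : ⋀[k]^p (wPart k l m 2) → Prop) (h0 : C 0) (ha : ∀ x y, C x → C y → C (x + y))
    (hs : ∀ (c : k) x, C x → C (c • x)) (hw : ∀ v, C (wWedge k l m p v)) (x) : C x := by
  have hx : x ∈ Submodule.span k (Set.range (exteriorPower.ιMulti k p (M := wPart k l m 2))) := by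
    rw [exteriorPower.ιMulti_span]; trivial
  induction hx using Submodule.span_induction with
  | mem x hx => obtain ⟨v, rfl⟩ := hx; exact hw v
  | zero => exact h0
  | add x y _ _ hx hy => exact ha _ _ hx hy
  | smul c x _ hx => exact hs c _ hx

variable [CharZero k] (d : ∀ p q : ℕ, wKoszulTerm k l m (p + 1) (2 * q) →ₗ[k] wKoszulTerm k l m p (2 * q + 2))

theorem JI_d
    (hd : ∀ (p q : ℕ) (v : Fin (p + 1) → wPart k l m 2) (f : wPart k l m (2 * q)),
      d p q (TensorProduct.tmul k (wWedge k l m (p + 1) v) f) =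
        ∑ i : Fin (p + 1), ((-1 : k) ^ (i : ℕ)) •
          TensorProduct.tmul k (wWedge k l m p (fun j => v (i.succAbove j)))
            (wMul k l m (v i) f))
    (p q : ℕ) (z : wKoszulTerm k l m (p + 1) (2 * q)) :
    JI k l m p (2 * q + 2) (d p q z) = DD k l m (JI k l m (p + 1) (2 * q) z) := by
  induction z using TensorProduct.induction_on with
  | zero => simp only [map_zero]
  | tmul x f =>
    induction x using wWedge_ind with
    | h0 => rw [TensorProduct.zero_tmul]; simp only [map_zero]
    | ha x y hx hy => rw [TensorProduct.add_tmul]; simp only [map_add, hx, hy]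
    | hs c x hx =>
      rw [← TensorProduct.smul_tmul']
      rw [LinearMap.map_smul, LinearMap.map_smul, LinearMap.map_smul, LinearMap.map_smul, hx]
    | hw v =>
      rw [hd, map_sum, JI_tmul]
      refine Eq.trans ?_ (DD_ιMulti p v f.1).symm
      refine Finset.sum_congr rfl fun i _ => ?_
      rw [LinearMap.map_smul, JI_tmul]
      rfl
  | add x y hx hy => simp only [map_add, hx, hy]

theorem range_d
    (hd : ∀ (p q : ℕ) (v : Fin (p + 1) → wPart k l m 2) (f : wPart k l m (2 * q)),
      d p q (TensorProduct.tmul k (wWedge k l m (p + 1) v) f) =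
        ∑ i : Fin (p + 1), ((-1 : k) ^ (i : ℕ)) •
          TensorProduct.tmul k (wWedge k l m p (fun j => v (i.succAbove j)))
            (wMul k l m (v i) f))
    (n p q : ℕ) (hn : 2 * (p + 1) + 2 * q = n) :
    Module.finrank k (LinearMap.range (d p q)) =
      Module.finrank k ↥(Submodule.map (DD k l m) (TT k l m n (p + 1))) := by
  have e : Submodule.map (JI k l m p (2 * q + 2)) (LinearMap.range (d p q)) =
      Submodule.map (DD k l m) (TT k l m n (p + 1)) := by
    rw [← JI_range n (p + 1) (2 * q) hn, ← LinearMap.range_comp, ← LinearMap.range_comp]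
    congr 1
    exact LinearMap.ext (JI_d d hd p q)
  rw [← e]
  exact (LinearEquiv.finrank_eq (Submodule.equivMapOfInjective _ (JI_inj p (2 * q + 2)) _))

theorem ker_d
    (hd : ∀ (p q : ℕ) (v : Fin (p + 1) → wPart k l m 2) (f : wPart k l m (2 * q)),
      d p q (TensorProduct.tmul k (wWedge k l m (p + 1) v) f) =
        ∑ i : Fin (p + 1), ((-1 : k) ^ (i : ℕ)) •
          TensorProduct.tmul k (wWedge k l m p (fun j => v (i.succAbove j)))
            (wMul k l m (v i) f))
    (n p q : ℕ) (hn : 2 * (p + 1) + 2 * q = n) :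
    Module.finrank k (LinearMap.ker (d p q)) =
      Module.finrank k ↥(LinearMap.ker (DD k l m) ⊓ TT k l m n (p + 1)) := by
  have e : Submodule.map (JI k l m (p + 1) (2 * q)) (LinearMap.ker (d p q)) =
      LinearMap.ker (DD k l m) ⊓ TT k l m n (p + 1) := by
    rw [← JI_range n (p + 1) (2 * q) hn]
    apply le_antisymm
    · rintro _ ⟨z, hz, rfl⟩
      refine ⟨?_, z, rfl⟩
      have hz' : d p q z = 0 := hz
      change DD k l m _ = 0
      rw [← JI_d d hd, hz', map_zero]
    · rintro _ ⟨hz, z, rfl⟩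
      refine ⟨z, ?_, rfl⟩
      have hz' : DD k l m _ = 0 := hz
      rw [← JI_d d hd] at hz'
      change d p q z = 0
      apply JI_inj p (2 * q + 2)
      rw [hz', map_zero]
  rw [← e]
  exact (LinearEquiv.finrank_eq (Submodule.equivMapOfInjective _ (JI_inj (p + 1) (2 * q)) _))

theorem term_zero (n : ℕ) :
    Module.finrank k (wKoszulTerm k l m 0 n) =
      Module.finrank k ↥(LinearMap.ker (DD k l m) ⊓ TT k l m n 0) := by
  have e : LinearMap.ker (DD k l m) ⊓ TT k l m n 0 = LinearMap.range (JI k l m 0 n) := by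
    rw [JI_range n 0 n (by omega)]
    exact inf_eq_right.2 (fun v hv => DD_T0 n v hv)
  rw [e]
  exact (LinearEquiv.ofInjective _ (JI_inj 0 n)).finrank_eq

end Link

theorem weighted_projective_space_syzygies (k : Type) [Field k] [CharZero k]
    [IsAlgClosed k] (l m : ℕ)
    (d : ∀ p q : ℕ, wKoszulTerm k l m (p + 1) (2 * q) →ₗ[k] wKoszulTerm k l m p (2 * q + 2))
    (hd : ∀ (p q : ℕ) (v : Fin (p + 1) → wPart k l m 2) (f : wPart k l m (2 * q)),
      d p q (TensorProduct.tmul k (wWedge k l m (p + 1) v) f) =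
        ∑ i : Fin (p + 1), ((-1 : k) ^ (i : ℕ)) •
          TensorProduct.tmul k (wWedge k l m p (fun j => v (i.succAbove j)))
            (wMul k l m (v i) f)) :
    (∀ p q : ℕ, Module.finrank k (LinearMap.ker (d p (q + 1))) =
        Module.finrank k (LinearMap.range (d (p + 1) q)) + veroneseBetti l (p + 1) (q + 1)) ∧
    (∀ p : ℕ, Module.finrank k (LinearMap.ker (d p 0)) = veroneseBetti l (p + 1) 0) ∧
    (∀ q : ℕ, Module.finrank k (wKoszulTerm k l m 0 (2 * (q + 1))) =
        Module.finrank k (LinearMap.range (d 0 q)) + veroneseBetti l 0 (q + 1)) ∧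
    Module.finrank k (wKoszulTerm k l m 0 0) = veroneseBetti l 0 0 := by
  refine ⟨fun p q => ?_, fun p => ?_, fun q => ?_, ?_⟩
  · rw [ker_d d hd (2 * (p + 1) + 2 * (q + 1)) p (q + 1) rfl,
      range_d d hd (2 * (p + 1) + 2 * (q + 1)) (p + 1) q (by omega)]
    exact main_conc _ _ _ rfl
  · rw [ker_d d hd (2 * (p + 1) + 2 * 0) p 0 rfl, main_conc _ (p + 1) 0 rfl,
      TT_bot (by omega), Submodule.map_bot, finrank_bot, zero_add]
  · rw [term_zero, range_d d hd (2 * (q + 1)) 0 q (by omega)]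
    exact main_conc _ 0 (q + 1) (by omega)
  · rw [term_zero, main_conc 0 0 0 rfl, TT_bot (by omega), Submodule.map_bot, finrank_bot, zero_add]
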